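/- Fix (α, β, θ) ∈ (0,1)³ with α < η̃^sig_θ(β). Then as p → ∞: (i) if 0 < β < (1−θ)/2, then Hamm_p(Ŝ_*^{(sa)}) → 0; (ii) if (1−θ)/2 < β < 1/2, then Hamm_p(Ŝ_*^{(if)}) → 0; (iii) if 1/2 < β < 1 and q ≥ 3, then Hamm_p(Ŝ_q^{(if)}) → 0. -/

import Mathlib

open MeasureTheory ProbabilityTheory Filter
open scoped ENNReal NNReal Classical BigOperators

namespace ARWPaper

/-- `n = ⌈p^θ⌉`. -/
noncomputable def nDim (p : ℕ) (θ : ℝ) : ℕ := ⌈(p : ℝ) ^ θ⌉₊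

/-- Law of a single class label: uniform on `{-1, 1}`. -/
noncomputable def signLaw : Measure ℝ :=
  (1 / 2 : ℝ≥0∞) • Measure.dirac (1 : ℝ) + (1 / 2 : ℝ≥0∞) • Measure.dirac (-1 : ℝ)

/-- Law of a single coordinate of `μ`: `τ` w.p. `ε`, `0` w.p. `1 - ε`. -/
noncomputable def muLaw (ε τ : ℝ) : Measure ℝ :=
  ENNReal.ofReal (1 - ε) • Measure.dirac (0 : ℝ) + ENNReal.ofReal ε • Measure.dirac τ

/-- Standard Gaussian product measure on `ℝ^n`. -/
noncomputable def gaussPi (n : ℕ) : Measure (Fin n → ℝ) :=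
  Measure.pi fun _ => gaussianReal 0 1

/-- Law of the noise matrix `Z` (i.i.d. `N(0,1)` entries, rows indexed by `Fin n`). -/
noncomputable def noiseLaw (n p : ℕ) : Measure (Fin n → Fin p → ℝ) :=
  Measure.pi fun _ => gaussPi p

/-- Sample space for `(ℓ, μ, Z)`. -/
abbrev Omega (n p : ℕ) := (Fin n → ℝ) × (Fin p → ℝ) × (Fin n → Fin p → ℝ)

/-- Joint law of `(ℓ, μ, Z)`. -/
noncomputable def jointLaw (n p : ℕ) (ε τ : ℝ) : Measure (Omega n p) :=
  (Measure.pi fun _ : Fin n => signLaw).prod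
    ((Measure.pi fun _ : Fin p => muLaw ε τ).prod (noiseLaw n p))

/-- Data matrix `X = ℓ μ' + Z`. -/
def dataMap {n p : ℕ} (ω : Omega n p) : Fin n → Fin p → ℝ :=
  fun i j => ω.1 i * ω.2.1 j + ω.2.2 i j

/-- Hamming clustering error of a clustering procedure `ell`, where the observed data
matrix is `D ω`. -/
noncomputable def hammingClu (n p : ℕ) (ε τ : ℝ)
    (D : Omega n p → Fin n → Fin p → ℝ)
    (ell : (Fin n → Fin p → ℝ) → Fin n → ℝ) : ℝ :=
  (n : ℝ)⁻¹ * min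
    (∑ i : Fin n, ((jointLaw n p ε τ) {ω | ell (D ω) i ≠ ω.1 i}).toReal)
    (∑ i : Fin n, ((jointLaw n p ε τ) {ω | ell (D ω) i ≠ -ω.1 i}).toReal)

/-- Hamming error for signal (support) recovery. -/
noncomputable def hammingSig (n p : ℕ) (ε τ : ℝ)
    (D : Omega n p → Fin n → Fin p → ℝ)
    (S : (Fin n → Fin p → ℝ) → Finset (Fin p)) : ℝ :=
  ((p : ℝ) * ε)⁻¹ * ∑ j : Fin p,
    (((jointLaw n p ε τ) {ω | ω.2.1 j = 0 ∧ j ∈ S (D ω)}).toReal +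
      ((jointLaw n p ε τ) {ω | ω.2.1 j ≠ 0 ∧ j ∉ S (D ω)}).toReal)

/-- Sum of type I and type II testing errors of the rejection region `R`. -/
noncomputable def testErr (n p : ℕ) (ε τ : ℝ)
    (R : Set (Fin n → Fin p → ℝ)) : ℝ :=
  ((noiseLaw n p) R).toReal + ((jointLaw n p ε τ) {ω | dataMap ω ∉ R}).toReal

/-- Statistical boundary for clustering. -/
noncomputable def etaClu (θ β : ℝ) : ℝ :=
  if β < (1 - θ) / 2 then (1 - 2 * β) / 2
  else if β < 1 - θ then θ / 2
  else (1 - β) / 2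

/-- CTUB boundary for clustering. -/
noncomputable def etaCluT (θ β : ℝ) : ℝ :=
  if β < (1 - θ) / 2 then (1 - 2 * β) / 2
  else if β < 1 / 2 then (1 + θ - 2 * β) / 4
  else if β < 1 - θ / 2 then θ / 4
  else (1 - β) / 2

/-- Statistical boundary for signal recovery. -/
noncomputable def etaSig (θ β : ℝ) : ℝ :=
  if β < 1 - θ then θ / 2 else (1 + θ - β) / 4

/-- CTUB boundary for signal recovery. -/
noncomputable def etaSigT (θ β : ℝ) : ℝ :=
  if β < (1 - θ) / 2 then θ / 2
  else if β < 1 / 2 then (1 + θ - 2 * β) / 4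
  else θ / 4

noncomputable def etaHyp1 (θ β : ℝ) : ℝ := (2 + θ - 4 * β) / 4
noncomputable def etaHyp2 (θ β : ℝ) : ℝ := min (θ / 2) ((1 + θ - β) / 4)
noncomputable def etaHyp (θ β : ℝ) : ℝ := max (etaHyp1 θ β) (etaHyp2 θ β)
noncomputable def etaHypT (θ β : ℝ) : ℝ := max (etaHyp1 θ β) (θ / 4)

/-- Standard phase function `ρ*`. -/
noncomputable def rhoStar (b : ℝ) : ℝ :=
  if b < 3 / 4 then b - 1 / 2 else (1 - Real.sqrt (1 - b)) ^ 2

/-- Phase function for IF-PCA. -/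
noncomputable def rhoStarTheta (θ β : ℝ) : ℝ :=
  (1 - θ) * rhoStar (1 / 2 + (β - 1 / 2) / (1 - θ))

/-- Euclidean norm of a vector. -/
noncomputable def l2 {n : ℕ} (v : Fin n → ℝ) : ℝ := Real.sqrt (∑ i, v i ^ 2)

/-- Entrywise sup-norm of a vector. -/
noncomputable def linf {n : ℕ} (v : Fin n → ℝ) : ℝ := ⨆ i, |v i|

/-- `cos(x, y) = |⟨x/‖x‖, y/‖y‖⟩|`. -/
noncomputable def cosv {n : ℕ} (x y : Fin n → ℝ) : ℝ :=
  |∑ i, x i * y i| / (l2 x * l2 y)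

/-- Spectral (operator) norm of a matrix. -/
noncomputable def specNorm {m k : ℕ} (A : Matrix (Fin m) (Fin k) ℝ) : ℝ :=
  sSup ((fun v => l2 (A.mulVec v)) '' {v | l2 v ≤ 1})

/-- Simple Aggregation clustering: entrywise sign of the sum of all columns. -/
noncomputable def ellSimpleAgg {n p : ℕ} (X : Fin n → Fin p → ℝ) : Fin n → ℝ :=
  fun i => Real.sign (∑ j, X i j)

/-- `S` picks, for every data matrix, a size-`N` subset maximizing `‖∑_{j ∈ S} x_j‖₁`. -/
def IsSparseAggMaximizer {n p : ℕ} (N : ℕ)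
    (S : (Fin n → Fin p → ℝ) → Finset (Fin p)) : Prop :=
  ∀ X, (S X).card = N ∧
    ∀ T : Finset (Fin p), T.card = N →
      ∑ i, |∑ j ∈ T, X i j| ≤ ∑ i, |∑ j ∈ S X, X i j|

/-- Sparse Aggregation clustering. -/
noncomputable def ellSparseAgg {n p : ℕ}
    (S : (Fin n → Fin p → ℝ) → Finset (Fin p)) (X : Fin n → Fin p → ℝ) :
    Fin n → ℝ :=
  fun i => Real.sign (∑ j ∈ S X, X i j)

/-- Gram matrix `X X'`. -/
def gram {n p : ℕ} (X : Fin n → Fin p → ℝ) : Matrix (Fin n) (Fin n) ℝ :=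
  Matrix.of fun i i' => ∑ j, X i j * X i' j

/-- `ξ` is a unit eigenvector of `A` associated with its largest eigenvalue. -/
def IsTopEigenvector {n : ℕ} (A : Matrix (Fin n) (Fin n) ℝ) (ξ : Fin n → ℝ) : Prop :=
  (∑ i, ξ i ^ 2) = 1 ∧
    ∃ lam : ℝ, A.mulVec ξ = lam • ξ ∧
      ∀ (lam' : ℝ) (v : Fin n → ℝ), v ≠ 0 → A.mulVec v = lam' • v → lam' ≤ lam

/-- χ²-screening: the set of selected features. -/
noncomputable def chiSel {n p : ℕ} (q : ℝ) (X : Fin n → Fin p → ℝ) : Finset (Fin p) :=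
  Finset.univ.filter fun j =>
    Real.sqrt (2 * q * Real.log p) ≤ ((∑ i, X i j ^ 2) - n) / Real.sqrt (2 * n)

/-- Post-selection Gram matrix `X^{(q)} (X^{(q)})'`. -/
noncomputable def gramSel {n p : ℕ} (q : ℝ) (X : Fin n → Fin p → ℝ) :
    Matrix (Fin n) (Fin n) ℝ :=
  Matrix.of fun i i' => ∑ j ∈ chiSel q X, X i j * X i' j

/-- IF-PCA calibration `τ_p* = p^{-θ/4} (4 r log p)^{1/4}`. -/
noncomputable def tauStar (p : ℕ) (θ r : ℝ) : ℝ :=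
  (p : ℝ) ^ (-(θ / 4)) * (4 * r * Real.log p) ^ ((1 : ℝ) / 4)

/-- The ideal threshold `q*` of IF-PCA in the Region of Possibility. -/
noncomputable def qStar (θ β r : ℝ) : ℝ :=
  if (β - θ / 2) / 3 < r then (β - θ / 2 + r) ^ 2 / (4 * r) else 4 * r

/-- Support of `μ`. -/
noncomputable def suppSet {p : ℕ} (μ : Fin p → ℝ) : Finset (Fin p) :=
  Finset.univ.filter fun j => μ j ≠ 0

/-- The event `D_p`: `| |S(μ)| - p ε_p | ≤ √(6 p ε_p log p)` with `ε_p = p^{-β}`. -/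
def inDp (β : ℝ) {p : ℕ} (μ : Fin p → ℝ) : Prop :=
  |((suppSet μ).card : ℝ) - (p : ℝ) * (p : ℝ) ^ (-β)| ≤
    Real.sqrt (6 * ((p : ℝ) * (p : ℝ) ^ (-β)) * Real.log p)

/-- Selection threshold `n + 2√(q n log p)` for the squared column norm. -/
noncomputable def thresh (p n : ℕ) (q : ℝ) : ℝ :=
  (n : ℝ) + 2 * Real.sqrt (q * n * Real.log p)

/-- `π₀ = P(‖z‖² > n + 2√(q n log p))`, `z ~ N(0, I_n)`. -/
noncomputable def pi0 (p n : ℕ) (q : ℝ) : ℝ :=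
  ((gaussPi n) {z | thresh p n q < ∑ i, z i ^ 2}).toReal

/-- `π₁ = P(‖z + τ ℓ‖² > n + 2√(q n log p))`, `z ~ N(0, I_n)`. -/
noncomputable def pi1 (p : ℕ) {n : ℕ} (q τ : ℝ) (ℓ : Fin n → ℝ) : ℝ :=
  ((gaussPi n) {z | thresh p n q < ∑ i, (z i + τ * ℓ i) ^ 2}).toReal

/-- Expected number of selected useless features (`s = |S(μ)|`). -/
noncomputable def m0q (p n : ℕ) (q : ℝ) (s : ℕ) : ℝ := ((p : ℝ) - s) * pi0 p n q

/-- Expected number of selected useful features. -/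
noncomputable def m1q (p : ℕ) {n : ℕ} (q τ : ℝ) (ℓ : Fin n → ℝ) (s : ℕ) : ℝ :=
  (s : ℝ) * pi1 p q τ ℓ

/-- `m^{(q)}`. -/
noncomputable def mq (p : ℕ) {n : ℕ} (q τ : ℝ) (ℓ : Fin n → ℝ) (s : ℕ) : ℝ :=
  m0q p n q s + m1q p q τ ℓ s

/-- `m_*^{(q)}`. -/
noncomputable def mstarq (p : ℕ) {n : ℕ} (q τ : ℝ) (ℓ : Fin n → ℝ) (s : ℕ) : ℝ :=
  ((p : ℝ) - s) * (n : ℝ)⁻¹ *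
      (∫ z in {z : Fin n → ℝ | thresh p n q < ∑ i, z i ^ 2}, (∑ i, z i ^ 2) ∂gaussPi n) +
    (s : ℝ) * (n : ℝ)⁻¹ *
      (∫ z in {z : Fin n → ℝ | thresh p n q < ∑ i, (z i + τ * ℓ i) ^ 2},
        (∑ i, z i ^ 2) ∂gaussPi n)

/-- The threshold `q̃(β, θ, r)` separating the "fat" and "skinny" cases. -/
noncomputable def qTilde (β θ r : ℝ) : ℝ :=
  if β < 1 - θ then max (1 - θ) ((Real.sqrt (1 - β - θ) + Real.sqrt r) ^ 2)
  else 1 - θ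

/-- The set of features selected by χ²-screening, in terms of `(ℓ, μ, Z)`. -/
noncomputable def selSet {n p : ℕ} (q : ℝ) (ℓ : Fin n → ℝ) (μ : Fin p → ℝ)
    (Z : Fin n → Fin p → ℝ) : Finset (Fin p) :=
  chiSel q fun i j => ℓ i * μ j + Z i j

/-- `Z^{(q)} (Z^{(q)})'`. -/
noncomputable def gramZq {n p : ℕ} (q : ℝ) (ℓ : Fin n → ℝ) (μ : Fin p → ℝ)
    (Z : Fin n → Fin p → ℝ) : Matrix (Fin n) (Fin n) ℝ :=
  Matrix.of fun i i' => ∑ j ∈ selSet q ℓ μ Z, Z i j * Z i' j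

/-- `X^{(q)} (X^{(q)})'`. -/
noncomputable def gramXq {n p : ℕ} (q : ℝ) (ℓ : Fin n → ℝ) (μ : Fin p → ℝ)
    (Z : Fin n → Fin p → ℝ) : Matrix (Fin n) (Fin n) ℝ :=
  Matrix.of fun i i' =>
    ∑ j ∈ selSet q ℓ μ Z, (ℓ i * μ j + Z i j) * (ℓ i' * μ j + Z i' j)

/-- The matrix `ℓ (μ^{(q)})' (Z^{(q)})' + Z^{(q)} μ^{(q)} ℓ'`. -/
noncomputable def crossMat {n p : ℕ} (q : ℝ) (ℓ : Fin n → ℝ) (μ : Fin p → ℝ)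
    (Z : Fin n → Fin p → ℝ) : Matrix (Fin n) (Fin n) ℝ :=
  Matrix.of fun i i' =>
    ℓ i * (∑ j ∈ selSet q ℓ μ Z, Z i' j * μ j) +
      (∑ j ∈ selSet q ℓ μ Z, Z i j * μ j) * ℓ i'

/-- Colored-noise data matrix `X = ℓ μ' + A Z B`. -/
noncomputable def dataColored {n p : ℕ} (A : Matrix (Fin n) (Fin n) ℝ)
    (B : Matrix (Fin p) (Fin p) ℝ) (ω : Omega n p) : Fin n → Fin p → ℝ :=
  fun i j => ω.1 i * ω.2.1 j + (A * Matrix.of ω.2.2 * B) i j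

/-- Colored-noise data matrix `X = ℓ μ' + Z B`. -/
noncomputable def dataColoredB {n p : ℕ} (B : Matrix (Fin p) (Fin p) ℝ)
    (ω : Omega n p) : Fin n → Fin p → ℝ :=
  fun i j => ω.1 i * ω.2.1 j + (Matrix.of ω.2.2 * B) i j

/-- `y_*^{(sa)} = n^{-1/2} X' ℓ̂_*^{(sa)}`. -/
noncomputable def ySA {n p : ℕ} (X : Fin n → Fin p → ℝ) : Fin p → ℝ :=
  fun j => (Real.sqrt n)⁻¹ * ∑ i, X i j * ellSimpleAgg X i

/-- `Ŝ_*^{(sa)}`: thresholding `y_*^{(sa)}` at the universal threshold. -/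
noncomputable def ShatSA {n p : ℕ} (X : Fin n → Fin p → ℝ) : Finset (Fin p) :=
  Finset.univ.filter fun j => Real.sqrt (2 * Real.log p) ≤ |ySA X j|

/-- `y_*^{(if)} = n^{-1/2} X' sgn(ξ)` for a given vector `ξ`. -/
noncomputable def yIF {n p : ℕ} (ξ : Fin n → ℝ) (X : Fin n → Fin p → ℝ) : Fin p → ℝ :=
  fun j => (Real.sqrt n)⁻¹ * ∑ i, X i j * Real.sign (ξ i)

/-- `Ŝ_*^{(if)}`: thresholding `y_*^{(if)}` at the universal threshold. -/
noncomputable def ShatIF {n p : ℕ} (ξ : Fin n → ℝ) (X : Fin n → Fin p → ℝ) : Finset (Fin p) :=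
  Finset.univ.filter fun j => Real.sqrt (2 * Real.log p) ≤ |yIF ξ X j|

/-- Rejection region of the Simple Aggregation test `T̂_*^{(sa)}`. -/
noncomputable def rejSA {n p : ℕ} : Set (Fin n → Fin p → ℝ) :=
  {X | 2 * Real.sqrt (2 * Real.log p) ≤
    ((p : ℝ) * (∑ i, ((p : ℝ)⁻¹ * ∑ j, X i j) ^ 2) - n) / Real.sqrt (2 * n)}

/-- Rejection region of the Sparse Aggregation test `T̂_N^{(sa)}`. -/
noncomputable def rejSparse {n p : ℕ} (N : ℕ)
    (S : (Fin n → Fin p → ℝ) → Finset (Fin p)) : Set (Fin n → Fin p → ℝ) :=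
  {X | Real.sqrt (2 / Real.pi) * n + Real.sqrt (2 * n * (N + 2) * Real.log p) ≤
    (Real.sqrt N)⁻¹ * ∑ i, |∑ j ∈ S X, X i j|}

/-- χ² P-value of feature `j`. -/
noncomputable def pvalue {n p : ℕ} (X : Fin n → Fin p → ℝ) (j : Fin p) : ℝ :=
  ((gaussPi n) {z | (∑ i, X i j ^ 2) ≤ ∑ i, z i ^ 2}).toReal

/-- Higher Criticism statistic. -/
noncomputable def HCstat {n p : ℕ} (X : Fin n → Fin p → ℝ) : ℝ :=
  sSup {h : ℝ | ∃ i : Fin p, 2 * (i.val + 1) ≤ p ∧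
    h = Real.sqrt p * (((i.val : ℝ) + 1) / p - pvalue X (Tuple.sort (pvalue X) i)) /
      Real.sqrt (pvalue X (Tuple.sort (pvalue X) i) *
        (1 - pvalue X (Tuple.sort (pvalue X) i)))}

/-- Rejection region of the Higher Criticism test. -/
noncomputable def rejHC {n p : ℕ} : Set (Fin n → Fin p → ℝ) :=
  {X | 2 * Real.sqrt (2 * Real.log (Real.log p)) ≤ HCstat X}

/-- Lebesgue measure on the space of `n × p` matrices. -/
noncomputable def lebPi (n p : ℕ) : Measure (Fin n → Fin p → ℝ) :=
  Measure.pi fun _ : Fin n => Measure.pi fun _ : Fin p => (volume : Measure ℝ)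

/-- Law of `X` in Experiment 1 (`X = ℓ μ' + c_p Z`) with `ℓ_i` forced to be `s`. -/
noncomputable def condLaw1 (n p : ℕ) (ε τ cp : ℝ) (i : Fin n) (s : ℝ) :
    Measure (Fin n → Fin p → ℝ) :=
  (jointLaw n p ε τ).map fun ω => fun i' j =>
    Function.update ω.1 i s i' * ω.2.1 j + cp * ω.2.2 i' j

/-- Law of `X` in Experiment 2 (`X = ℓ μ' + c_p Z + W`) with `ℓ_i` forced to be `s`,
where `W ~ ν` is independent of `(ℓ, μ, Z)`. -/
noncomputable def condLaw2 (n p : ℕ) (ε τ cp : ℝ)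
    (ν : Measure (Fin n → Fin p → ℝ)) (i : Fin n) (s : ℝ) :
    Measure (Fin n → Fin p → ℝ) :=
  ((jointLaw n p ε τ).prod ν).map fun ωw => fun i' j =>
    Function.update ωw.1.1 i s i' * ωw.1.2.1 j + cp * ωw.1.2.2 i' j + ωw.2 i' j

end ARWPaper

namespace ARWPaper

instance instIsProbabilityMeasureGaussPi (n : ℕ) : IsProbabilityMeasure (gaussPi n) := by
  unfold gaussPi; infer_instance

instance instIsProbabilityMeasureNoiseLaw (n p : ℕ) : IsProbabilityMeasure (noiseLaw n p) := by
  unfold noiseLaw; infer_instance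

/-- A linear form of a standard Gaussian vector is Gaussian. -/
lemma gaussPi_map_linear {p : ℕ} (a : Fin p → ℝ) :
    (gaussPi p).map (fun z => ∑ j, a j * z j) = gaussianReal 0 (∑ j, a j ^ 2).toNNReal := by
  have hm : Measurable fun z : Fin p → ℝ => ∑ j, a j * z j := by fun_prop
  have : IsProbabilityMeasure ((gaussPi p).map (fun z => ∑ j, a j * z j)) :=
    Measure.isProbabilityMeasure_map hm.aemeasurable
  apply Measure.ext_of_charFun
  ext t
  have hs : 0 ≤ ∑ j, a j ^ 2 := Finset.sum_nonneg fun _ _ => sq_nonneg _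
  rw [charFun_gaussianReal, charFun_apply_real, integral_map hm.aemeasurable (by fun_prop)]
  have h1 : ∀ z : Fin p → ℝ, Complex.exp (t * ((∑ j, a j * z j : ℝ) : ℂ) * Complex.I)
      = ∏ j, Complex.exp (((t * a j : ℝ) : ℂ) * (z j : ℂ) * Complex.I) := by
    intro z
    rw [← Complex.exp_sum]
    congr 1
    push_cast
    rw [Finset.mul_sum, Finset.sum_mul]
    exact Finset.sum_congr rfl fun j _ => by ring
  simp_rw [h1]
  rw [gaussPi, integral_fintype_prod_eq_prod
    (f := fun j (x : ℝ) => Complex.exp (((t * a j : ℝ) : ℂ) * (x : ℂ) * Complex.I))]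
  simp_rw [← charFun_apply_real, charFun_gaussianReal]
  rw [← Complex.exp_sum]
  congr 1
  rw [Real.coe_toNNReal _ hs]
  push_cast
  simp only [mul_zero, zero_mul, zero_sub, one_mul]
  rw [Finset.sum_neg_distrib, Finset.sum_mul, Finset.sum_div]
  congr 1
  exact Finset.sum_congr rfl fun j _ => by ring

/-- The noise law is invariant under transposition. -/
lemma noiseLaw_map_transpose (n p : ℕ) :
    (noiseLaw n p).map (fun Z j i => Z i j) = noiseLaw p n := by
  have h1 : ∀ a b : ℕ, (Measure.pi fun _ : Fin a × Fin b => gaussianReal 0 1).map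
      (fun f i j => f (i, j)) = noiseLaw a b := by
    intro a b
    have := Measure.infinitePi_map_curry (ι := Fin a) (κ := Fin b)
      (fun _ _ => gaussianReal 0 1)
    simp only [Measure.infinitePi_eq_pi] at this
    exact this
  have hm : Measurable fun (f : Fin n × Fin p → ℝ) (i : Fin n) (j : Fin p) => f (i, j) := by
    fun_prop
  have hm' : Measurable fun (f : Fin p × Fin n → ℝ) (i : Fin p) (j : Fin n) => f (i, j) := by
    fun_prop
  rw [← h1 n p, ← h1 p n, Measure.map_map (by fun_prop) hm]
  have h2 := (measurePreserving_piCongrLeft (fun _ : Fin p × Fin n => gaussianReal 0 1)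
    (Equiv.prodComm (Fin n) (Fin p))).map_eq
  rw [← h2, Measure.map_map hm' (MeasurableEquiv.measurable _)]
  congr 1

lemma measurable_update_prod {ι : Type*} [DecidableEq ι] {E : Type*} [MeasurableSpace E] (i : ι) :
    Measurable fun q : (ι → E) × E => Function.update q.1 i q.2 := by
  rw [measurable_pi_iff]
  intro k
  by_cases hk : k = i
  · subst hk; simpa using measurable_snd
  · simp only [Function.update_of_ne hk]; fun_prop

/-- Resampling one coordinate preserves a product measure. -/
lemma map_update_pi {ι : Type*} [Fintype ι] [DecidableEq ι] {E : Type*} [MeasurableSpace E]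
    (μ : ι → Measure E) [∀ i, IsProbabilityMeasure (μ i)] (i : ι) :
    ((Measure.pi μ).prod (μ i)).map (fun q => Function.update q.1 i q.2) = Measure.pi μ := by
  have hm : Measurable fun q : (ι → E) × E => Function.update q.1 i q.2 :=
    measurable_update_prod i
  symm
  refine Measure.pi_eq fun s hs => ?_
  rw [Measure.map_apply hm (MeasurableSet.univ_pi hs)]
  have : (fun q : (ι → E) × E => Function.update q.1 i q.2) ⁻¹' Set.univ.pi s
      = (Set.univ.pi (Function.update s i Set.univ)) ×ˢ s i := by
    ext ⟨x, y⟩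
    simp only [Set.mem_preimage, Set.mem_pi, Set.mem_univ, true_implies, Set.mem_prod]
    constructor
    · refine fun h => ⟨fun k => ?_, by simpa using h i⟩
      by_cases hk : k = i
      · subst hk; simp
      · simpa [Function.update_of_ne hk] using h k
    · rintro ⟨h, h'⟩ k
      by_cases hk : k = i
      · subst hk; simpa using h'
      · simpa [Function.update_of_ne hk] using h k
  rw [this, Measure.prod_prod, Measure.pi_pi, ← Finset.mul_prod_erase _ _ (Finset.mem_univ i),
    ← Finset.mul_prod_erase (Finset.univ) (fun k => μ k (s k)) (Finset.mem_univ i)]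
  rw [mul_comm (μ i (s i))]
  simp only [Function.update_self, measure_univ, one_mul]
  congr 1
  exact Finset.prod_congr rfl fun k hk => by
    rw [Function.update_of_ne (Finset.ne_of_mem_erase hk)]

lemma lintegral_pi_prod {ι : Type*} [Fintype ι] {E : Type*} [MeasurableSpace E]
    (μ : ι → Measure E) [∀ i, IsProbabilityMeasure (μ i)] (f : ι → E → ℝ≥0∞)
    (hf : ∀ i, Measurable (f i)) :
    ∫⁻ x, ∏ i, f i (x i) ∂Measure.pi μ = ∏ i, ∫⁻ y, f i y ∂μ i := by
  rw [lintegral_prod_eq_prod_lintegral_of_indepFun Finset.univ (fun i (x : ι → E) => f i (x i))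
    (iIndepFun_pi fun i => (hf i).aemeasurable) (fun i => (hf i).comp (measurable_pi_apply i))]
  refine Finset.prod_congr rfl fun i _ => ?_
  exact (measurePreserving_eval μ i).lintegral_comp (hf i)

lemma chernoff {Ω : Type*} [MeasurableSpace Ω] (μ : Measure Ω) (f : Ω → ℝ) (hf : Measurable f)
    (c : ℝ) : μ {ω | c ≤ f ω} ≤ ENNReal.ofReal (Real.exp (-c)) *
      ∫⁻ ω, ENNReal.ofReal (Real.exp (f ω)) ∂μ := by
  have h := mul_meas_ge_le_lintegral (μ := μ)
    (f := fun ω => ENNReal.ofReal (Real.exp (f ω))) (by fun_prop) (ENNReal.ofReal (Real.exp c))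
  have hs : {ω | c ≤ f ω} =
      {ω | ENNReal.ofReal (Real.exp c) ≤ ENNReal.ofReal (Real.exp (f ω))} := by
    ext ω
    simp only [Set.mem_ofPred_eq]
    rw [ENNReal.ofReal_le_ofReal_iff (Real.exp_pos _).le, Real.exp_le_exp]
  rw [hs]
  calc _ = ENNReal.ofReal (Real.exp (-c)) * (ENNReal.ofReal (Real.exp c) *
        μ {ω | ENNReal.ofReal (Real.exp c) ≤ ENNReal.ofReal (Real.exp (f ω))}) := by
        rw [← mul_assoc, ← ENNReal.ofReal_mul (Real.exp_pos _).le, ← Real.exp_add]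
        simp
    _ ≤ _ := by gcongr

/-- Chernoff bound for a sum of row statistics under a product measure. -/
lemma chernoff_pi {n : ℕ} {E : Type*} [MeasurableSpace E] (μ : Measure E) [IsProbabilityMeasure μ]
    (f : Fin n → E → ℝ) (hf : ∀ i, Measurable (f i)) (B c : ℝ)
    (hB : ∀ i, ∫⁻ z, ENNReal.ofReal (Real.exp (f i z)) ∂μ ≤ ENNReal.ofReal (Real.exp B)) :
    (Measure.pi fun _ : Fin n => μ) {Z | c ≤ ∑ i, f i (Z i)}
      ≤ ENNReal.ofReal (Real.exp (n * B - c)) := by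
  refine (chernoff _ (fun Z : Fin n → E => ∑ i, f i (Z i))
    (Finset.measurable_fun_sum _ fun i _ => (hf i).comp (measurable_pi_apply i)) c).trans ?_
  have h : ∀ Z : Fin n → E, ENNReal.ofReal (Real.exp (∑ i, f i (Z i)))
      = ∏ i, ENNReal.ofReal (Real.exp (f i (Z i))) := fun Z => by
    rw [Real.exp_sum, ENNReal.ofReal_prod_of_nonneg fun _ _ => (Real.exp_pos _).le]
  simp_rw [h]
  rw [lintegral_pi_prod (fun _ => μ) (fun i z => ENNReal.ofReal (Real.exp (f i z)))
    (fun i => by have := hf i; fun_prop)]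
  calc _ ≤ ENNReal.ofReal (Real.exp (-c)) * ∏ i : Fin n, ENNReal.ofReal (Real.exp B) := by
        gcongr with i; exact hB i
    _ = _ := by
        rw [Finset.prod_const, Finset.card_univ, Fintype.card_fin,
          ← ENNReal.ofReal_pow (Real.exp_pos _).le, ← Real.exp_nat_mul,
          ← ENNReal.ofReal_mul (Real.exp_pos _).le, ← Real.exp_add]
        congr 2; ring

lemma lintegral_exp_gaussianReal (v : ℝ≥0) (c : ℝ) :
    ∫⁻ x, ENNReal.ofReal (Real.exp (c * x)) ∂gaussianReal 0 v
      = ENNReal.ofReal (Real.exp (v * c ^ 2 / 2)) := by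
  rw [← ofReal_integral_eq_lintegral_ofReal (integrable_exp_mul_gaussianReal c)
    (Eventually.of_forall fun _ => (Real.exp_pos _).le)]
  have := congrFun (mgf_id_gaussianReal (μ := 0) (v := v)) c
  simp only [mgf, id] at this
  rw [this]; simp

lemma exp_sub_sq_le_one_add {y : ℝ} (h : |y| ≤ 1 / 2) : Real.exp (y - y ^ 2) ≤ 1 + y := by
  rw [abs_le] at h
  rcases le_or_gt 0 y with hy | hy
  · have h1 : |y - y ^ 2| ≤ 1 := by rw [abs_le]; constructor <;> nlinarith
    have h2 := Real.abs_exp_sub_one_sub_id_le h1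
    have h3 := (abs_le.1 h2).2
    nlinarith [mul_nonneg hy hy, mul_nonneg (mul_nonneg hy hy) hy]
  · have h1 : 0 ≤ -y + y ^ 2 := by nlinarith
    have h2 := Real.quadratic_le_exp_of_nonneg h1
    have h3 : Real.exp (y - y ^ 2) = (Real.exp (-y + y ^ 2))⁻¹ := by
      rw [← Real.exp_neg]; congr 1; ring
    rw [h3, inv_le_comm₀ (Real.exp_pos _) (by linarith)]
    refine le_trans ?_ h2
    rw [inv_le_iff_one_le_mul₀ (by linarith)]
    have h4 : 0 < -y := by linarith
    nlinarith [mul_pos h4 h4, mul_pos (mul_pos h4 h4) h4,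
      mul_nonneg (mul_pos h4 h4).le (by linarith : 0 ≤ 1/2 + y),
      mul_nonneg (mul_pos (mul_pos h4 h4) h4).le (by linarith : 0 ≤ 1/2 + y),
      mul_nonneg (mul_pos (mul_pos h4 h4) (mul_pos h4 h4)).le (by linarith : 0 ≤ 1/2 + y)]

/-- Moment generating function bound for a centred chi-square variable. -/
lemma lintegral_exp_sq_gaussianReal {x : ℝ} (hx : |x| ≤ 1 / 4) :
    ∫⁻ z, ENNReal.ofReal (Real.exp (x * (z ^ 2 - 1))) ∂gaussianReal 0 1
      ≤ ENNReal.ofReal (Real.exp (2 * x ^ 2)) := by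
  rw [abs_le] at hx
  have hb : 0 < 1 / 2 - x := by linarith
  rw [gaussianReal_of_var_ne_zero 0 one_ne_zero,
    lintegral_withDensity_eq_lintegral_mul _ (measurable_gaussianPDF 0 1) (by fun_prop)]
  have h1 : ∀ z : ℝ, (gaussianPDF 0 1 * fun z => ENNReal.ofReal (Real.exp (x * (z ^ 2 - 1)))) z
      = ENNReal.ofReal ((√(2 * Real.pi))⁻¹ * Real.exp (-x) *
        Real.exp (-(1 / 2 - x) * z ^ 2)) := by
    intro z
    simp only [Pi.mul_apply, gaussianPDF, gaussianPDFReal, NNReal.coe_one, mul_one, sub_zero]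
    rw [← ENNReal.ofReal_mul (by positivity), mul_assoc, mul_assoc, ← Real.exp_add,
      ← Real.exp_add]
    congr 3; ring
  simp_rw [h1]
  rw [← ofReal_integral_eq_lintegral_ofReal ((integrable_exp_neg_mul_sq hb).const_mul _)
    (Eventually.of_forall fun _ => by positivity), integral_const_mul, integral_gaussian]
  apply ENNReal.ofReal_le_ofReal
  have h2 : √(Real.pi / (1 / 2 - x)) = √(2 * Real.pi) * (√(1 - 2 * x))⁻¹ := by
    rw [← Real.sqrt_inv, ← Real.sqrt_mul (by positivity)]
    congr 1
    field_simp
  rw [h2]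
  have h3 : √(2 * Real.pi) ≠ 0 := by positivity
  have h4 : (√(2 * Real.pi))⁻¹ * Real.exp (-x) * (√(2 * Real.pi) * (√(1 - 2 * x))⁻¹)
      = Real.exp (-x) * (√(1 - 2 * x))⁻¹ := by field_simp
  rw [h4]
  have h5 := exp_sub_sq_le_one_add (y := -2 * x) (by rw [abs_le]; constructor <;> linarith)
  have h6 : Real.exp (-x - 2 * x ^ 2) ≤ √(1 - 2 * x) := by
    apply Real.le_sqrt_of_sq_le
    rw [← Real.exp_nat_mul]
    calc _ = Real.exp (-2 * x - (-2 * x) ^ 2) := by congr 1; push_cast; ring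
      _ ≤ _ := by linarith
  rw [← div_eq_mul_inv, div_le_iff₀ (Real.sqrt_pos.2 (by linarith))]
  calc Real.exp (-x) = Real.exp (2 * x ^ 2) * Real.exp (-x - 2 * x ^ 2) := by
        rw [← Real.exp_add]; congr 1; ring
    _ ≤ _ := by gcongr

instance instIsProbabilityMeasureSignLaw : IsProbabilityMeasure signLaw := by
  refine ⟨?_⟩
  simp [signLaw, ENNReal.inv_two_add_inv_two]

lemma isProbabilityMeasure_muLaw {ε τ : ℝ} (h0 : 0 ≤ ε) (h1 : ε ≤ 1) :
    IsProbabilityMeasure (muLaw ε τ) := by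
  refine ⟨?_⟩
  simp [muLaw, ← ENNReal.ofReal_add (sub_nonneg.2 h1) h0]

lemma ae_signLaw : ∀ᵐ x ∂signLaw, x = 1 ∨ x = -1 := by
  rw [signLaw, ae_add_measure_iff]
  constructor <;> refine Measure.ae_smul_measure ?_ _ <;> rw [ae_dirac_eq] <;> simp

lemma ae_muLaw (ε τ : ℝ) : ∀ᵐ x ∂muLaw ε τ, x = 0 ∨ x = τ := by
  rw [muLaw, ae_add_measure_iff]
  constructor <;> refine Measure.ae_smul_measure ?_ _ <;> rw [ae_dirac_eq] <;> simp

lemma ae_pi_of_ae {n : ℕ} (ν : Measure ℝ) [IsProbabilityMeasure ν] {P : ℝ → Prop}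
    (h : ∀ᵐ x ∂ν, P x) : ∀ᵐ x ∂(Measure.pi fun _ : Fin n => ν), ∀ i, P (x i) :=
  ae_all_iff.2 fun i => (Measure.quasiMeasurePreserving_eval (fun _ : Fin n => ν) i).ae h

/-- Label vectors in `{1, -1}^n`. -/
def IsLabel {n : ℕ} (ℓ : Fin n → ℝ) : Prop := ∀ i, ℓ i = 1 ∨ ℓ i = -1

/-- Signal vectors in `{0, τ}^p`. -/
def IsSignal {p : ℕ} (τ : ℝ) (μ : Fin p → ℝ) : Prop := ∀ j, μ j = 0 ∨ μ j = τ

lemma finite_label (n : ℕ) : {ℓ : Fin n → ℝ | IsLabel ℓ}.Finite := by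
  refine (Set.Finite.pi' fun _ : Fin n => Set.toFinite ({1, -1} : Set ℝ)).subset fun ℓ h i => ?_
  simpa using h i

lemma finite_signal (p : ℕ) (τ : ℝ) : {μ : Fin p → ℝ | IsSignal τ μ}.Finite := by
  refine (Set.Finite.pi' fun _ : Fin p => Set.toFinite ({0, τ} : Set ℝ)).subset fun μ h i => ?_
  simpa using h i

/-- Conditioning on labels and signal; no measurability of `B` is needed since these
take finitely many values. -/
lemma jointLaw_le {n p : ℕ} {ε τ : ℝ} (h0 : 0 ≤ ε) (h1 : ε ≤ 1) (B : Set (Omega n p))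
    (f : (Fin p → ℝ) → ℝ≥0∞)
    (h : ∀ ℓ, IsLabel ℓ → ∀ μ, IsSignal τ μ → noiseLaw n p {Z | (ℓ, μ, Z) ∈ B} ≤ f μ) :
    jointLaw n p ε τ B ≤ ∫⁻ μ, f μ ∂(Measure.pi fun _ : Fin p => muLaw ε τ) := by
  have := isProbabilityMeasure_muLaw (τ := τ) h0 h1
  set L := {ℓ : Fin n → ℝ | IsLabel ℓ}
  set M := {μ : Fin p → ℝ | IsSignal τ μ}
  let T : (Fin n → ℝ) → (Fin p → ℝ) → Set (Fin n → Fin p → ℝ) :=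
    fun ℓ μ => toMeasurable (noiseLaw n p) {Z | (ℓ, μ, Z) ∈ B}
  let B' : Set (Omega n p) := (⋃ ℓ ∈ L, ⋃ μ ∈ M, {ℓ} ×ˢ ({μ} ×ˢ T ℓ μ)) ∪
    ((Lᶜ ×ˢ Set.univ) ∪ (Set.univ ×ˢ (Mᶜ ×ˢ Set.univ)))
  have hL : MeasurableSet L := (finite_label n).measurableSet
  have hM : MeasurableSet M := (finite_signal p τ).measurableSet
  have hB' : MeasurableSet B' := by
    refine MeasurableSet.union ?_ ((hL.compl.prod .univ).union (.prod .univ (hM.compl.prod .univ)))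
    refine (finite_label n).measurableSet_biUnion fun ℓ _ =>
      (finite_signal p τ).measurableSet_biUnion fun μ _ => ?_
    exact (measurableSet_singleton _).prod ((measurableSet_singleton _).prod
      (measurableSet_toMeasurable _ _))
  have hBB' : B ⊆ B' := by
    rintro ⟨ℓ, μ, Z⟩ hω
    by_cases hl : ℓ ∈ L
    · by_cases hm : μ ∈ M
      · left
        simp only [Set.mem_iUnion]
        exact ⟨ℓ, hl, μ, hm, rfl, rfl, subset_toMeasurable _ _ hω⟩
      · right; right; exact ⟨trivial, hm, trivial⟩
    · right; left; exact ⟨hl, trivial⟩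
  have hsec : ∀ ℓ ∈ L, ∀ μ ∈ M, Prod.mk μ ⁻¹' (Prod.mk ℓ ⁻¹' B') ⊆ T ℓ μ := by
    rintro ℓ hl μ hm Z (hZ | hZ | hZ)
    · simp only [Set.mem_iUnion] at hZ
      obtain ⟨ℓ', -, μ', -, h1, h2, h3⟩ := hZ
      obtain rfl : ℓ = ℓ' := h1
      obtain rfl : μ = μ' := h2
      exact h3
    · exact absurd hl hZ.1
    · exact absurd hm hZ.2.1
  have hprob : IsProbabilityMeasure (Measure.pi fun _ : Fin n => signLaw) := inferInstance
  calc jointLaw n p ε τ B ≤ jointLaw n p ε τ B' := measure_mono hBB'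
    _ = ∫⁻ ℓ, ((Measure.pi fun _ : Fin p => muLaw ε τ).prod (noiseLaw n p))
          (Prod.mk ℓ ⁻¹' B') ∂(Measure.pi fun _ : Fin n => signLaw) := by
        rw [jointLaw, Measure.prod_apply hB']
    _ ≤ ∫⁻ _, (∫⁻ μ, f μ ∂(Measure.pi fun _ : Fin p => muLaw ε τ))
          ∂(Measure.pi fun _ : Fin n => signLaw) := by
        refine lintegral_mono_ae ?_
        filter_upwards [ae_pi_of_ae (n := n) signLaw ae_signLaw] with ℓ hl
        rw [Measure.prod_apply (measurable_prodMk_left hB')]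
        refine lintegral_mono_ae ?_
        filter_upwards [ae_pi_of_ae (n := p) (muLaw ε τ) (ae_muLaw ε τ)] with μ hm
        calc _ ≤ noiseLaw n p (T ℓ μ) := measure_mono (hsec ℓ hl μ hm)
          _ = _ := measure_toMeasurable _
          _ ≤ _ := h ℓ hl μ hm
    _ = _ := by simp

/-- With high probability the signal is not too sparse. -/
lemma pi_muLaw_sparse_le {p : ℕ} {ε τ : ℝ} (h0 : 0 ≤ ε) (h1 : ε ≤ 1) (hτ : 0 < τ) :
    (Measure.pi fun _ : Fin p => muLaw ε τ) {μ | ∑ j, μ j < τ * (p * ε / 2)}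
      ≤ ENNReal.ofReal (Real.exp (-(p * ε / 10))) := by
  have := isProbabilityMeasure_muLaw (τ := τ) h0 h1
  have he : Real.exp (-1) ≤ 0.37 := by
    have := Real.exp_neg_one_lt_d9; linarith
  have h := chernoff_pi (n := p) (muLaw ε τ) (fun _ x => -(τ⁻¹ * x)) (fun _ => by fun_prop)
    (-(ε * (1 - Real.exp (-1)))) (-(p * ε / 2)) (fun _ => by
      have hm : Measurable fun z : ℝ => ENNReal.ofReal (Real.exp (-(τ⁻¹ * z))) := by fun_prop
      rw [muLaw, lintegral_add_measure, lintegral_smul_measure, lintegral_smul_measure,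
        lintegral_dirac' _ hm, lintegral_dirac' _ hm, smul_eq_mul, smul_eq_mul,
        ← ENNReal.ofReal_mul (by linarith), ← ENNReal.ofReal_mul h0,
        ← ENNReal.ofReal_add (by have := Real.exp_pos (-(τ⁻¹ * 0)); nlinarith)
          (by positivity)]
      apply ENNReal.ofReal_le_ofReal
      rw [inv_mul_cancel₀ hτ.ne']
      have := Real.add_one_le_exp (-(ε * (1 - Real.exp (-1))))
      simp only [mul_zero, neg_zero, Real.exp_zero]
      linarith)
  refine (measure_mono ?_).trans (h.trans (ENNReal.ofReal_le_ofReal (Real.exp_le_exp.2 ?_)))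
  · intro μ hμ
    simp only [Set.mem_ofPred_eq] at hμ ⊢
    rw [Finset.sum_neg_distrib, ← Finset.mul_sum, neg_le_neg_iff, inv_mul_le_iff₀ hτ]
    exact hμ.le
  · have : 0 ≤ (p : ℝ) * ε := by positivity
    nlinarith

lemma pi_muLaw_ne_zero_le {p : ℕ} {ε τ : ℝ} (h0 : 0 ≤ ε) (h1 : ε ≤ 1) (j : Fin p) :
    (Measure.pi fun _ : Fin p => muLaw ε τ) {μ | μ j ≠ 0} ≤ ENNReal.ofReal ε := by
  have := isProbabilityMeasure_muLaw (τ := τ) h0 h1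
  have hm : MeasurableSet {x : ℝ | x ≠ 0} := (measurableSet_singleton (0 : ℝ)).compl
  have h := (measurePreserving_eval (fun _ : Fin p => muLaw ε τ) j).measure_preimage
    hm.nullMeasurableSet
  change (Measure.pi fun _ : Fin p => muLaw ε τ) (Function.eval j ⁻¹' {x : ℝ | x ≠ 0}) ≤ _
  rw [h, muLaw]
  simp only [Measure.coe_add, Measure.coe_smul, Pi.add_apply, Pi.smul_apply, smul_eq_mul,
    Measure.dirac_apply' _ hm]
  have h2 : Set.indicator {x : ℝ | x ≠ 0} (1 : ℝ → ℝ≥0∞) 0 = 0 := by simp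
  rw [h2, mul_zero, zero_add]
  calc _ ≤ ENNReal.ofReal ε * 1 := by
        gcongr; exact Set.indicator_le_self' (by simp) _
    _ = _ := mul_one _

lemma hammingSig_nonneg (n p : ℕ) {ε : ℝ} (τ : ℝ) (hε : 0 ≤ ε)
    (D : Omega n p → Fin n → Fin p → ℝ) (S : (Fin n → Fin p → ℝ) → Finset (Fin p)) :
    0 ≤ hammingSig n p ε τ D S := by
  unfold hammingSig; positivity

/-- Reduction of the Hamming error to noise probabilities given labels and signal. -/
lemma hammingSig_le {n p : ℕ} {ε τ c₀ c₁ : ℝ} (hp : 1 ≤ p) (h0 : 0 < ε) (h1 : ε ≤ 1)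
    (hτ : 0 < τ) (hc₀ : 0 ≤ c₀) (hc₁ : 0 ≤ c₁) (S : (Fin n → Fin p → ℝ) → Finset (Fin p))
    (hnull : ∀ ℓ, IsLabel ℓ → ∀ μ, IsSignal τ μ → τ * (p * ε / 2) ≤ ∑ j, μ j → ∀ j, μ j = 0 →
      noiseLaw n p {Z | j ∈ S fun i j => ℓ i * μ j + Z i j} ≤ ENNReal.ofReal c₀)
    (halt : ∀ ℓ, IsLabel ℓ → ∀ μ, IsSignal τ μ → τ * (p * ε / 2) ≤ ∑ j, μ j → ∀ j, μ j = τ →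
      noiseLaw n p {Z | j ∉ S fun i j => ℓ i * μ j + Z i j} ≤ ENNReal.ofReal c₁) :
    hammingSig n p ε τ dataMap S ≤ c₀ / ε + c₁ + 2 * (Real.exp (-(p * ε / 10)) / ε) := by
  have := isProbabilityMeasure_muLaw (τ := τ) h0.le h1
  set ν := Measure.pi fun _ : Fin p => muLaw ε τ
  set bad : Set (Fin p → ℝ) := {μ | ∑ j, μ j < τ * (p * ε / 2)} with hbad
  have hbadm : MeasurableSet bad := measurableSet_lt (by fun_prop) measurable_const
  set e := Real.exp (-(p * ε / 10)) with he
  have hepos : 0 < e := Real.exp_pos _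
  have hbadle : ν bad ≤ ENNReal.ofReal e := pi_muLaw_sparse_le h0.le h1 hτ
  have hle1 : ∀ s : Set (Fin n → Fin p → ℝ), noiseLaw n p s ≤ 1 := fun s => prob_le_one
  have hA : ∀ j : Fin p, ((jointLaw n p ε τ) {ω | ω.2.1 j = 0 ∧ j ∈ S (dataMap ω)}).toReal
      ≤ c₀ + e := by
    intro j
    refine ENNReal.toReal_le_of_le_ofReal (by positivity) ?_
    refine (jointLaw_le h0.le h1 _
      (fun μ => ENNReal.ofReal c₀ + bad.indicator 1 μ) ?_).trans ?_
    · intro ℓ hl μ hm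
      by_cases hb : μ ∈ bad
      · simp only [Set.indicator_of_mem hb, Pi.one_apply]
        exact (hle1 _).trans le_add_self
      · by_cases hj : μ j = 0
        · refine le_add_right ((measure_mono ?_).trans (hnull ℓ hl μ hm (not_lt.1 hb) j hj))
          exact fun Z hZ => hZ.2
        · have : {Z : Fin n → Fin p → ℝ | (ℓ, μ, Z) ∈
              {ω : Omega n p | ω.2.1 j = 0 ∧ j ∈ S (dataMap ω)}} = ∅ := by
            ext Z; simp [hj]
          rw [this]; simp
    · rw [lintegral_add_left measurable_const, ENNReal.ofReal_add hc₀ hepos.le]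
      gcongr
      · simp
      · simpa [lintegral_indicator hbadm] using hbadle
  have hB : ∀ j : Fin p, ((jointLaw n p ε τ) {ω | ω.2.1 j ≠ 0 ∧ j ∉ S (dataMap ω)}).toReal
      ≤ c₁ * ε + e := by
    intro j
    have hjm : MeasurableSet {μ : Fin p → ℝ | μ j ≠ 0} :=
      (measurableSet_eq_fun (measurable_pi_apply j) measurable_const).compl
    refine ENNReal.toReal_le_of_le_ofReal (by positivity) ?_
    refine (jointLaw_le h0.le h1 _
      (fun μ => ENNReal.ofReal c₁ * Set.indicator {μ : Fin p → ℝ | μ j ≠ 0} 1 μ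
        + bad.indicator 1 μ) ?_).trans ?_
    · intro ℓ hl μ hm
      by_cases hb : μ ∈ bad
      · simp only [Set.indicator_of_mem hb, Pi.one_apply]
        exact (hle1 _).trans le_add_self
      · by_cases hj : μ j = 0
        · have : {Z : Fin n → Fin p → ℝ | (ℓ, μ, Z) ∈
              {ω : Omega n p | ω.2.1 j ≠ 0 ∧ j ∉ S (dataMap ω)}} = ∅ := by
            ext Z; simp [hj]
          rw [this]; simp
        · have hj' : μ ∈ {μ : Fin p → ℝ | μ j ≠ 0} := hj
          rw [Set.indicator_of_mem hj', Pi.one_apply, mul_one]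
          refine le_add_right ((measure_mono ?_).trans
            (halt ℓ hl μ hm (not_lt.1 hb) j ((hm j).resolve_left hj)))
          exact fun Z hZ => hZ.2
    · rw [lintegral_add_right _ (measurable_one.indicator hbadm),
        lintegral_const_mul _ (measurable_one.indicator hjm),
        ENNReal.ofReal_add (by positivity) hepos.le, ENNReal.ofReal_mul hc₁]
      gcongr
      · simpa [lintegral_indicator hjm] using pi_muLaw_ne_zero_le h0.le h1 j
      · simpa [lintegral_indicator hbadm] using hbadle
  have hp' : (0 : ℝ) < p := by exact_mod_cast hp
  unfold hammingSig
  calc _ ≤ ((p : ℝ) * ε)⁻¹ * ∑ j : Fin p, ((c₀ + e) + (c₁ * ε + e)) := by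
        gcongr with j
        · exact hA j
        · exact hB j
    _ = _ := by
        rw [Finset.sum_const, Finset.card_univ, Fintype.card_fin, nsmul_eq_mul]
        field_simp
        ring

lemma noiseLaw_map_col (n p : ℕ) (j : Fin p) :
    (noiseLaw n p).map (fun Z i => Z i j) = gaussPi n := by
  have h : (fun (Z : Fin n → Fin p → ℝ) (i : Fin n) => Z i j) =
      (fun W : Fin p → Fin n → ℝ => W j) ∘ fun Z j i => Z i j := rfl
  rw [h, ← Measure.map_map (by fun_prop) (by fun_prop), noiseLaw_map_transpose]
  exact (measurePreserving_eval (fun _ : Fin p => gaussPi n) j).map_eq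

lemma noiseLaw_col_le {n p : ℕ} (j : Fin p) (A : Set (Fin n → ℝ)) :
    noiseLaw n p {Z | (fun i => Z i j) ∈ A} ≤ gaussPi n A := by
  rw [← noiseLaw_map_col n p j]
  exact Measure.le_map_apply (Measurable.aemeasurable (by fun_prop)) A

lemma noiseLaw_row_le {n p : ℕ} (i : Fin n) (A : Set (Fin p → ℝ)) :
    noiseLaw n p {Z | Z i ∈ A} ≤ gaussPi p A := by
  have h := measurePreserving_eval (fun _ : Fin n => gaussPi p) i
  exact (Measure.le_map_apply h.measurable.aemeasurable A).trans_eq (by rw [noiseLaw, h.map_eq])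

lemma gaussPi_linear_tail {n : ℕ} (a : Fin n → ℝ) {V t : ℝ} (hV : 0 < V)
    (ht : 0 ≤ t) (ha : ∑ i, a i ^ 2 ≤ V) :
    gaussPi n {z | t ≤ ∑ i, a i * z i} ≤ ENNReal.ofReal (Real.exp (-(t ^ 2 / (2 * V)))) := by
  have hm : Measurable fun z : Fin n → ℝ => ∑ i, a i * z i := by fun_prop
  refine (measure_mono (t := {z | t / V * t ≤ t / V * ∑ i, a i * z i}) fun z hz => ?_).trans
    ((chernoff (gaussPi n) (fun z => t / V * ∑ i, a i * z i) (hm.const_mul _) _).trans ?_)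
  · simp only [Set.mem_ofPred_eq] at hz ⊢; gcongr
  · have h1 : ∫⁻ z, ENNReal.ofReal (Real.exp (t / V * ∑ i, a i * z i)) ∂gaussPi n =
        ∫⁻ x, ENNReal.ofReal (Real.exp (t / V * x))
          ∂((gaussPi n).map fun z => ∑ i, a i * z i) := by
      rw [lintegral_map (by fun_prop) hm]
    rw [h1, gaussPi_map_linear, lintegral_exp_gaussianReal,
      ← ENNReal.ofReal_mul (Real.exp_pos _).le, ← Real.exp_add]
    apply ENNReal.ofReal_le_ofReal
    rw [Real.exp_le_exp, Real.coe_toNNReal _ (Finset.sum_nonneg fun i _ => sq_nonneg _)]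
    have : (∑ i, a i ^ 2) * (t / V) ^ 2 / 2 ≤ V * (t / V) ^ 2 / 2 := by gcongr
    refine (add_le_add_right this _).trans (le_of_eq ?_)
    field_simp; ring

lemma gaussPi_sq_tail {n : ℕ} {σ t : ℝ} (hσ : σ = 1 ∨ σ = -1) (h0 : 0 ≤ t) (h1 : t ≤ n) :
    gaussPi n {z | t ≤ ∑ i, σ * (z i ^ 2 - 1)} ≤
      ENNReal.ofReal (Real.exp (-(t ^ 2 / (8 * n)))) := by
  rcases Nat.eq_zero_or_pos n with rfl | hn
  · simpa using prob_le_one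
  have hn' : (0 : ℝ) < n := by exact_mod_cast hn
  have hx : |t / (4 * n) * σ| ≤ 1 / 4 := by
    have : |σ| = 1 := by rcases hσ with rfl | rfl <;> simp
    rw [abs_mul, this, mul_one, abs_of_nonneg (by positivity), div_le_div_iff₀ (by positivity)
      (by norm_num)]
    linarith
  have h := chernoff_pi (n := n) (gaussianReal 0 1)
    (fun _ z => t / (4 * n) * σ * (z ^ 2 - 1)) (fun _ => by fun_prop) _ (t / (4 * n) * t)
    (fun _ => lintegral_exp_sq_gaussianReal hx)
  refine (measure_mono fun z hz => ?_).trans (h.trans (ENNReal.ofReal_le_ofReal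
    (Real.exp_le_exp.2 (le_of_eq ?_))))
  · simp only [Set.mem_ofPred_eq] at hz ⊢
    simp only [mul_assoc (t / (4 * n)), ← Finset.mul_sum]
    simp only [← Finset.mul_sum] at hz
    gcongr
  · have : σ ^ 2 = 1 := by rcases hσ with rfl | rfl <;> norm_num
    rw [mul_pow, this]; field_simp; ring

lemma IsLabel.sq {n : ℕ} {ℓ : Fin n → ℝ} (h : IsLabel ℓ) (i : Fin n) : ℓ i ^ 2 = 1 := by
  rcases h i with h | h <;> rw [h] <;> norm_num

lemma IsLabel.sum_sq {n : ℕ} {ℓ : Fin n → ℝ} (h : IsLabel ℓ) : ∑ i, ℓ i ^ 2 = n := by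
  simp [h.sq]

/-- Nonasymptotic Hamming bound for chi-square screening. -/
lemma hammingSig_chiSel_le {n p : ℕ} {ε τ q u : ℝ} (hn : 1 ≤ n) (hp : 1 ≤ p) (h0 : 0 < ε)
    (h1 : ε ≤ 1) (hτ : 0 < τ) (hτ1 : τ ≤ 1) (hq : 0 ≤ q)
    (hu : u = Real.sqrt (2 * q * Real.log p) * Real.sqrt (2 * n)) (hun : u ≤ n)
    (huτ : 4 * u ≤ n * τ ^ 2) :
    hammingSig n p ε τ dataMap (fun X => chiSel q X) ≤
      Real.exp (-(q * Real.log p / 2)) / ε + 2 * Real.exp (-(q * Real.log p / 2)) +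
        2 * (Real.exp (-(p * ε / 10)) / ε) := by
  have hn' : (0 : ℝ) < n := by exact_mod_cast hn
  have hlog : 0 ≤ Real.log p := Real.log_natCast_nonneg p
  have hu0 : 0 ≤ u := by rw [hu]; positivity
  have hsq : 0 < Real.sqrt (2 * n) := by positivity
  have hu2 : u ^ 2 = 4 * n * (q * Real.log p) := by
    rw [hu, mul_pow, Real.sq_sqrt (by positivity), Real.sq_sqrt (by positivity)]; ring
  have hexp : u ^ 2 / (8 * n) = q * Real.log p / 2 := by rw [hu2]; field_simp; ring
  have hmem : ∀ (X : Fin n → Fin p → ℝ) j, j ∈ chiSel q X ↔ u ≤ (∑ i, X i j ^ 2) - n := by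
    intro X j
    simp only [chiSel, Finset.mem_filter, Finset.mem_univ, true_and]
    rw [le_div_iff₀ hsq, hu]
  refine hammingSig_le hp h0 h1 hτ (Real.exp_pos _).le (by positivity) _ ?_ ?_
  · intro ℓ _ μ _ _ j hj
    rw [← hexp]
    refine (measure_mono fun Z hZ => ?_).trans ((noiseLaw_col_le j _).trans
      (gaussPi_sq_tail (σ := 1) (.inl rfl) hu0 hun))
    simp only [Set.mem_ofPred_eq, hmem, hj, mul_zero, zero_add] at hZ ⊢
    simpa using hZ
  · intro ℓ hl μ _ _ j hj
    rw [two_mul, ENNReal.ofReal_add (Real.exp_pos _).le (Real.exp_pos _).le]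
    have hA := (noiseLaw_col_le (n := n) j _).trans
      (gaussPi_sq_tail (n := n) (σ := -1) (.inr rfl) hu0 hun)
    have hB := (noiseLaw_col_le (n := n) j _).trans
      (gaussPi_linear_tail (t := u) (fun i => -ℓ i) hn' hu0 (by simp [hl.sum_sq]))
    rw [hexp] at hA
    refine (measure_mono fun Z hZ => ?_).trans ((measure_union_le _ _).trans
      (add_le_add hA (hB.trans (ENNReal.ofReal_le_ofReal (Real.exp_le_exp.2 ?_)))))
    · simp only [Set.mem_union, Set.mem_ofPred_eq, hmem, hj, not_le] at hZ ⊢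
      by_contra! hcon
      obtain ⟨h1, h2⟩ := hcon
      have e1 : ∑ i, -1 * (Z i j ^ 2 - 1) = n - ∑ i, Z i j ^ 2 := by
        rw [← Finset.mul_sum, Finset.sum_sub_distrib]; simp
      have e2 : ∑ i, -ℓ i * Z i j = -∑ i, ℓ i * Z i j := by simp [Finset.sum_neg_distrib]
      have e3 : ∑ i, (ℓ i * τ + Z i j) ^ 2 =
          n * τ ^ 2 + 2 * τ * ∑ i, ℓ i * Z i j + ∑ i, Z i j ^ 2 := by
        rw [← hl.sum_sq, Finset.sum_mul, Finset.mul_sum, ← Finset.sum_add_distrib,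
          ← Finset.sum_add_distrib]
        exact Finset.sum_congr rfl fun i _ => by ring
      rw [e1] at h1; rw [e2] at h2; rw [e3] at hZ
      nlinarith
    · rw [← hexp, neg_le_neg_iff]
      gcongr
      norm_num

lemma eventually_log_mul_rpow_le (C : ℝ) (k : ℕ) {a b : ℝ} (hab : a < b) :
    ∀ᶠ p : ℕ in atTop, C * Real.log p ^ k * (p : ℝ) ^ a ≤ (p : ℝ) ^ b := by
  have h := (isLittleO_log_rpow_rpow_atTop (k : ℝ) (sub_pos.2 hab)).bound
    (c := (|C| + 1)⁻¹) (by positivity)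
  filter_upwards [tendsto_natCast_atTop_atTop.eventually h, eventually_ge_atTop 1] with p hp hp1
  have hp0 : (0 : ℝ) < p := by exact_mod_cast hp1
  have hl : 0 ≤ Real.log p := Real.log_natCast_nonneg p
  rw [Real.rpow_natCast, Real.norm_of_nonneg (by positivity), Real.norm_of_nonneg (by positivity),
    le_inv_mul_iff₀ (by positivity), Real.rpow_sub hp0, le_div_iff₀ (by positivity)] at hp
  refine le_trans ?_ hp
  have := le_abs_self C
  gcongr
  linarith

lemma eventually_log_le_rpow (C : ℝ) (k : ℕ) {b : ℝ} (hb : 0 < b) :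
    ∀ᶠ p : ℕ in atTop, C * Real.log p ^ k ≤ (p : ℝ) ^ b := by
  simpa using eventually_log_mul_rpow_le C k hb

lemma tendsto_exp_neg_div_rpow {f : ℕ → ℝ} {β c : ℝ} (hc : β < c)
    (hf : ∀ᶠ p : ℕ in atTop, c * Real.log p ≤ f p) :
    Tendsto (fun p : ℕ => Real.exp (-(f p)) / (p : ℝ) ^ (-β)) atTop (nhds 0) := by
  have h : Tendsto (fun p : ℕ => (p : ℝ) ^ (-(c - β))) atTop (nhds 0) :=
    (tendsto_rpow_neg_atTop (sub_pos.2 hc)).comp tendsto_natCast_atTop_atTop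
  refine squeeze_zero' (.of_forall fun p => by positivity) ?_ h
  filter_upwards [hf, eventually_ge_atTop 1] with p hp hp1
  have hp0 : (0 : ℝ) < p := by exact_mod_cast hp1
  rw [div_le_iff₀ (by positivity), ← Real.rpow_add hp0, Real.rpow_def_of_pos hp0,
    Real.exp_le_exp]
  linarith

lemma tendsto_exp_neg {f : ℕ → ℝ} {c : ℝ} (hc : 0 < c)
    (hf : ∀ᶠ p : ℕ in atTop, c * Real.log p ≤ f p) :
    Tendsto (fun p : ℕ => Real.exp (-(f p))) atTop (nhds 0) := by
  simpa using tendsto_exp_neg_div_rpow hc hf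

lemma tendsto_sparse_term {β : ℝ} (hβ : β < 1) :
    Tendsto (fun p : ℕ => 2 * (Real.exp (-((p : ℝ) * (p : ℝ) ^ (-β) / 10)) / (p : ℝ) ^ (-β)))
      atTop (nhds 0) := by
  have h := (tendsto_exp_neg_div_rpow (f := fun p : ℕ => (p : ℝ) * (p : ℝ) ^ (-β) / 10) hβ (by
    filter_upwards [eventually_log_le_rpow 10 1 (sub_pos.2 hβ), eventually_ge_atTop 1]
      with p hp hp1
    have hp0 : (0 : ℝ) < p := by exact_mod_cast hp1
    rw [sub_eq_add_neg, Real.rpow_add hp0, Real.rpow_one] at hp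
    linarith)).const_mul 2
  simpa using h

lemma rpow_neg_le_one {p : ℕ} (hp : 1 ≤ p) {a : ℝ} (ha : 0 ≤ a) : (p : ℝ) ^ (-a) ≤ 1 :=
  Real.rpow_le_one_of_one_le_of_nonpos (by exact_mod_cast hp) (by linarith)

lemma one_le_nDim {p : ℕ} (hp : 1 ≤ p) (θ : ℝ) : 1 ≤ nDim p θ :=
  Nat.ceil_pos.2 (Real.rpow_pos_of_pos (by exact_mod_cast hp) θ)

lemma rpow_le_nDim (p : ℕ) (θ : ℝ) : (p : ℝ) ^ θ ≤ nDim p θ := Nat.le_ceil _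

lemma nDim_le {p : ℕ} (hp : 1 ≤ p) {θ : ℝ} (hθ : 0 ≤ θ) : (nDim p θ : ℝ) ≤ 2 * (p : ℝ) ^ θ := by
  have h1 : (1 : ℝ) ≤ (p : ℝ) ^ θ := Real.one_le_rpow (by exact_mod_cast hp) hθ
  have := Nat.ceil_lt_add_one (zero_le_one.trans h1)
  unfold nDim; linarith

/-- Success of chi-square screening. -/
lemma tendsto_hammingSig_chiSel {α β θ q : ℝ} (hα0 : 0 < α) (hβ0 : 0 < β) (hβ1 : β < 1)
    (hθ0 : 0 < θ) (hq : 3 ≤ q) (hα : α < θ / 4) :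
    Tendsto (fun p : ℕ => hammingSig (nDim p θ) p ((p : ℝ) ^ (-β)) ((p : ℝ) ^ (-α)) dataMap
      (fun X => chiSel q X)) atTop (nhds 0) := by
  have hlim := ((tendsto_exp_neg_div_rpow (f := fun p : ℕ => q * Real.log p / 2) (β := β)
    (c := q / 2) (by linarith) (.of_forall fun p => by linarith)).add
    ((tendsto_exp_neg (f := fun p : ℕ => q * Real.log p / 2) (c := q / 2) (by linarith)
      (.of_forall fun p => by linarith)).const_mul 2)).add (tendsto_sparse_term hβ1)
  simp only [mul_zero, add_zero] at hlim
  refine squeeze_zero' (.of_forall fun p => hammingSig_nonneg _ _ _ (by positivity) _ _) ?_ hlim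
  filter_upwards [eventually_log_le_rpow (4 * q) 1 hθ0,
    eventually_log_le_rpow (64 * q) 1 (b := θ - 4 * α) (by linarith), eventually_ge_atTop 1]
    with p h1 h2 hp
  have hp0 : (0 : ℝ) < p := by exact_mod_cast hp
  have hn : (p : ℝ) ^ θ ≤ nDim p θ := rpow_le_nDim p θ
  have hn0 : (0 : ℝ) < nDim p θ := by exact_mod_cast one_le_nDim hp θ
  have hlog : 0 ≤ Real.log p := Real.log_natCast_nonneg p
  have hu2 : (Real.sqrt (2 * q * Real.log p) * Real.sqrt (2 * nDim p θ)) ^ 2 =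
      4 * q * Real.log p * nDim p θ := by
    rw [mul_pow, Real.sq_sqrt (by positivity), Real.sq_sqrt (by positivity)]; ring
  have hτ4 : ((p : ℝ) ^ (-α)) ^ 4 = (p : ℝ) ^ (-(4 * α)) := by
    rw [← Real.rpow_natCast, ← Real.rpow_mul hp0.le]; congr 1; push_cast; ring
  refine hammingSig_chiSel_le (one_le_nDim hp θ) hp (by positivity) (rpow_neg_le_one hp hβ0.le)
    (by positivity) (rpow_neg_le_one hp hα0.le) (by linarith) rfl ?_ ?_
  · refine abs_le_of_sq_le_sq' ?_ hn0.le |>.2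
    rw [hu2]
    nlinarith
  · refine abs_le_of_sq_le_sq' ?_ (by positivity) |>.2
    rw [mul_pow, hu2, mul_pow, ← pow_mul, hτ4]
    rw [sub_eq_add_neg, Real.rpow_add hp0, pow_one] at h2
    have h3 : (64 * q * Real.log p) * nDim p θ ≤
        (nDim p θ * (p : ℝ) ^ (-(4 * α))) * nDim p θ :=
      mul_le_mul_of_nonneg_right (h2.trans (by gcongr)) hn0.le
    nlinarith

lemma gaussianReal_Icc_le {v : ℝ≥0} (hv : v ≠ 0) (a b : ℝ) :
    gaussianReal 0 v (Set.Icc a b) ≤ ENNReal.ofReal ((b - a) / Real.sqrt v) := by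
  have hv' : (0 : ℝ) < v := by positivity
  rw [gaussianReal_apply 0 hv]
  calc ∫⁻ x in Set.Icc a b, gaussianPDF 0 v x
      ≤ ∫⁻ _ in Set.Icc a b, ENNReal.ofReal (Real.sqrt v)⁻¹ := by
        refine lintegral_mono fun x => ENNReal.ofReal_le_ofReal ?_
        rw [gaussianPDFReal]
        have h1 : Real.exp (-(x - 0) ^ 2 / (2 * v)) ≤ 1 := by
          rw [Real.exp_le_one_iff, neg_div]
          exact neg_nonpos.2 (by positivity)
        have h2 : (Real.sqrt (2 * Real.pi * v))⁻¹ ≤ (Real.sqrt v)⁻¹ := by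
          gcongr
          nlinarith [Real.pi_gt_three]
        calc _ ≤ (Real.sqrt (2 * Real.pi * v))⁻¹ * 1 := by gcongr
          _ ≤ _ := by rw [mul_one]; exact h2
    _ = _ := by
        rw [lintegral_const, Measure.restrict_apply_univ, Real.volume_Icc,
          ← ENNReal.ofReal_mul (by positivity), mul_comm, div_eq_mul_inv]

lemma le_gaussianReal_Ioo {v : ℝ≥0} (hv : v ≠ 0) {r : ℝ} (hr : r ≤ Real.sqrt v) :
    ENNReal.ofReal (r / Real.sqrt v / 4) ≤ gaussianReal 0 v (Set.Ioo (-r) r) := by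
  have hv' : (0 : ℝ) < v := by positivity
  rw [gaussianReal_apply 0 hv]
  calc _ = ∫⁻ _ in Set.Ioo (-r) r, ENNReal.ofReal (Real.sqrt v * 8)⁻¹ := by
        rw [lintegral_const, Measure.restrict_apply_univ, Real.volume_Ioo,
          ← ENNReal.ofReal_mul (by positivity)]
        congr 1; field_simp; ring
    _ ≤ _ := by
        refine setLIntegral_mono' measurableSet_Ioo fun x hx => ENNReal.ofReal_le_ofReal ?_
        rw [gaussianPDFReal]
        have hx2 : x ^ 2 ≤ v := by
          rw [← Real.sq_sqrt hv'.le]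
          exact sq_le_sq' (by linarith [hx.1]) (by linarith [hx.2])
        have h1 : (1 / 2 : ℝ) ≤ Real.exp (-(x - 0) ^ 2 / (2 * v)) := by
          refine le_trans ?_ (Real.add_one_le_exp _)
          have : (x - 0) ^ 2 / (2 * v) ≤ 1 / 2 := by
            rw [div_le_div_iff₀ (by positivity) (by norm_num)]; simpa using by linarith
          rw [neg_div]; linarith
        have h2 : (Real.sqrt v * 4)⁻¹ ≤ (Real.sqrt (2 * Real.pi * v))⁻¹ := by
          gcongr
          refine Real.sqrt_le_iff.2 ⟨by positivity, ?_⟩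
          rw [mul_pow, Real.sq_sqrt hv'.le]
          nlinarith [Real.pi_lt_four]
        calc (Real.sqrt v * 8)⁻¹ = (Real.sqrt v * 4)⁻¹ * (1 / 2) := by
              field_simp; norm_num
          _ ≤ _ := by gcongr

lemma gaussPi_map_coord_sum {p : ℕ} (j : Fin p) :
    (gaussPi p).map (fun z => (∑ k, z k - z j, z j)) =
      (gaussianReal 0 ((p : ℝ) - 1).toNNReal).prod (gaussianReal 0 1) := by
  set a : Fin p → ℝ := fun k => if k = j then 0 else 1
  have ha : ∑ k, a k ^ 2 = (p : ℝ) - 1 := by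
    have : ∀ k, a k ^ 2 = 1 - if k = j then 1 else 0 := fun k => by
      by_cases h : k = j <;> simp [a, h]
    simp [this]
  have h := map_update_pi (fun _ : Fin p => gaussianReal 0 1) j
  have hm : Measurable fun q : (Fin p → ℝ) × ℝ => Function.update q.1 j q.2 :=
    measurable_update_prod j
  rw [gaussPi, ← h, Measure.map_map (by fun_prop) hm]
  have hcomp : (fun z : Fin p → ℝ => (∑ k, z k - z j, z j)) ∘
      (fun q : (Fin p → ℝ) × ℝ => Function.update q.1 j q.2) =
      Prod.map (fun w => ∑ k, a k * w k) id := by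
    ext q
    · have : ∀ k, Function.update q.1 j q.2 k = a k * q.1 k + if k = j then q.2 else 0 := by
        intro k
        by_cases hk : k = j
        · subst hk; simp [a]
        · simp [a, hk]
      simp only [Function.comp, Function.update_self]
      simp [this, Finset.sum_add_distrib]
    · simp
  rw [hcomp, ← Measure.map_prod_map _ _ (by fun_prop) measurable_id, Measure.map_id]
  congr 1
  rw [← ha]
  exact gaussPi_map_linear a

lemma measurable_sign : Measurable Real.sign :=
  Measurable.ite measurableSet_Iio measurable_const
    (Measurable.ite measurableSet_Ioi measurable_const measurable_const)

lemma abs_sign_le_one (x : ℝ) : |Real.sign x| ≤ 1 := by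
  rcases Real.sign_apply_eq x with h | h | h <;> simp [h]

lemma exp_mul_sign_add_le {σ lam z b : ℝ} (hσ : σ = 1 ∨ σ = -1) (hl : 0 ≤ lam) :
    Real.exp (lam * (σ * (z * Real.sign (b + z)))) ≤
      Real.exp (lam * (σ * (z * Real.sign b))) +
        (Set.Icc (-|z|) |z|).indicator (fun _ => 2 * lam * |z| * Real.exp (lam * |z|)) b := by
  have hσ' : |σ| = 1 := by rcases hσ with rfl | rfl <;> simp
  have hbd : ∀ s : ℝ, |s| ≤ 1 → |lam * (σ * (z * s))| ≤ lam * |z| := fun s hs => by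
    rw [abs_mul, abs_mul, abs_mul, hσ', abs_of_nonneg hl, one_mul]
    exact mul_le_mul_of_nonneg_left (mul_le_of_le_one_right (abs_nonneg _) hs) hl
  by_cases hb : b ∈ Set.Icc (-|z|) |z|
  · rw [Set.indicator_of_mem hb]
    have h1 := (abs_le.1 (hbd _ (abs_sign_le_one (b + z)))).2
    have h2 := (abs_le.1 (hbd _ (abs_sign_le_one b))).1
    have h3 := Real.add_one_le_exp (-(2 * lam * |z|))
    have h4 : Real.exp (-(lam * |z|)) = Real.exp (lam * |z|) * Real.exp (-(2 * lam * |z|)) := by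
      rw [← Real.exp_add]; ring_nf
    have h5 := Real.exp_le_exp.2 h1
    have h6 := Real.exp_le_exp.2 h2
    rw [h4] at h6
    nlinarith [Real.exp_pos (lam * |z|)]
  · rw [Set.indicator_of_notMem hb, add_zero]
    have : Real.sign (b + z) = Real.sign b := by
      rw [Set.mem_Icc, not_and_or, not_le, not_le] at hb
      rcases hb with hb | hb
      · rw [Real.sign_of_neg, Real.sign_of_neg] <;>
          linarith [le_abs_self z, neg_abs_le z, abs_nonneg z]
      · rw [Real.sign_of_pos, Real.sign_of_pos] <;>
          linarith [le_abs_self z, neg_abs_le z, abs_nonneg z]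
    rw [this]

lemma lintegral_sq_mul_exp_abs_gaussianReal_le :
    ∫⁻ z, ENNReal.ofReal (z ^ 2 * Real.exp |z|) ∂gaussianReal 0 1 ≤ ENNReal.ofReal 32 := by
  calc _ ≤ ∫⁻ z, (ENNReal.ofReal 2 * ENNReal.ofReal (Real.exp (2 * z)) +
        ENNReal.ofReal 2 * ENNReal.ofReal (Real.exp (-2 * z))) ∂gaussianReal 0 1 := by
        refine lintegral_mono fun z => ?_
        rw [← ENNReal.ofReal_mul zero_le_two, ← ENNReal.ofReal_mul zero_le_two,
          ← ENNReal.ofReal_add (by positivity) (by positivity)]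
        apply ENNReal.ofReal_le_ofReal
        have h1 : z ^ 2 ≤ 2 * Real.exp |z| := by
          have := Real.quadratic_le_exp_of_nonneg (abs_nonneg z)
          rw [← sq_abs]; nlinarith [abs_nonneg z]
        have h2 : Real.exp |z| * Real.exp |z| ≤ Real.exp (2 * z) + Real.exp (-2 * z) := by
          rw [← Real.exp_add]
          rcases abs_cases z with ⟨h, -⟩ | ⟨h, -⟩ <;> rw [h]
          · have := Real.exp_pos (-2 * z); ring_nf at *; linarith
          · have := Real.exp_pos (2 * z); ring_nf at *; linarith
        nlinarith [Real.exp_pos |z|]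
    _ = ENNReal.ofReal (4 * Real.exp 2) := by
        rw [lintegral_add_left (by fun_prop), lintegral_const_mul _ (by fun_prop),
          lintegral_const_mul _ (by fun_prop), lintegral_exp_gaussianReal,
          lintegral_exp_gaussianReal, ← ENNReal.ofReal_mul zero_le_two,
          ← ENNReal.ofReal_mul zero_le_two, ← ENNReal.ofReal_add (by positivity) (by positivity)]
        congr 1
        norm_num
        ring
    _ ≤ _ := by
        apply ENNReal.ofReal_le_ofReal
        have h := Real.exp_one_lt_d9
        have : Real.exp 2 = Real.exp 1 * Real.exp 1 := by rw [← Real.exp_add]; norm_num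
        nlinarith [Real.exp_pos 1]

/-- The sign of a row sum is nearly independent of each of its entries. -/
lemma lintegral_exp_mul_sign_le {p : ℕ} (hp : 2 ≤ p) (j : Fin p) (c : ℝ) {σ lam : ℝ}
    (hσ : σ = 1 ∨ σ = -1) (h0 : 0 ≤ lam) (h1 : lam ≤ 1) :
    ∫⁻ z, ENNReal.ofReal (Real.exp (lam * (σ * (z j * Real.sign (c + ∑ k, z k))))) ∂gaussPi p
      ≤ ENNReal.ofReal (Real.exp (lam ^ 2 / 2 + 128 * lam / Real.sqrt ((p : ℝ) - 1))) := by
  have hp' : (2 : ℝ) ≤ p := by exact_mod_cast hp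
  set v : ℝ≥0 := ((p : ℝ) - 1).toNNReal with hv
  have hvv : (v : ℝ) = (p : ℝ) - 1 := Real.coe_toNNReal _ (by linarith)
  have hv0 : v ≠ 0 := by
    have : (0 : ℝ) < v := by rw [hvv]; linarith
    exact_mod_cast this.ne'
  have hm := measurable_sign
  set G := gaussianReal 0 1
  set H := gaussianReal 0 v
  set F : ℝ × ℝ → ℝ≥0∞ := fun q =>
    ENNReal.ofReal (Real.exp (lam * (σ * (q.2 * Real.sign (c + q.1 + q.2)))))
  have hF : Measurable F := by fun_prop
  have hI : Measurable fun q : ℝ × ℝ => (Set.Icc (-|q.2|) |q.2|).indicator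
      (fun _ => 2 * lam * |q.2| * Real.exp (lam * |q.2|)) (c + q.1) := by
    have hS : MeasurableSet {q : ℝ × ℝ | -|q.2| ≤ c + q.1 ∧ c + q.1 ≤ |q.2|} :=
      (measurableSet_le (f := fun q : ℝ × ℝ => -|q.2|) (g := fun q => c + q.1)
        (by fun_prop) (by fun_prop)).inter (measurableSet_le (f := fun q : ℝ × ℝ => c + q.1)
        (g := fun q => |q.2|) (by fun_prop) (by fun_prop))
    exact (by fun_prop : Measurable fun q : ℝ × ℝ =>
      2 * lam * |q.2| * Real.exp (lam * |q.2|)).indicator hS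
  calc _ = ∫⁻ q, F q ∂(H.prod G) := by
        rw [← gaussPi_map_coord_sum j, lintegral_map hF (by fun_prop)]
        simp only [F]
        refine lintegral_congr fun z => ?_
        congr 6; ring
    _ ≤ ∫⁻ q, (ENNReal.ofReal (Real.exp (lam * (σ * (q.2 * Real.sign (c + q.1))))) +
          ENNReal.ofReal ((Set.Icc (-|q.2|) |q.2|).indicator
            (fun _ => 2 * lam * |q.2| * Real.exp (lam * |q.2|)) (c + q.1))) ∂(H.prod G) := by
        refine lintegral_mono fun q => ?_
        rw [← ENNReal.ofReal_add (Real.exp_pos _).le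
          (Set.indicator_nonneg (fun _ _ => by positivity) _)]
        exact ENNReal.ofReal_le_ofReal (exp_mul_sign_add_le hσ h0)
    _ ≤ ENNReal.ofReal (Real.exp (lam ^ 2 / 2)) +
          ENNReal.ofReal (128 * lam / Real.sqrt v) := by
        rw [lintegral_add_left (by fun_prop)]
        refine add_le_add ?_ ?_
        · rw [lintegral_prod _ (by fun_prop)]
          refine (lintegral_mono fun b => ?_).trans (lintegral_const _).le |>.trans (by simp; rfl)
          have : ∀ z : ℝ, lam * (σ * (z * Real.sign (c + b))) = lam * σ * Real.sign (c + b) * z :=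
            fun z => by ring
          simp only [this]
          rw [lintegral_exp_gaussianReal]
          apply ENNReal.ofReal_le_ofReal
          rw [Real.exp_le_exp]
          have h1 : σ ^ 2 = 1 := by rcases hσ with rfl | rfl <;> norm_num
          have h2 : Real.sign (c + b) ^ 2 ≤ 1 := by
            rw [sq_le_one_iff_abs_le_one]; exact abs_sign_le_one _
          rw [mul_pow, mul_pow, h1]
          push_cast
          nlinarith [sq_nonneg lam]
        · rw [lintegral_prod_symm _ hI.ennreal_ofReal.aemeasurable]
          calc _ ≤ ∫⁻ z, ENNReal.ofReal (4 * lam / Real.sqrt v) *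
                ENNReal.ofReal (z ^ 2 * Real.exp |z|) ∂G := by
                refine lintegral_mono fun z => ?_
                have e : ∀ b, ENNReal.ofReal ((Set.Icc (-|z|) |z|).indicator
                    (fun _ => 2 * lam * |z| * Real.exp (lam * |z|)) (c + b)) =
                    (Set.Icc (-|z| - c) (|z| - c)).indicator
                    (fun _ => ENNReal.ofReal (2 * lam * |z| * Real.exp (lam * |z|))) b := by
                  intro b
                  simp only [Set.indicator, Set.mem_Icc]
                  have : (-|z| ≤ c + b ∧ c + b ≤ |z|) ↔ (-|z| - c ≤ b ∧ b ≤ |z| - c) := by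
                    constructor <;> rintro ⟨h1, h2⟩ <;> constructor <;> linarith
                  simp only [this]
                  split_ifs <;> simp
                simp only [e]
                rw [lintegral_indicator measurableSet_Icc, setLIntegral_const]
                calc _ ≤ ENNReal.ofReal (2 * lam * |z| * Real.exp (lam * |z|)) *
                      ENNReal.ofReal ((|z| - c - (-|z| - c)) / Real.sqrt v) := by
                      gcongr; exact gaussianReal_Icc_le hv0 _ _
                  _ ≤ _ := by
                      rw [← ENNReal.ofReal_mul (by positivity),
                        ← ENNReal.ofReal_mul (by positivity)]
                      apply ENNReal.ofReal_le_ofReal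
                      have : Real.exp (lam * |z|) ≤ Real.exp |z| := by
                        rw [Real.exp_le_exp]; exact mul_le_of_le_one_left (abs_nonneg _) h1
                      calc _ = 4 * lam / Real.sqrt v * (z ^ 2 * Real.exp (lam * |z|)) := by
                            rw [← sq_abs z]; ring
                        _ ≤ _ := by gcongr
            _ ≤ ENNReal.ofReal (4 * lam / Real.sqrt v) * ENNReal.ofReal 32 := by
                rw [lintegral_const_mul _ (by fun_prop)]
                gcongr
                exact lintegral_sq_mul_exp_abs_gaussianReal_le
            _ = _ := by
                rw [← ENNReal.ofReal_mul (by positivity)]; congr 1; ring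
    _ ≤ _ := by
        rw [← ENNReal.ofReal_add (Real.exp_pos _).le (by positivity), hvv]
        apply ENNReal.ofReal_le_ofReal
        set y := 128 * lam / Real.sqrt ((p : ℝ) - 1) with hy
        have hy0 : 0 ≤ y := by positivity
        have h3 : 1 ≤ Real.exp (lam ^ 2 / 2) := Real.one_le_exp (by positivity)
        have h4 := Real.add_one_le_exp y
        rw [Real.exp_add]
        nlinarith

lemma exp_sign_add_exp_sign_le {lam s w : ℝ} (hl : 0 ≤ lam) (hs : 0 < s) :
    Real.exp (-(lam * Real.sign (s + w))) + Real.exp (-(lam * Real.sign (s + -w))) ≤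
      2 * Real.cosh lam := by
  have h1 := Real.one_le_exp hl
  have h2 : Real.exp (-lam) ≤ 1 := Real.exp_le_one_iff.2 (by linarith)
  have h3 := Real.one_le_cosh lam
  have h4 := Real.cosh_eq lam
  have hab : 0 < (s + w) + (s + -w) := by linarith
  generalize s + w = a at *
  generalize s + -w = b at *
  rcases lt_trichotomy a 0 with ha | ha | ha <;> rcases lt_trichotomy b 0 with hb | hb | hb <;>
    simp only [Real.sign_of_neg, Real.sign_of_pos, Real.sign_zero, ha, hb, mul_zero, mul_one,
      mul_neg, neg_neg, neg_zero, Real.exp_zero] <;>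
    linarith

lemma cosh_sub_mul_sinh_le {lam P m : ℝ} (h0 : 0 ≤ lam) (h1 : lam ≤ 1) (hm : m ≤ P)
    (hP : 0 ≤ P) :
    Real.exp (-lam) * P + Real.cosh lam * (1 - P) ≤ Real.exp (lam ^ 2 - lam * m) := by
  have h2 : Real.cosh lam ≤ 1 + lam ^ 2 := by
    refine (Real.cosh_le_exp_half_sq lam).trans ?_
    have := (abs_le.1 (Real.abs_exp_sub_one_sub_id_le (x := lam ^ 2 / 2)
      (by rw [abs_of_nonneg (by positivity)]; nlinarith))).2
    have h : lam ^ 2 ≤ 1 := by nlinarith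
    nlinarith [sq_nonneg lam]
  have h3 : lam ≤ Real.sinh lam := Real.self_le_sinh_iff.2 h0
  have h4 := Real.add_one_le_exp (lam ^ 2 - lam * m)
  rw [← Real.cosh_sub_sinh]
  nlinarith

lemma lintegral_exp_neg_sign_le {v : ℝ≥0} (hv : v ≠ 0) {s r lam : ℝ} (hr0 : 0 < r) (hrs : r ≤ s)
    (hr : r ≤ Real.sqrt v) (h0 : 0 ≤ lam) (h1 : lam ≤ 1) :
    ∫⁻ w, ENNReal.ofReal (Real.exp (-(lam * Real.sign (s + w)))) ∂gaussianReal 0 v ≤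
      ENNReal.ofReal (Real.exp (lam ^ 2 - lam * (r / Real.sqrt v / 4))) := by
  have hm := measurable_sign
  set N := gaussianReal 0 v
  set A := Set.Ioo (-r) r
  have hA : MeasurableSet A := measurableSet_Ioo
  set f : ℝ → ℝ≥0∞ := fun w => ENNReal.ofReal (Real.exp (-(lam * Real.sign (s + w)))) with hf
  have hfm : Measurable f := by fun_prop
  have hsymm : ∫⁻ w, f (-w) ∂N = ∫⁻ w, f w ∂N := by
    have h : N.map (fun x => -x) = N := by
      simpa using gaussianReal_map_neg (μ := 0) (v := v)
    conv_rhs => rw [← h]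
    rw [lintegral_map hfm measurable_neg]
  have hPA : N A = ENNReal.ofReal (N.real A) := (ENNReal.ofReal_toReal (by simp)).symm
  have hPAc : N Aᶜ = ENNReal.ofReal (1 - N.real A) := by
    rw [← probReal_compl_eq_one_sub hA]
    exact (ENNReal.ofReal_toReal (by simp)).symm
  have hP : r / Real.sqrt v / 4 ≤ N.real A := by
    have := le_gaussianReal_Ioo hv hr
    rw [hPA] at this
    exact (ENNReal.ofReal_le_ofReal_iff measureReal_nonneg).1 this
  have hP1 : N.real A ≤ 1 := measureReal_le_one
  have key : 2 * ∫⁻ w, f w ∂N ≤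
      2 * ENNReal.ofReal (Real.exp (lam ^ 2 - lam * (r / Real.sqrt v / 4))) := by
    calc 2 * ∫⁻ w, f w ∂N = ∫⁻ w, (f w + f (-w)) ∂N := by
          rw [lintegral_add_left hfm, hsymm, two_mul]
      _ ≤ ∫⁻ w, (A.indicator (fun _ => ENNReal.ofReal (2 * Real.exp (-lam))) w +
            Aᶜ.indicator (fun _ => ENNReal.ofReal (2 * Real.cosh lam)) w) ∂N := by
          refine lintegral_mono fun w => ?_
          simp only [hf]
          rw [← ENNReal.ofReal_add (Real.exp_pos _).le (Real.exp_pos _).le]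
          by_cases hw : w ∈ A
          · rw [Set.indicator_of_mem hw, Set.indicator_of_notMem (by simpa using hw), add_zero,
              Real.sign_of_pos (by linarith [hw.1]), Real.sign_of_pos (by linarith [hw.2]),
              two_mul, mul_one]
          · rw [Set.indicator_of_notMem hw, Set.indicator_of_mem hw, zero_add]
            exact ENNReal.ofReal_le_ofReal (exp_sign_add_exp_sign_le h0 (by linarith))
      _ = 2 * ENNReal.ofReal (Real.exp (-lam) * N.real A + Real.cosh lam * (1 - N.real A)) := by
          have hc : 0 < Real.cosh lam := Real.cosh_pos lam
          rw [lintegral_add_left (measurable_const.indicator hA), lintegral_indicator hA,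
            lintegral_indicator hA.compl, setLIntegral_const, setLIntegral_const, hPA, hPAc,
            ← ENNReal.ofReal_mul (by positivity), ← ENNReal.ofReal_mul (by positivity),
            ← ENNReal.ofReal_add (by positivity) (mul_nonneg (by positivity) (by linarith)),
            ← ENNReal.ofReal_ofNat 2, ← ENNReal.ofReal_mul (by norm_num)]
          congr 1; ring
      _ ≤ _ := by
          gcongr
          exact cosh_sub_mul_sinh_le h0 h1 hP measureReal_nonneg
  exact (ENNReal.mul_le_mul_iff_right (by simp) (by simp)).1 key

lemma lintegral_exp_neg_label_sign_le {p : ℕ} (hp : 1 ≤ p) {ℓ s r lam : ℝ}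
    (hℓ : ℓ = 1 ∨ ℓ = -1) (hr0 : 0 < r) (hrs : r ≤ s) (hr : r ≤ Real.sqrt p) (h0 : 0 ≤ lam)
    (h1 : lam ≤ 1) :
    ∫⁻ z, ENNReal.ofReal (Real.exp (-(lam * (ℓ * Real.sign (ℓ * s + ∑ k, z k))))) ∂gaussPi p ≤
      ENNReal.ofReal (Real.exp (lam ^ 2 - lam * (r / Real.sqrt p / 4))) := by
  have hm := measurable_sign
  have e : ∀ z : Fin p → ℝ, ℓ * Real.sign (ℓ * s + ∑ k, z k) =
      Real.sign (s + ∑ k, ℓ * z k) := by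
    intro z
    rcases hℓ with rfl | rfl
    · simp
    · rw [neg_one_mul, ← Real.sign_neg, ← Finset.mul_sum]
      congr 1; ring
  simp only [e]
  have hv : (∑ _k : Fin p, ℓ ^ 2).toNNReal = (p : ℝ≥0) := by
    have : ℓ ^ 2 = 1 := by rcases hℓ with rfl | rfl <;> norm_num
    simp [this]
  have h := lintegral_exp_neg_sign_le (v := (p : ℝ≥0)) (by positivity) hr0 hrs
    (by simpa using hr) h0 h1
  rw [← hv, ← gaussPi_map_linear, hv, lintegral_map (by fun_prop) (by fun_prop)] at h
  simpa using h

/-- Simple aggregation agrees with the labels on a nonvanishing fraction of the samples. -/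
lemma label_agreement_tail {n p : ℕ} (hp : 1 ≤ p) {ℓ : Fin n → ℝ} (hℓ : IsLabel ℓ) {s m : ℝ}
    (hm0 : 0 < m) (hm1 : m ≤ 1 / 4) (hms : 4 * m * Real.sqrt p ≤ s) :
    noiseLaw n p {Z | ∑ i, ℓ i * Real.sign (ℓ i * s + ∑ k, Z i k) ≤ n * m / 4} ≤
      ENNReal.ofReal (Real.exp (-(n * m ^ 2 / 8))) := by
  have hp' : (0 : ℝ) < p := by exact_mod_cast hp
  have hm := measurable_sign
  have h := chernoff_pi (n := n) (gaussPi p)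
    (fun i z => -(m / 2 * (ℓ i * Real.sign (ℓ i * s + ∑ k, z k)))) (fun i => by fun_prop) _
    (-(m / 2 * (n * m / 4))) (fun i => lintegral_exp_neg_label_sign_le hp (hℓ i)
      (r := 4 * m * Real.sqrt p) (by positivity) hms
      (mul_le_of_le_one_left (Real.sqrt_nonneg _) (by linarith)) (by positivity) (by linarith))
  refine (measure_mono fun Z hZ => ?_).trans (h.trans (ENNReal.ofReal_le_ofReal
    (Real.exp_le_exp.2 (le_of_eq ?_))))
  · simp only [Set.mem_ofPred_eq] at hZ ⊢
    rw [Finset.sum_neg_distrib, ← Finset.mul_sum, neg_le_neg_iff]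
    gcongr
  · have : 0 < Real.sqrt p := by positivity
    field_simp; ring

lemma sum_mul_sign_tail {n p : ℕ} (hn : 1 ≤ n) (hp : 2 ≤ p) (j : Fin p) (c : Fin n → ℝ) {T : ℝ}
    (hT0 : 0 ≤ T) (hT : T ≤ Real.sqrt n) :
    noiseLaw n p {Z | T * Real.sqrt n ≤ |∑ i, Z i j * Real.sign (c i + ∑ k, Z i k)|} ≤
      ENNReal.ofReal (2 * Real.exp
        (-(T ^ 2 / 2 - 128 * T * Real.sqrt n / Real.sqrt ((p : ℝ) - 1)))) := by
  have hn' : (0 : ℝ) < n := by exact_mod_cast hn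
  have hsn : 0 < Real.sqrt n := by positivity
  have hsq : Real.sqrt n ^ 2 = n := Real.sq_sqrt hn'.le
  have hm := measurable_sign
  have h : ∀ σ : ℝ, σ = 1 ∨ σ = -1 →
      noiseLaw n p {Z | T * Real.sqrt n ≤ σ * ∑ i, Z i j * Real.sign (c i + ∑ k, Z i k)} ≤
      ENNReal.ofReal (Real.exp
        (-(T ^ 2 / 2 - 128 * T * Real.sqrt n / Real.sqrt ((p : ℝ) - 1)))) := by
    intro σ hσ
    have h := chernoff_pi (n := n) (gaussPi p)
      (fun i z => T / Real.sqrt n * (σ * (z j * Real.sign (c i + ∑ k, z k))))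
      (fun i => by fun_prop) _ (T / Real.sqrt n * (T * Real.sqrt n))
      (fun i => lintegral_exp_mul_sign_le hp j (c i) hσ (by positivity)
        (by rw [div_le_one hsn]; exact hT))
    refine (measure_mono fun Z hZ => ?_).trans (h.trans (ENNReal.ofReal_le_ofReal
      (Real.exp_le_exp.2 (le_of_eq ?_))))
    · simp only [Set.mem_ofPred_eq] at hZ ⊢
      rw [← Finset.mul_sum, ← Finset.mul_sum]
      gcongr
    · have : 0 < Real.sqrt ((p : ℝ) - 1) := by
        have : (2 : ℝ) ≤ p := by exact_mod_cast hp
        exact Real.sqrt_pos.2 (by linarith)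
      generalize Real.sqrt n = y at *
      rw [← hsq]
      field_simp; ring
  rw [two_mul, ENNReal.ofReal_add (Real.exp_pos _).le (Real.exp_pos _).le]
  refine (measure_mono fun Z hZ => ?_).trans ((measure_union_le _ _).trans
    (add_le_add (h 1 (.inl rfl)) (h (-1) (.inr rfl))))
  simp only [Set.mem_union, Set.mem_ofPred_eq] at hZ ⊢
  rw [one_mul, neg_one_mul]
  exact le_abs.1 hZ

/-- Nonasymptotic Hamming bound for thresholding after simple aggregation. -/
lemma hammingSig_ShatSA_le {n p : ℕ} {ε τ T m c₀ : ℝ} (hn : 1 ≤ n) (hp : 2 ≤ p) (h0 : 0 < ε)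
    (h1 : ε ≤ 1) (hτ : 0 < τ) (hT : T = Real.sqrt (2 * Real.log p)) (hTn : T ≤ Real.sqrt n)
    (hm0 : 0 < m) (hm1 : m ≤ 1 / 4) (hm2 : 4 * m * Real.sqrt p ≤ τ * (p * ε / 2))
    (hmT : 8 * T ≤ Real.sqrt n * τ * m)
    (hc₀ : c₀ = 2 * Real.exp
        (-(T ^ 2 / 2 - 128 * T * Real.sqrt n / Real.sqrt ((p : ℝ) - 1)))) :
    hammingSig n p ε τ dataMap ShatSA ≤
      c₀ / ε + (c₀ + Real.exp (-(n * m ^ 2 / 8))) + 2 * (Real.exp (-(p * ε / 10)) / ε) := by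
  have hn' : (0 : ℝ) < n := by exact_mod_cast hn
  have hsn : 0 < Real.sqrt n := by positivity
  have hsq : Real.sqrt n * Real.sqrt n = n := Real.mul_self_sqrt hn'.le
  have hT0 : 0 ≤ T := by rw [hT]; positivity
  have hc : 0 ≤ c₀ := by rw [hc₀]; positivity
  have hmem : ∀ (X : Fin n → Fin p → ℝ) j, j ∈ ShatSA X ↔
      T * Real.sqrt n ≤ |∑ i, X i j * Real.sign (∑ k, X i k)| := by
    intro X j
    simp only [ShatSA, Finset.mem_filter, Finset.mem_univ, true_and]
    simp only [ySA, ellSimpleAgg]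
    rw [abs_mul, abs_of_nonneg (inv_nonneg.2 hsn.le), le_inv_mul_iff₀ hsn, hT, mul_comm]
  have hrow : ∀ (ℓ : Fin n → ℝ) (μ : Fin p → ℝ) (Z : Fin n → Fin p → ℝ) (i : Fin n),
      ∑ k, (ℓ i * μ k + Z i k) = ℓ i * ∑ k, μ k + ∑ k, Z i k := by
    intro ℓ μ Z i; rw [Finset.sum_add_distrib, Finset.mul_sum]
  refine hammingSig_le (by omega) h0 h1 hτ hc (by positivity) _ ?_ ?_
  · intro ℓ _ μ _ _ j hj
    have h := sum_mul_sign_tail hn hp j (fun i => ℓ i * ∑ k, μ k) hT0 hTn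
    rw [← hc₀] at h
    refine (measure_mono fun Z hZ => ?_).trans h
    simpa only [Set.mem_ofPred_eq, hmem, hrow, hj, mul_zero, zero_add] using hZ
  · intro ℓ hℓ μ _ hμ j hj
    have hA := sum_mul_sign_tail hn hp j (fun i => ℓ i * ∑ k, μ k) hT0 hTn
    rw [← hc₀] at hA
    have hB := label_agreement_tail (p := p) (by omega) hℓ hm0 hm1 (hm2.trans hμ)
    rw [ENNReal.ofReal_add hc (Real.exp_pos _).le]
    refine (measure_mono fun Z hZ => ?_).trans ((measure_union_le _ _).trans (add_le_add hA hB))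
    simp only [Set.mem_ofPred_eq, hmem, hrow, hj, not_le, Set.mem_union] at hZ ⊢
    by_contra! hcon
    obtain ⟨hc1, hc2⟩ := hcon
    have e : ∑ i, (ℓ i * τ + Z i j) * Real.sign (ℓ i * ∑ k, μ k + ∑ k, Z i k) =
        τ * ∑ i, ℓ i * Real.sign (ℓ i * ∑ k, μ k + ∑ k, Z i k) +
          ∑ i, Z i j * Real.sign (ℓ i * ∑ k, μ k + ∑ k, Z i k) := by
      rw [Finset.mul_sum, ← Finset.sum_add_distrib]
      exact Finset.sum_congr rfl fun i _ => by ring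
    rw [e] at hZ
    have h2 := (abs_lt.1 hc1).1
    have h3 := (abs_lt.1 hZ).2
    have h4 : τ * (n * m / 4) < τ * ∑ i, ℓ i * Real.sign (ℓ i * ∑ k, μ k + ∑ k, Z i k) := by
      gcongr
    have h5 : 8 * T * Real.sqrt n ≤ n * τ * m := by
      calc _ ≤ Real.sqrt n * τ * m * Real.sqrt n := by gcongr
        _ = Real.sqrt n * Real.sqrt n * τ * m := by ring
        _ = _ := by rw [hsq]
    nlinarith

lemma eventually_one_le_log : ∀ᶠ p : ℕ in atTop, 1 ≤ Real.log p :=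
  (Real.tendsto_log_atTop.comp tendsto_natCast_atTop_atTop).eventually_ge_atTop 1

/-- Success of thresholding after simple aggregation. -/
lemma tendsto_hammingSig_ShatSA {α β θ : ℝ} (hα0 : 0 < α) (hβ0 : 0 < β) (hβ1 : β < 1)
    (hθ0 : 0 < θ) (hθ1 : θ < 1) (hβ : β < (1 - θ) / 2) (hα : α < θ / 2) :
    Tendsto (fun p : ℕ => hammingSig (nDim p θ) p ((p : ℝ) ^ (-β)) ((p : ℝ) ^ (-α)) dataMap
      ShatSA) atTop (nhds 0) := by
  obtain ⟨γ, hγ0, hγ1, hγ2⟩ : ∃ γ : ℝ, 0 ≤ γ ∧ α + β - 1 / 2 ≤ γ ∧ α + γ < θ / 2 :=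
    ⟨max 0 (α + β - 1 / 2), le_max_left _ _, le_max_right _ _, by
      rcases max_cases 0 (α + β - 1 / 2) with ⟨h, -⟩ | ⟨h, -⟩ <;> rw [h] <;> linarith⟩
  obtain ⟨δ, hδ0, hδ⟩ : ∃ δ : ℝ, 0 < δ ∧ 1 - 128 * δ = (1 + β) / 2 :=
    ⟨(1 - β) / 256, by linarith, by ring⟩
  set f : ℕ → ℝ := fun p => Real.sqrt (2 * Real.log p) ^ 2 / 2 -
    128 * Real.sqrt (2 * Real.log p) * Real.sqrt (nDim p θ) / Real.sqrt ((p : ℝ) - 1) with hf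
  have hfle : ∀ᶠ p : ℕ in atTop, (1 + β) / 2 * Real.log p ≤ f p := by
    filter_upwards [eventually_log_mul_rpow_le (8 / δ ^ 2) 0 hθ1, eventually_one_le_log,
      eventually_ge_atTop 2] with p h1 hl hp
    have hp2 : (2 : ℝ) ≤ p := by exact_mod_cast hp
    rw [pow_zero, mul_one, Real.rpow_one, div_mul_eq_mul_div, div_le_iff₀ (by positivity)] at h1
    have hn := nDim_le (by omega : 1 ≤ p) hθ0.le
    have hs : 0 < Real.sqrt ((p : ℝ) - 1) := Real.sqrt_pos.2 (by linarith)
    have key : Real.sqrt (2 * Real.log p) * Real.sqrt (nDim p θ) ≤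
        δ * Real.log p * Real.sqrt ((p : ℝ) - 1) := by
      refine (abs_le_of_sq_le_sq' ?_ (by positivity)).2
      rw [mul_pow, mul_pow, Real.sq_sqrt (by linarith), Real.sq_sqrt (by positivity),
        Real.sq_sqrt (by linarith)]
      have h2 : 2 * (nDim p θ : ℝ) ≤ δ ^ 2 * ((p : ℝ) - 1) := by nlinarith [sq_nonneg δ]
      have h3 : δ ^ 2 * ((p : ℝ) - 1) ≤ δ ^ 2 * ((p : ℝ) - 1) * Real.log p :=
        le_mul_of_one_le_right (mul_nonneg (sq_nonneg δ) (by linarith)) hl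
      calc _ = 2 * (nDim p θ : ℝ) * Real.log p := by ring
        _ ≤ δ ^ 2 * ((p : ℝ) - 1) * Real.log p * Real.log p :=
          mul_le_mul_of_nonneg_right (h2.trans h3) (by linarith)
        _ = _ := by ring
    have h4 : 128 * Real.sqrt (2 * Real.log p) * Real.sqrt (nDim p θ) / Real.sqrt ((p : ℝ) - 1)
        ≤ 128 * δ * Real.log p := by
      rw [div_le_iff₀ hs]; linarith
    simp only [hf]
    rw [Real.sq_sqrt (by positivity), ← hδ]
    linarith
  set g : ℕ → ℝ := fun p => nDim p θ * ((p : ℝ) ^ (-γ) / 8) ^ 2 / 8 with hg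
  have hgle : ∀ᶠ p : ℕ in atTop, 1 * Real.log p ≤ g p := by
    filter_upwards [eventually_log_le_rpow 512 1 (b := θ - 2 * γ) (by
      linarith), eventually_ge_atTop 1]
      with p h1 hp
    have hp0 : (0 : ℝ) < p := by exact_mod_cast hp
    have h2 : (p : ℝ) ^ (θ - 2 * γ) = (p : ℝ) ^ θ * ((p : ℝ) ^ (-γ)) ^ 2 := by
      rw [← Real.rpow_natCast, ← Real.rpow_mul hp0.le, ← Real.rpow_add hp0]; congr 1
      push_cast; ring
    have h3 : (p : ℝ) ^ θ * ((p : ℝ) ^ (-γ)) ^ 2 ≤ nDim p θ * ((p : ℝ) ^ (-γ)) ^ 2 := by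
      gcongr; exact rpow_le_nDim p θ
    simp only [hg]
    rw [h2, pow_one] at h1
    rw [div_pow]
    linarith
  have hlim := (((tendsto_exp_neg_div_rpow (f := f) (β := β) (by linarith) hfle).const_mul 2).add
    (((tendsto_exp_neg (f := f) (by linarith) hfle).const_mul 2).add
      (tendsto_exp_neg (f := g) one_pos hgle))).add (tendsto_sparse_term hβ1)
  simp only [mul_zero, add_zero] at hlim
  refine squeeze_zero' (.of_forall fun p => hammingSig_nonneg _ _ _ (by positivity) _ _) ?_ hlim
  filter_upwards [eventually_log_le_rpow 2 1 hθ0,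
    eventually_log_le_rpow 8192 1 (b := θ - 2 * α - 2 * γ) (by linarith), eventually_ge_atTop 2]
    with p h1 h2 hp
  have hp0 : (0 : ℝ) < p := by have : 0 < p := by omega
                               exact_mod_cast this
  have hp1 : 1 ≤ p := by omega
  have hpr : (1 : ℝ) ≤ p := by exact_mod_cast hp1
  have hn : (p : ℝ) ^ θ ≤ nDim p θ := rpow_le_nDim p θ
  have hlog : 0 ≤ Real.log p := Real.log_natCast_nonneg p
  have hγle := rpow_neg_le_one hp1 hγ0
  refine (hammingSig_ShatSA_le (m := (p : ℝ) ^ (-γ) / 8) (one_le_nDim hp1 θ) hp (by positivity)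
    (rpow_neg_le_one hp1 hβ0.le) (by positivity) rfl ?_ (by positivity) (by linarith) ?_ ?_
    rfl).trans (le_of_eq ?_)
  · apply Real.sqrt_le_sqrt
    rw [pow_one] at h1
    linarith
  · have e1 : 4 * ((p : ℝ) ^ (-γ) / 8) * Real.sqrt p = (p : ℝ) ^ (-γ + 1 / 2) / 2 := by
      rw [Real.rpow_add hp0, ← Real.sqrt_eq_rpow]; ring
    have e2 : (p : ℝ) ^ (-α) * (p * (p : ℝ) ^ (-β) / 2) = (p : ℝ) ^ (-α + (1 + -β)) / 2 := by
      rw [Real.rpow_add hp0, Real.rpow_add hp0, Real.rpow_one]; ring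
    rw [e1, e2]
    have := Real.rpow_le_rpow_of_exponent_le hpr
      (by linarith : -γ + 1 / 2 ≤ -α + (1 + -β))
    linarith
  · refine (abs_le_of_sq_le_sq' ?_ (by positivity)).2
    rw [mul_pow, mul_pow, mul_pow, Real.sq_sqrt (by positivity), Real.sq_sqrt (by positivity)]
    have h3 : (p : ℝ) ^ (θ - 2 * α - 2 * γ) =
        (p : ℝ) ^ θ * ((p : ℝ) ^ (-α)) ^ 2 * ((p : ℝ) ^ (-γ)) ^ 2 := by
      rw [← Real.rpow_natCast, ← Real.rpow_mul hp0.le, ← Real.rpow_natCast,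
        ← Real.rpow_mul hp0.le, ← Real.rpow_add hp0, ← Real.rpow_add hp0]
      congr 1; push_cast; ring
    have h4 : (p : ℝ) ^ θ * ((p : ℝ) ^ (-α)) ^ 2 * ((p : ℝ) ^ (-γ)) ^ 2 ≤
        nDim p θ * ((p : ℝ) ^ (-α)) ^ 2 * ((p : ℝ) ^ (-γ)) ^ 2 := by gcongr
    rw [h3, pow_one] at h2
    rw [div_pow]
    linarith
  · simp only [hf, hg]; ring

/-- `η` is a unit vector of `V` maximizing `‖Y v‖` over the unit sphere of `V`. -/
def IsTopVector {E F : Type*} [NormedAddCommGroup E] [InnerProductSpace ℝ E]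
    [NormedAddCommGroup F] [InnerProductSpace ℝ F] (Y : E →ₗ[ℝ] F) (V : Submodule ℝ E)
    (η : E) : Prop :=
  η ∈ V ∧ ‖η‖ = 1 ∧ ∀ v ∈ V, ‖Y v‖ ^ 2 ≤ ‖Y η‖ ^ 2 * ‖v‖ ^ 2

section TopVector

variable {E F : Type*} [NormedAddCommGroup E] [InnerProductSpace ℝ E]
    [NormedAddCommGroup F] [InnerProductSpace ℝ F]

lemma norm_add_smul_sq (u w : E) (x : ℝ) :
    ‖u + x • w‖ ^ 2 = ‖u‖ ^ 2 + 2 * x * inner ℝ u w + x ^ 2 * ‖w‖ ^ 2 := by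
  rw [norm_add_sq_real, norm_smul, mul_pow, Real.norm_eq_abs, sq_abs, inner_smul_right]; ring

lemma eq_zero_of_forall_linear_le {a b : ℝ} (h : ∀ x : ℝ, 2 * x * a ≤ x ^ 2 * b) : a = 0 := by
  by_contra ha
  have hb : 0 < |b| + 1 := by positivity
  have h1 := h (a / (|b| + 1))
  have h2 : (a / (|b| + 1)) ^ 2 * b ≤ (a / (|b| + 1)) ^ 2 * (|b| + 1) := by
    gcongr; linarith [le_abs_self b]
  have h3 : (a / (|b| + 1)) ^ 2 * (|b| + 1) = a ^ 2 / (|b| + 1) := by field_simp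
  have h4 : 2 * (a / (|b| + 1)) * a = 2 * (a ^ 2 / (|b| + 1)) := by ring
  have h5 : 0 < a ^ 2 / (|b| + 1) := by positivity
  linarith

lemma IsTopVector.inner_eq {Y : E →ₗ[ℝ] F} {V : Submodule ℝ E} {η : E} (h : IsTopVector Y V η)
    {w : E} (hw : w ∈ V) : inner ℝ (Y η) (Y w) = ‖Y η‖ ^ 2 * inner ℝ η w := by
  obtain ⟨hη, h1, hmax⟩ := h
  rw [← sub_eq_zero]
  refine eq_zero_of_forall_linear_le (b := ‖Y η‖ ^ 2 * ‖w‖ ^ 2 - ‖Y w‖ ^ 2) fun x => ?_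
  have := hmax (η + x • w) (V.add_mem hη (V.smul_mem x hw))
  rw [map_add, map_smul, norm_add_smul_sq, norm_add_smul_sq, h1] at this
  linarith

variable {Y T : E →ₗ[ℝ] F} {ℓ : E} {μ : F} {p t r : ℝ}

lemma abs_inner_le_of_near_isometry (hT : ∀ v, |‖T v‖ ^ 2 - p * ‖v‖ ^ 2| ≤ t * ‖v‖ ^ 2)
    {u v : E} (huv : inner ℝ u v = 0) : |inner ℝ (T u) (T v)| ≤ t * (‖u‖ * ‖v‖) := by
  have key : ∀ u v : E, ‖u‖ = 1 → ‖v‖ = 1 → inner ℝ u v = 0 → |inner ℝ (T u) (T v)| ≤ t := by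
    intro u v hu hv huv
    have h1 := abs_le.1 (hT (u + (1 : ℝ) • v))
    have h2 := abs_le.1 (hT (u + (-1 : ℝ) • v))
    simp only [map_add, map_smul, norm_add_smul_sq, hu, hv, huv] at h1 h2
    exact abs_le.2 ⟨by linarith [h1.1, h2.2], by linarith [h1.2, h2.1]⟩
  rcases eq_or_ne u 0 with rfl | hu
  · simp
  rcases eq_or_ne v 0 with rfl | hv
  · simp
  have hu' : ‖u‖ ≠ 0 := norm_ne_zero_iff.2 hu
  have hv' : ‖v‖ ≠ 0 := norm_ne_zero_iff.2 hv
  have h := key (‖u‖⁻¹ • u) (‖v‖⁻¹ • v) (by simp [norm_smul, hu']) (by simp [norm_smul, hv'])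
    (by simp [inner_smul_left, inner_smul_right, huv])
  rw [map_smul, map_smul, real_inner_smul_left, real_inner_smul_right, abs_mul, abs_mul,
    abs_of_nonneg (by positivity), abs_of_nonneg (by positivity), inv_mul_le_iff₀ (by positivity),
    inv_mul_le_iff₀ (by positivity)] at h
  linarith

lemma norm_sq_spiked (hY : ∀ v, Y v = inner ℝ ℓ v • μ + T v) (v : E) :
    ‖Y v‖ ^ 2 = inner ℝ ℓ v ^ 2 * ‖μ‖ ^ 2 + 2 * inner ℝ ℓ v * inner ℝ μ (T v) + ‖T v‖ ^ 2 := by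
  rw [hY, add_comm, norm_add_smul_sq, real_inner_comm μ (T v)]; ring

lemma IsTopVector.le_norm_sq {V : Submodule ℝ E} {η ℓV : E} {m N : ℝ}
    (hY : ∀ v, Y v = inner ℝ ℓ v • μ + T v)
    (hT : ∀ v, |‖T v‖ ^ 2 - p * ‖v‖ ^ 2| ≤ t * ‖v‖ ^ 2)
    (hr : ∀ v, |inner ℝ μ (T v)| ≤ r * ‖v‖) (hμ : ‖μ‖ ^ 2 = m) (hm : 0 < m) (hN : 25 ≤ N)
    (ht : t ≤ m * N ^ 2 / 25) (hrm : r ≤ m * N / 25) (hη : IsTopVector Y V η) (hℓV : ℓV ∈ V)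
    (hin : inner ℝ ℓ ℓV = ‖ℓV‖ ^ 2) (hle : ‖ℓV‖ ≤ N) (hge : N ^ 2 - 1 ≤ ‖ℓV‖ ^ 2) :
    p + 4 / 5 * (m * N ^ 2) ≤ ‖Y η‖ ^ 2 := by
  set y := ‖ℓV‖ with hy
  have hy0 : 0 ≤ y := norm_nonneg _
  have hypos : 0 < y := by nlinarith
  have h1 := hη.2.2 ℓV hℓV
  rw [norm_sq_spiked hY, hin, hμ, ← hy] at h1
  have h2 := (abs_le.1 (hT ℓV)).1
  have h3 := (abs_le.1 (hr ℓV)).1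
  rw [← hy] at h2 h3
  have hr0 : 0 ≤ r := by
    have := (abs_nonneg _).trans (hr ℓV)
    rw [← hy] at this
    exact nonneg_of_mul_nonneg_left this hypos
  have h4 : y ^ 2 * (y ^ 2 * m - 2 * (r * y) + p - t) ≤ y ^ 2 * ‖Y η‖ ^ 2 := by
    nlinarith [mul_le_mul_of_nonneg_left h3 (by positivity : 0 ≤ 2 * y ^ 2)]
  have h5 := le_of_mul_le_mul_left h4 (by positivity)
  have h6 : r * y ≤ m * N / 25 * N := by gcongr
  have h7 : (N ^ 2 - 1) * m ≤ y ^ 2 * m := by gcongr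
  have h8 : m ≤ m * N ^ 2 / 25 := by nlinarith
  nlinarith

lemma IsTopVector.inner_sq_ge {V : Submodule ℝ E} {η : E} {m N : ℝ}
    (hY : ∀ v, Y v = inner ℝ ℓ v • μ + T v)
    (hT : ∀ v, |‖T v‖ ^ 2 - p * ‖v‖ ^ 2| ≤ t * ‖v‖ ^ 2)
    (hr : ∀ v, |inner ℝ μ (T v)| ≤ r * ‖v‖) (hμ : ‖μ‖ ^ 2 = m) (hℓ : ‖ℓ‖ = N)
    (ht : t ≤ m * N ^ 2 / 25) (hrm : r ≤ m * N / 25) (hη : IsTopVector Y V η)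
    (hge : p + 4 / 5 * (m * N ^ 2) ≤ ‖Y η‖ ^ 2) :
    |inner ℝ ℓ η| ≤ N ∧ 17 / 25 * (m * N ^ 2) ≤ inner ℝ ℓ η ^ 2 * m ∧
      ‖Y η‖ ^ 2 ≤ 2 * (m * N ^ 2) + p := by
  have h1 := hη.2.1
  have hc : |inner ℝ ℓ η| ≤ N := by
    simpa [h1, hℓ] using abs_real_inner_le_norm ℓ η
  have h2 := (abs_le.1 (hT η)).2
  have h3 := hr η
  rw [h1, mul_one] at h3
  rw [h1] at h2
  have h4 : inner ℝ ℓ η * inner ℝ μ (T η) ≤ N * (m * N / 25) := by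
    refine (le_abs_self _).trans ?_
    rw [abs_mul]
    exact mul_le_mul hc (h3.trans hrm) (abs_nonneg _) ((abs_nonneg _).trans hc)
  have h5 : inner ℝ ℓ η ^ 2 ≤ N ^ 2 := sq_le_sq.2 (hc.trans (le_abs_self _))
  have hm : 0 ≤ m := hμ ▸ sq_nonneg _
  have h6 : inner ℝ ℓ η ^ 2 * m ≤ N ^ 2 * m := by gcongr
  rw [norm_sq_spiked hY, hμ] at hge ⊢
  refine ⟨hc, ?_, ?_⟩
  · nlinarith
  · have : 0 ≤ m * N ^ 2 := by positivity
    nlinarith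

lemma IsTopVector.norm_sq_orthogonal_le {V : Submodule ℝ E} {η w : E}
    (hY : ∀ v, Y v = inner ℝ ℓ v • μ + T v)
    (hT : ∀ v, |‖T v‖ ^ 2 - p * ‖v‖ ^ 2| ≤ t * ‖v‖ ^ 2) (hη : IsTopVector Y V η)
    (hge : p + t ≤ ‖Y η‖ ^ 2) (hc : inner ℝ ℓ η ≠ 0) (hw : w ∈ V) (hηw : inner ℝ η w = 0) :
    ‖Y w‖ ^ 2 ≤ (p + t) * ‖w‖ ^ 2 := by
  set c := inner ℝ ℓ η
  set d := inner ℝ ℓ w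
  have hin := hη.inner_eq hw
  rw [hηw, mul_zero] at hin
  have hx : inner ℝ ℓ (d • η + (-c) • w) = 0 := by
    rw [inner_add_right, inner_smul_right, inner_smul_right]; simp only [c, d]; ring
  have h1 : ‖Y (d • η + (-c) • w)‖ ^ 2 = d ^ 2 * ‖Y η‖ ^ 2 + c ^ 2 * ‖Y w‖ ^ 2 := by
    rw [map_add, map_smul, map_smul, norm_add_smul_sq, real_inner_smul_left, hin, norm_smul,
      mul_pow, Real.norm_eq_abs, sq_abs]
    ring
  have h2 : ‖d • η + (-c) • w‖ ^ 2 = d ^ 2 + c ^ 2 * ‖w‖ ^ 2 := by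
    rw [norm_add_smul_sq, real_inner_smul_left, hηw, norm_smul, mul_pow, Real.norm_eq_abs, sq_abs,
      hη.2.1]
    ring
  have h3 := (abs_le.1 (hT (d • η + (-c) • w))).2
  rw [hY, hx, zero_smul, zero_add] at h1
  rw [h1, h2] at h3
  have h4 : c ^ 2 * ‖Y w‖ ^ 2 ≤ c ^ 2 * ((p + t) * ‖w‖ ^ 2) := by
    nlinarith [mul_le_mul_of_nonneg_left hge (sq_nonneg d)]
  exact le_of_mul_le_mul_left h4 (by positivity)

/-- Bound on the cross term between a unit vector `e` and its orthogonal complement. -/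
lemma abs_inner_spiked_le {e w : E} {m N : ℝ} (hY : ∀ v, Y v = inner ℝ ℓ v • μ + T v)
    (hT : ∀ v, |‖T v‖ ^ 2 - p * ‖v‖ ^ 2| ≤ t * ‖v‖ ^ 2)
    (hr : ∀ v, |inner ℝ μ (T v)| ≤ r * ‖v‖) (hμ : ‖μ‖ ^ 2 = m) (hm : 0 < m) (hℓ : ‖ℓ‖ = N)
    (hN : 25 ≤ N) (ht : t ≤ m * N ^ 2 / 25) (hrm : r ≤ m * N / 25)
    (he : ‖e‖ = 1) (hℓe : |inner ℝ ℓ e| = 1) (hew : inner ℝ e w = 0) :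
    |inner ℝ (Y e) (Y w)| ≤ 4 / 25 * (m * N ^ 2) * ‖w‖ := by
  have hd : |inner ℝ ℓ w| ≤ N * ‖w‖ := hℓ ▸ abs_real_inner_le_norm ℓ w
  have hTe : |inner ℝ μ (T e)| ≤ m * N / 25 := by
    simpa [he] using (hr e).trans (by rw [he, mul_one]; exact hrm)
  have hTw : |inner ℝ μ (T w)| ≤ m * N / 25 * ‖w‖ := (hr w).trans (by gcongr)
  have hTT : |inner ℝ (T e) (T w)| ≤ m * N ^ 2 / 25 * ‖w‖ := by
    have := abs_inner_le_of_near_isometry hT hew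
    rw [he, one_mul] at this
    exact this.trans (by gcongr)
  have heq : inner ℝ (Y e) (Y w) = inner ℝ ℓ e * inner ℝ ℓ w * m + inner ℝ ℓ e * inner ℝ μ (T w) +
      inner ℝ ℓ w * inner ℝ μ (T e) + inner ℝ (T e) (T w) := by
    rw [hY e, hY w, inner_add_left, inner_add_right, inner_add_right, real_inner_smul_left,
      real_inner_smul_left, inner_smul_right, inner_smul_right, real_inner_self_eq_norm_sq, hμ,
      real_inner_comm μ (T e)]
    ring
  generalize ‖w‖ = W, inner ℝ ℓ e = l, inner ℝ ℓ w = d at *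
  generalize inner ℝ μ (T e) = ue, inner ℝ μ (T w) = uw at *
  have hW : 0 ≤ W := nonneg_of_mul_nonneg_right ((abs_nonneg _).trans hd) (by linarith)
  have h1 : |l * d * m| ≤ N * W * m := by
    rw [abs_mul, abs_mul, hℓe, one_mul, abs_of_pos hm]; gcongr
  have h2 : |l * uw| ≤ m * N / 25 * W := by
    rw [abs_mul, hℓe, one_mul]; exact hTw
  have h3 : |d * ue| ≤ N * W * (m * N / 25) := by
    rw [abs_mul]; gcongr
  have h4 : m * W * N * 25 ≤ m * W * N * N := by gcongr
  have h5 : 0 ≤ m * W * N := by positivity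
  rw [heq]
  have k1 := abs_add_le (l * d * m + l * uw + d * ue) (inner ℝ (T e) (T w))
  have k2 := abs_add_le (l * d * m + l * uw) (d * ue)
  have k3 := abs_add_le (l * d * m) (l * uw)
  have e1 : N * W * m = m * W * N := by ring
  have e2 : m * N / 25 * W = m * W * N / 25 := by ring
  have e3 : N * W * (m * N / 25) = m * W * N * N / 25 := by ring
  have e4 : m * N ^ 2 / 25 * W = m * W * N * N / 25 := by ring
  have e5 : 4 / 25 * (m * N ^ 2) * W = 4 / 25 * (m * W * N * N) := by ring
  rw [e5]
  rw [e1] at h1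
  rw [e2] at h2
  rw [e3] at h3
  rw [e4] at hTT
  linarith

lemma leading_sign_of_pos {a c y B u v m N : ℝ} (hm : 0 < m) (hN : 25 ≤ N) (hy : y ≠ 0)
    (hc : 4 / 5 * N ≤ c) (hcN : c ≤ N) (hu : |u| ≤ m * N / 25) (hv : |v| ≤ 2 * (m * N) / 25)
    (hB : |B| ≤ N * (4 / 19 * |y|)) (h : m * N ^ 2 / 2 * y ^ 2 ≤ a * (c * m + u + v) * y) :
    0 < (y + a * c + B) * y := by
  have hu' := abs_le.1 hu
  have hv' := abs_le.1 hv
  have hy2 : 0 < y ^ 2 := by positivity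
  have hmN : 0 < m * N := by nlinarith
  have hg1 : 0 < c * m + u + v := by
    have : 4 / 5 * N * m ≤ c * m := by gcongr
    nlinarith
  have hg2 : c * m + u + v ≤ 28 / 25 * (m * N) := by
    have : c * m ≤ N * m := by gcongr
    nlinarith
  have hk0 : 0 < a * y := by
    have h1 : 0 < m * N ^ 2 / 2 * y ^ 2 := by positivity
    have h2 : a * (c * m + u + v) * y = (a * y) * (c * m + u + v) := by ring
    exact pos_of_mul_pos_left (h2 ▸ h1.trans_le h) hg1.le
  have hk : 25 / 56 * N * y ^ 2 ≤ a * y := by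
    have h1 : (a * y) * (c * m + u + v) ≤ (a * y) * (28 / 25 * (m * N)) := by gcongr
    refine le_of_mul_le_mul_left ?_ hmN
    nlinarith
  have hkc : 25 / 56 * N * y ^ 2 * (4 / 5 * N) ≤ a * y * c := by gcongr
  have hBy : -(N * (4 / 19) * y ^ 2) ≤ B * y := by
    have h1 : |B * y| ≤ N * (4 / 19) * y ^ 2 := by
      rw [abs_mul, ← sq_abs y]
      nlinarith [abs_nonneg y]
    exact (abs_le.1 h1).1
  have hNN : N * y ^ 2 * 25 ≤ N * y ^ 2 * N := by gcongr
  have : 0 < N * y ^ 2 := by positivity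
  nlinarith

lemma leading_sign {a c x l B b u v m N : ℝ} (hm : 0 < m) (hN : 25 ≤ N) (hx : x ≠ 0)
    (hl : l ^ 2 = 1)
    (hc : 4 / 5 * N ≤ |c|) (hcN : |c| ≤ N) (hu : |u| ≤ m * N / 25) (hv : |v| ≤ 2 * (m * N) / 25)
    (hB : |B| ≤ N * (4 / 19 * |x|)) (hb : b = l * (c * m + u) + v)
    (h : m * N ^ 2 / 2 * x ^ 2 ≤ a * b * x) :
    0 < (x * l + a * c + B) * (l * x) := by
  have hl1 : |l| = 1 := (sq_eq_sq₀ (abs_nonneg l) zero_le_one).1 (by rw [sq_abs, hl, one_pow])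
  have hl0 : l ≠ 0 := by rintro rfl; simp at hl
  have hyx : |l * x| = |x| := by rw [abs_mul, hl1, one_mul]
  have hlv : |l * v| ≤ 2 * (m * N) / 25 := by rwa [abs_mul, hl1, one_mul]
  have h' : m * N ^ 2 / 2 * (l * x) ^ 2 ≤ a * (c * m + u + l * v) * (l * x) := by
    have e : a * b * x = a * (c * m + u + l * v) * (l * x) := by
      rw [hb]; linear_combination (-(a * v * x)) * hl
    rw [← e, mul_pow, hl, one_mul]; exact h
  rw [mul_comm x l]
  rcases abs_cases c with ⟨hc', -⟩ | ⟨hc', -⟩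
  · rw [hc'] at hc hcN
    exact leading_sign_of_pos hm hN (mul_ne_zero hl0 hx) hc hcN hu hlv (by rwa [hyx]) h'
  · rw [hc'] at hc hcN
    have := leading_sign_of_pos (a := -a) (B := B) (u := -u) (v := -(l * v)) hm hN
      (mul_ne_zero hl0 hx)
      hc hcN (by rwa [abs_neg]) (by rwa [abs_neg]) (by rwa [hyx]) (by linarith)
    linarith

set_option maxHeartbeats 1000000 in
/-- The leave-one-out comparison: the leading vector has the right sign in direction `e`. -/
lemma IsTopVector.mul_inner_pos {ξ η e : E} {m N s : ℝ}
    (hY : ∀ v, Y v = inner ℝ ℓ v • μ + T v)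
    (hT : ∀ v, |‖T v‖ ^ 2 - p * ‖v‖ ^ 2| ≤ t * ‖v‖ ^ 2)
    (hr : ∀ v, |inner ℝ μ (T v)| ≤ r * ‖v‖) (hμ : ‖μ‖ ^ 2 = m) (hm : 0 < m) (hℓ : ‖ℓ‖ = N)
    (hN : 25 ≤ N) (ht : t ≤ m * N ^ 2 / 25) (hrm : r ≤ m * N / 25)
    (hs : s ^ 2 * (2 * (m * N ^ 2) + p) ≤ (2 * (m * N) / 25) ^ 2)
    (he : ‖e‖ = 1) (hℓe : inner ℝ ℓ e ^ 2 = 1)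
    (hη : IsTopVector Y (ℝ ∙ e)ᗮ η) (hs' : |inner ℝ (T e) (Y η)| ≤ s * ‖Y η‖)
    (hξ : IsTopVector Y ⊤ ξ) :
    0 < inner ℝ ξ ℓ * (inner ℝ ℓ e * inner ℝ ξ e) := by
  obtain ⟨l, hl⟩ : ∃ l : ℝ, l = inner ℝ ℓ e := ⟨_, rfl⟩
  rw [← hl] at hℓe ⊢
  have hlabs : |l| = 1 := (sq_eq_sq₀ (abs_nonneg l) zero_le_one).1 (by rw [sq_abs, hℓe, one_pow])
  have memV : ∀ v : E, v ∈ (ℝ ∙ e)ᗮ ↔ inner ℝ e v = 0 := fun v =>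
    Submodule.mem_orthogonal_singleton_iff_inner_right
  have hN0 : 0 < N := by linarith
  have hA : 0 < m * N ^ 2 := by positivity
  have hηe : inner ℝ e η = 0 := (memV η).1 hη.1
  have hlam : p + 4 / 5 * (m * N ^ 2) ≤ ‖Y η‖ ^ 2 := by
    have hin : inner ℝ ℓ (ℓ + (-l) • e) = N ^ 2 - 1 := by
      rw [inner_add_right, inner_smul_right, real_inner_self_eq_norm_sq, hℓ, ← hl]
      linarith
    have hnorm : ‖ℓ + (-l) • e‖ ^ 2 = N ^ 2 - 1 := by
      rw [norm_add_smul_sq, hℓ, he, ← hl]; linarith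
    refine hη.le_norm_sq (ℓV := ℓ + (-l) • e) hY hT hr hμ hm hN ht hrm ?_ (hin.trans hnorm.symm)
      ?_ hnorm.ge
    · rw [memV, inner_add_right, inner_smul_right, real_inner_self_eq_norm_sq, he,
        real_inner_comm, ← hl]
      ring
    · refine (abs_le_of_sq_le_sq' ?_ hN0.le).2
      linarith
  obtain ⟨hcN, hcm, hlam2⟩ := hη.inner_sq_ge hY hT hr hμ hℓ ht hrm hlam
  have hcN' : 4 / 5 * N ≤ |inner ℝ ℓ η| := by
    refine (abs_le_of_sq_le_sq' ?_ (abs_nonneg _)).2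
    rw [sq_abs]
    refine le_of_mul_le_mul_right ?_ hm
    nlinarith
  have hc0 : inner ℝ ℓ η ≠ 0 := abs_pos.1 (by linarith)
  obtain ⟨x, hx⟩ : ∃ x : ℝ, x = inner ℝ ξ e := ⟨_, rfl⟩
  obtain ⟨a, ha⟩ : ∃ a : ℝ, a = inner ℝ ξ η := ⟨_, rfl⟩
  obtain ⟨w, hw⟩ : ∃ w : E, w = ξ - x • e - a • η := ⟨_, rfl⟩
  have hξw : ξ = x • e + a • η + w := by rw [hw]; abel
  have hew : inner ℝ e w = 0 := by
    rw [hw, inner_sub_right, inner_sub_right, inner_smul_right, inner_smul_right, hηe,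
      real_inner_self_eq_norm_sq, he, real_inner_comm, ← hx]
    ring
  have hηw : inner ℝ η w = 0 := by
    rw [hw, inner_sub_right, inner_sub_right, inner_smul_right, inner_smul_right,
      real_inner_comm e η, hηe, real_inner_self_eq_norm_sq, hη.2.1, real_inner_comm, ← ha]
    ring
  have hξw2 : inner ℝ ξ w = ‖w‖ ^ 2 := by
    rw [hξw, inner_add_left, inner_add_left, real_inner_smul_left, real_inner_smul_left, hew, hηw,
      real_inner_self_eq_norm_sq]
    ring
  have hYηw : inner ℝ (Y η) (Y w) = 0 := by
    rw [hη.inner_eq ((memV w).2 hew), hηw, mul_zero]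
  have hLam : ‖Y η‖ ^ 2 ≤ ‖Y ξ‖ ^ 2 := by
    have := hξ.2.2 η trivial
    rwa [hη.2.1, one_pow, mul_one] at this
  have hQw : ‖Y w‖ ^ 2 ≤ (p + t) * ‖w‖ ^ 2 :=
    hη.norm_sq_orthogonal_le hY hT (by linarith) hc0 ((memV w).2 hew) hηw
  have hYξ : Y ξ = x • Y e + a • Y η + Y w := by
    rw [hξw, map_add, map_add, map_smul, map_smul]
  have hD := abs_inner_spiked_le hY hT hr hμ hm hℓ hN ht hrm he (hl ▸ hlabs) hew
  have hwx : ‖w‖ ≤ 4 / 19 * |x| := by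
    have h1 := hξ.inner_eq (Submodule.mem_top (x := w))
    rw [hξw2, hYξ, inner_add_left, inner_add_left, real_inner_smul_left, real_inner_smul_left,
      hYηw, real_inner_self_eq_norm_sq, ← hYξ] at h1
    have h2 : x * inner ℝ (Y e) (Y w) ≤ |x| * (4 / 25 * (m * N ^ 2) * ‖w‖) := by
      refine (le_abs_self _).trans ?_
      rw [abs_mul]; gcongr
    have h3 : 19 / 25 * (m * N ^ 2) ≤ ‖Y ξ‖ ^ 2 - (p + t) := by linarith
    have h4 := mul_le_mul_of_nonneg_right h3 (sq_nonneg ‖w‖)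
    rcases eq_or_ne ‖w‖ 0 with h0 | h0
    · rw [h0]; positivity
    · have hwpos : 0 < ‖w‖ := lt_of_le_of_ne (norm_nonneg _) h0.symm
      refine le_of_mul_le_mul_left (a := 19 / 25 * (m * N ^ 2) * ‖w‖) ?_ (by positivity)
      nlinarith
  have hb : inner ℝ (Y η) (Y e) =
      l * (inner ℝ ℓ η * m + inner ℝ μ (T η)) + inner ℝ (T e) (Y η) := by
    rw [real_inner_comm, hY e, inner_add_left, real_inner_smul_left, hY η, inner_add_right,
      inner_smul_right, real_inner_self_eq_norm_sq, hμ, ← hl]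
  have hu : |inner ℝ μ (T η)| ≤ m * N / 25 := by
    have := hr η
    rw [hη.2.1, mul_one] at this
    exact this.trans hrm
  have hv : |inner ℝ (T e) (Y η)| ≤ 2 * (m * N) / 25 := by
    refine hs'.trans ((abs_le_of_sq_le_sq' ?_ (by positivity)).2)
    rw [mul_pow]
    exact (mul_le_mul_of_nonneg_left hlam2 (sq_nonneg s)).trans hs
  have hYe : ‖Y e‖ ^ 2 ≤ p + t + 1 / 25 * (m * N ^ 2) := by
    rw [norm_sq_spiked hY, ← hl, hμ, hℓe]
    have h1 := (abs_le.1 (hT e)).2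
    have h2 : l * inner ℝ μ (T e) ≤ m * N / 25 := by
      refine (le_abs_self _).trans ?_
      rw [abs_mul, hlabs, one_mul]
      refine (hr e).trans ?_
      rwa [he, mul_one]
    rw [he] at h1
    have h3 : m * N * 25 ≤ m * N * N := by gcongr
    have h4 : m * 25 ≤ m * N := by gcongr
    nlinarith
  have habx : m * N ^ 2 / 2 * x ^ 2 ≤ a * inner ℝ (Y η) (Y e) * x := by
    have h1 := hξ.inner_eq (Submodule.mem_top (x := e))
    rw [← hx] at h1
    have h0 : inner ℝ (Y ξ) (Y e) =
        x * ‖Y e‖ ^ 2 + a * inner ℝ (Y η) (Y e) + inner ℝ (Y e) (Y w) := by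
      rw [hYξ, inner_add_left, inner_add_left, real_inner_smul_left, real_inner_smul_left,
        real_inner_self_eq_norm_sq, real_inner_comm (Y w) (Y e)]
    rw [h0] at h1
    have h2 : inner ℝ (Y e) (Y w) * x ≤ 4 / 25 * (m * N ^ 2) * (4 / 19 * |x|) * |x| := by
      refine (le_abs_self _).trans ?_
      rw [abs_mul]
      gcongr
      exact hD.trans (by gcongr)
    have h3 : 4 / 25 * (m * N ^ 2) * (4 / 19 * |x|) * |x| = 16 / 475 * (m * N ^ 2 * x ^ 2) := by
      rw [← sq_abs x]; ring
    have h4 : 18 / 25 * (m * N ^ 2) ≤ ‖Y ξ‖ ^ 2 - ‖Y e‖ ^ 2 := by linarith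
    have h5 := mul_le_mul_of_nonneg_right h4 (sq_nonneg x)
    have h6 : 0 ≤ m * N ^ 2 * x ^ 2 := by positivity
    have h7 : a * inner ℝ (Y η) (Y e) * x =
        (‖Y ξ‖ ^ 2 - ‖Y e‖ ^ 2) * x ^ 2 - inner ℝ (Y e) (Y w) * x := by
      linear_combination x * h1
    rw [h7]
    linarith
  have hx0 : x ≠ 0 := by
    rintro rfl
    rw [abs_zero, mul_zero] at hwx
    have hw0 : w = 0 := norm_le_zero_iff.1 hwx
    have h1 := hξ.inner_eq (Submodule.mem_top (x := e))
    rw [← hx, hYξ, hw0, zero_smul, map_zero, zero_add, add_zero, real_inner_smul_left, mul_zero]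
      at h1
    have ha0 : a ≠ 0 := by
      rintro rfl
      have := hξ.2.1
      rw [hξw, hw0] at this
      simp at this
    have hb0 := (mul_eq_zero.1 h1).resolve_left ha0
    rw [hb0] at hb
    have h2 : |inner ℝ ℓ η| * m = |l * inner ℝ μ (T η) + inner ℝ (T e) (Y η)| := by
      have h : inner ℝ ℓ η * m * l = -(l * inner ℝ μ (T η) + inner ℝ (T e) (Y η)) := by
        linear_combination -hb
      rw [← abs_neg (_ + _), ← h, abs_mul, abs_mul, hlabs, mul_one, abs_of_pos hm]
    have h3 := abs_add_le (l * inner ℝ μ (T η)) (inner ℝ (T e) (Y η))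
    rw [abs_mul, hlabs, one_mul] at h3
    have h4 : 4 / 5 * N * m ≤ |inner ℝ ℓ η| * m := by gcongr
    have : 0 < m * N := by positivity
    linarith
  have hfin : inner ℝ ξ ℓ = x * l + a * inner ℝ ℓ η + inner ℝ w ℓ := by
    rw [hξw, inner_add_left, inner_add_left, real_inner_smul_left, real_inner_smul_left,
      real_inner_comm ℓ e, ← hl, real_inner_comm ℓ η]
  rw [hfin, ← hx]
  refine leading_sign hm hN hx0 hℓe hcN' hcN hu hv ?_ hb habx
  have h1 := abs_real_inner_le_norm w ℓ
  rw [hℓ, mul_comm] at h1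
  exact h1.trans (by gcongr)

end TopVector

lemma exists_isTopVector {E F : Type*} [NormedAddCommGroup E] [InnerProductSpace ℝ E]
    [NormedAddCommGroup F] [InnerProductSpace ℝ F] [FiniteDimensional ℝ E] (Y : E →ₗ[ℝ] F)
    (V : Submodule ℝ E) (hV : V ≠ ⊥) : ∃ η, IsTopVector Y V η := by
  have : ProperSpace E := FiniteDimensional.proper ℝ E
  have hc : IsCompact (Metric.sphere (0 : E) 1 ∩ V) :=
    (isCompact_sphere 0 1).inter_right V.closed_of_finiteDimensional
  obtain ⟨v, hv, hv0⟩ := V.exists_mem_ne_zero_of_ne_bot hV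
  have hv0' : ‖v‖ ≠ 0 := norm_ne_zero_iff.2 hv0
  have hY : Continuous Y := Y.continuous_of_finiteDimensional
  obtain ⟨η, hη, hmax⟩ := hc.exists_isMaxOn (f := fun v => ‖Y v‖ ^ 2)
    ⟨‖v‖⁻¹ • v, by simp [norm_smul, hv0'], V.smul_mem _ hv⟩ (by fun_prop)
  refine ⟨η, hη.2, by simpa using hη.1, fun w hw => ?_⟩
  rcases eq_or_ne w 0 with rfl | hw0
  · simp
  have hw0' : 0 < ‖w‖ := norm_pos_iff.2 hw0
  have h := hmax (a := ‖w‖⁻¹ • w) ⟨by simp [norm_smul, hw0'.ne'], V.smul_mem _ hw⟩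
  simp only [Set.mem_ofPred_eq, map_smul, norm_smul, norm_inv, norm_norm] at h
  rwa [mul_pow, inv_pow, inv_mul_le_iff₀ (by positivity), mul_comm] at h

/-- The map `v ↦ X' v` between Euclidean spaces. -/
noncomputable def rowComb {n p : ℕ} (X : Fin n → Fin p → ℝ) :
    EuclideanSpace ℝ (Fin n) →ₗ[ℝ] EuclideanSpace ℝ (Fin p) where
  toFun v := WithLp.toLp 2 fun j => ∑ i, v i * X i j
  map_add' u v := by ext j; simp [add_mul, Finset.sum_add_distrib]
  map_smul' c v := by ext j; simp [Finset.mul_sum, mul_assoc]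

@[simp] lemma rowComb_apply {n p : ℕ} (X : Fin n → Fin p → ℝ) (v : EuclideanSpace ℝ (Fin n))
    (j : Fin p) : rowComb X v j = ∑ i, v i * X i j := rfl

lemma inner_euclidean {n : ℕ} (u v : EuclideanSpace ℝ (Fin n)) :
    inner ℝ u v = ∑ i, u i * v i := by
  rw [PiLp.inner_apply]
  exact Finset.sum_congr rfl fun i _ => by simp [mul_comm]

lemma inner_single_one {n : ℕ} (u : EuclideanSpace ℝ (Fin n)) (i : Fin n) :
    inner ℝ u (EuclideanSpace.single i (1 : ℝ)) = u i := by
  rw [inner_euclidean]; simp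

lemma inner_rowComb {n p : ℕ} (X : Fin n → Fin p → ℝ) (u v : EuclideanSpace ℝ (Fin n)) :
    inner ℝ (rowComb X u) (rowComb X v) = ∑ i, (gram X).mulVec u i * v i := by
  rw [inner_euclidean]
  simp only [rowComb_apply, Matrix.mulVec, dotProduct, gram, Matrix.of_apply, Finset.sum_mul,
    Finset.mul_sum]
  rw [Finset.sum_comm]
  simp_rw [Finset.sum_comm (s := (Finset.univ : Finset (Fin p)))]
  refine Finset.sum_congr rfl fun i _ => Finset.sum_congr rfl fun k _ =>
    Finset.sum_congr rfl fun j _ => by ring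

lemma IsTopEigenvector.isTopVector {n p : ℕ} {X : Fin n → Fin p → ℝ} {ξ : Fin n → ℝ}
    (h : IsTopEigenvector (gram X) ξ) : IsTopVector (rowComb X) ⊤ (WithLp.toLp 2 ξ) := by
  obtain ⟨h1, lam, hlam, hmax⟩ := h
  have hn1 : ‖WithLp.toLp 2 ξ‖ = 1 := by
    rw [EuclideanSpace.norm_eq]; simp [h1]
  have hne : (⊤ : Submodule ℝ (EuclideanSpace ℝ (Fin n))) ≠ ⊥ := by
    intro hbot
    have : WithLp.toLp 2 ξ ∈ (⊤ : Submodule ℝ (EuclideanSpace ℝ (Fin n))) := trivial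
    rw [hbot, Submodule.mem_bot] at this
    rw [this, norm_zero] at hn1
    exact zero_ne_one hn1
  have hξ : ‖rowComb X (WithLp.toLp 2 ξ)‖ ^ 2 = lam := by
    rw [← real_inner_self_eq_norm_sq, inner_rowComb]
    change ∑ i, (gram X).mulVec ξ i * ξ i = lam
    rw [hlam]
    simp only [Pi.smul_apply, smul_eq_mul, mul_assoc]
    rw [← Finset.mul_sum]
    simp_rw [← pow_two]
    rw [h1, mul_one]
  obtain ⟨η, hη⟩ := exists_isTopVector (rowComb X) ⊤ hne
  have hle : ‖rowComb X η‖ ^ 2 ≤ lam := by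
    refine hmax _ (fun i => η i) (fun h0 => ?_) ?_
    · have : η = 0 := by ext i; exact congrFun h0 i
      have h2 := hη.2.1
      rw [this, norm_zero] at h2
      exact zero_ne_one h2
    · ext i
      have h2 := hη.inner_eq (w := EuclideanSpace.single i 1) trivial
      rw [inner_rowComb, inner_euclidean] at h2
      simpa using h2
  refine ⟨trivial, hn1, fun v _ => ?_⟩
  rw [hξ]
  exact (hη.2.2 v trivial).trans (by gcongr)

/-- The event that the leading direction of the data with row `i` left out is nearly orthogonal
to the noise in row `i`. -/
def IsRowGeneric {n p : ℕ} (s : ℝ) (X Z : Fin n → Fin p → ℝ) (i : Fin n) : Prop :=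
  ∃ η, IsTopVector (rowComb X) (ℝ ∙ (EuclideanSpace.single i (1 : ℝ)))ᗮ η ∧
    |inner ℝ (rowComb Z (EuclideanSpace.single i 1)) (rowComb X η)| ≤ s * ‖rowComb X η‖

lemma sign_leading_eigenvector {n p : ℕ} {ℓ : Fin n → ℝ} {μ : Fin p → ℝ}
    {X Z : Fin n → Fin p → ℝ} {ξ : Fin n → ℝ} {t r s m : ℝ} (hℓ : IsLabel ℓ)
    (hX : X = fun i j => ℓ i * μ j + Z i j)
    (hT : ∀ v, |‖rowComb Z v‖ ^ 2 - p * ‖v‖ ^ 2| ≤ t * ‖v‖ ^ 2)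
    (hr : ∀ v, |inner ℝ (WithLp.toLp 2 μ) (rowComb Z v)| ≤ r * ‖v‖) (hμ : ∑ j, μ j ^ 2 = m)
    (hm : 0 < m) (hn : 25 ≤ Real.sqrt n) (ht : t ≤ m * n / 25) (hrm : r ≤ m * Real.sqrt n / 25)
    (hs : s ^ 2 * (2 * (m * n) + p) ≤ (2 * (m * Real.sqrt n) / 25) ^ 2)
    (hgen : ∀ i, IsRowGeneric s X Z i) (hξ : IsTopEigenvector (gram X) ξ) :
    ∃ σ : ℝ, (σ = 1 ∨ σ = -1) ∧ ∀ i, Real.sign (ξ i) = σ * ℓ i := by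
  have hY : ∀ v, rowComb X v = inner ℝ (WithLp.toLp 2 ℓ) v • WithLp.toLp 2 μ + rowComb Z v := by
    intro v
    ext j
    rw [inner_euclidean, rowComb_apply, hX]
    simp only [PiLp.add_apply, PiLp.smul_apply, smul_eq_mul, rowComb_apply, Finset.sum_mul]
    rw [← Finset.sum_add_distrib]
    exact Finset.sum_congr rfl fun i _ => by ring
  have hN2 : Real.sqrt n ^ 2 = n := Real.sq_sqrt (Nat.cast_nonneg n)
  have hℓN : ‖WithLp.toLp 2 ℓ‖ = Real.sqrt n := by
    rw [EuclideanSpace.norm_eq]; simp [hℓ.sum_sq]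
  have key : ∀ i, 0 < inner ℝ (WithLp.toLp 2 ξ) (WithLp.toLp 2 ℓ) * (ℓ i * ξ i) := by
    intro i
    obtain ⟨η, hη, hη'⟩ := hgen i
    have := hη.mul_inner_pos hY hT hr (m := m) (N := Real.sqrt n) (s := s)
      (by rw [EuclideanSpace.norm_sq_eq]; simpa using hμ) hm hℓN hn (by rwa [hN2]) hrm
      (by rwa [hN2]) (by simp) (by rw [inner_single_one]; exact hℓ.sq i) hη' hξ.isTopVector
    rwa [inner_single_one, inner_single_one] at this
  set I : ℝ := inner ℝ (WithLp.toLp 2 ξ) (WithLp.toLp 2 ℓ)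
  rcases lt_trichotomy I 0 with hI | hI | hI
  · refine ⟨-1, .inr rfl, fun i => ?_⟩
    have h := neg_of_mul_pos_right (key i) hI.le
    rcases hℓ i with h1 | h1 <;> rw [h1] at h ⊢
    · rw [Real.sign_of_neg (by linarith)]; norm_num
    · rw [Real.sign_of_pos (by linarith)]; norm_num
  · refine ⟨1, .inl rfl, fun i => ?_⟩
    have h := key i
    rw [hI, zero_mul] at h
    exact absurd h (lt_irrefl 0)
  · refine ⟨1, .inl rfl, fun i => ?_⟩
    have h := pos_of_mul_pos_right (key i) hI.le
    rcases hℓ i with h1 | h1 <;> rw [h1] at h ⊢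
    · rw [Real.sign_of_pos (by linarith)]; norm_num
    · rw [Real.sign_of_neg (by linarith)]; norm_num

lemma continuous_rowComb {Ω : Type*} [TopologicalSpace Ω] {n p : ℕ}
    {X : Ω → Fin n → Fin p → ℝ} {v : Ω → EuclideanSpace ℝ (Fin n)}
    (hX : Continuous X) (hv : Continuous v) : Continuous fun q => rowComb (X q) (v q) := by
  change Continuous fun q => WithLp.toLp 2 fun j => ∑ i, v q i * X q i j
  fun_prop

lemma isClosed_isRowGeneric {n p : ℕ} (s : ℝ) (M : Fin n → Fin p → ℝ) (i : Fin n) :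
    IsClosed {Z : Fin n → Fin p → ℝ | IsRowGeneric s (fun i j => M i j + Z i j) Z i} := by
  set V : Submodule ℝ (EuclideanSpace ℝ (Fin n)) := (ℝ ∙ (EuclideanSpace.single i (1 : ℝ)))ᗮ
  set K : Set (EuclideanSpace ℝ (Fin n)) := Metric.sphere 0 1 ∩ V
  have hK : CompactSpace K := isCompact_iff_compactSpace.1
    ((isCompact_sphere 0 1).inter_right V.closed_of_finiteDimensional)
  set X : (Fin n → Fin p → ℝ) → Fin n → Fin p → ℝ := fun Z i j => M i j + Z i j
  have hX : Continuous X := by fun_prop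
  set A : Set ((Fin n → Fin p → ℝ) × K) :=
    {q | (∀ v ∈ V, ‖rowComb (X q.1) v‖ ^ 2 ≤ ‖rowComb (X q.1) q.2‖ ^ 2 * ‖v‖ ^ 2) ∧
      |inner ℝ (rowComb q.1 (EuclideanSpace.single i 1)) (rowComb (X q.1) q.2)| ≤
        s * ‖rowComb (X q.1) q.2‖}
  have c1 : Continuous fun q : (Fin n → Fin p → ℝ) × K => rowComb (X q.1) q.2 :=
    continuous_rowComb (by fun_prop) (by fun_prop)
  have c2 : ∀ v, Continuous fun q : (Fin n → Fin p → ℝ) × K => rowComb (X q.1) v :=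
    fun v => continuous_rowComb (by fun_prop) (by fun_prop)
  have c3 : ∀ v, Continuous fun q : (Fin n → Fin p → ℝ) × K => rowComb q.1 v :=
    fun v => continuous_rowComb (by fun_prop) (by fun_prop)
  have hA : IsClosed A := by
    have h : A = (⋂ v ∈ V, {q : (Fin n → Fin p → ℝ) × K |
        ‖rowComb (X q.1) v‖ ^ 2 ≤ ‖rowComb (X q.1) q.2‖ ^ 2 * ‖v‖ ^ 2}) ∩
        {q | |inner ℝ (rowComb q.1 (EuclideanSpace.single i 1)) (rowComb (X q.1) q.2)| ≤
          s * ‖rowComb (X q.1) q.2‖} := by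
      ext q; simp [A]
    rw [h]
    refine (isClosed_iInter fun v => isClosed_iInter fun _ => ?_).inter ?_
    · exact isClosed_le ((c2 v).norm.pow 2) ((c1.norm.pow 2).mul continuous_const)
    · exact isClosed_le ((c3 _).inner c1).abs (continuous_const.mul c1.norm)
  convert isClosedMap_fst_of_compactSpace _ hA using 1
  ext Z
  constructor
  · rintro ⟨η, ⟨h1, h2, h3⟩, h4⟩
    exact ⟨(Z, ⟨η, by simpa using h2, h1⟩), ⟨h3, h4⟩, rfl⟩
  · rintro ⟨⟨Z, η⟩, ⟨h3, h4⟩, rfl⟩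
    exact ⟨η, ⟨η.2.2, by simpa using η.2.1, h3⟩, h4⟩

lemma gaussPi_abs_linear_tail {p : ℕ} (a : Fin p → ℝ) {t V : ℝ} (hV : 0 < V) (ht : 0 ≤ t)
    (ha : ∑ j, a j ^ 2 ≤ V) :
    gaussPi p {z | t ≤ |∑ j, a j * z j|} ≤
      ENNReal.ofReal (2 * Real.exp (-(t ^ 2 / (2 * V)))) := by
  rw [two_mul, ENNReal.ofReal_add (Real.exp_pos _).le (Real.exp_pos _).le]
  refine (measure_mono (t := {z | t ≤ ∑ j, a j * z j} ∪ {z | t ≤ ∑ j, -a j * z j}) ?_).trans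
    ((measure_union_le _ _).trans (add_le_add (gaussPi_linear_tail a hV ht ha)
      (gaussPi_linear_tail (fun j => -a j) hV ht (by simpa using ha))))
  intro z hz
  have hz' : t ≤ |∑ j, a j * z j| := hz
  rcases le_abs.1 hz' with h | h
  · exact .inl h
  · right
    simpa using h

lemma noiseLaw_not_isRowGeneric_le {n p : ℕ} (hn : 2 ≤ n) {s : ℝ} (hs : 0 ≤ s)
    (M : Fin n → Fin p → ℝ) (i : Fin n) :
    noiseLaw n p {Z | ¬ IsRowGeneric s (fun i j => M i j + Z i j) Z i} ≤
      ENNReal.ofReal (2 * Real.exp (-(s ^ 2 / 2))) := by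
  have hmeas : MeasurableSet {Z | ¬ IsRowGeneric s (fun i j => M i j + Z i j) Z i} :=
    (isClosed_isRowGeneric s M i).measurableSet.compl
  have hup := measurable_update_prod (E := Fin p → ℝ) i
  have hlaw : noiseLaw n p = ((noiseLaw n p).prod (gaussPi p)).map
      (fun q => Function.update q.1 i q.2) := (map_update_pi (fun _ => gaussPi p) i).symm
  rw [hlaw, Measure.map_apply hup hmeas, Measure.prod_apply (hup hmeas)]
  refine (lintegral_mono (g := fun _ => ENNReal.ofReal (2 * Real.exp (-(s ^ 2 / 2))))
    fun Z => ?_).trans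
    (by simp)
  set e : EuclideanSpace ℝ (Fin n) := EuclideanSpace.single i (1 : ℝ) with he
  have hmem : ∀ v ∈ (ℝ ∙ e)ᗮ, v i = 0 := by
    intro v hv
    rw [Submodule.mem_orthogonal_singleton_iff_inner_right, real_inner_comm, he,
      inner_single_one] at hv
    exact hv
  have hV : (ℝ ∙ e)ᗮ ≠ ⊥ := by
    have : Nontrivial (Fin n) := Fin.nontrivial_iff_two_le.2 hn
    obtain ⟨k, hk⟩ := exists_ne i
    intro h
    have : EuclideanSpace.single k (1 : ℝ) ∈ (ℝ ∙ e)ᗮ := by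
      rw [Submodule.mem_orthogonal_singleton_iff_inner_right, real_inner_comm, he,
        inner_single_one]
      simp [hk.symm]
    rw [h, Submodule.mem_bot] at this
    simpa using congrArg norm this
  obtain ⟨η, hη⟩ := exists_isTopVector (rowComb fun i j => M i j + Z i j) _ hV
  have hsame : ∀ z, ∀ v ∈ (ℝ ∙ e)ᗮ, rowComb (fun k j => M k j + Function.update Z i z k j) v =
      rowComb (fun i j => M i j + Z i j) v := by
    intro z v hv
    ext j
    simp only [rowComb_apply]
    refine Finset.sum_congr rfl fun k _ => ?_
    rcases eq_or_ne k i with rfl | hk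
    · rw [hmem v hv, zero_mul, zero_mul]
    · rw [Function.update_of_ne hk]
  set a := rowComb (fun i j => M i j + Z i j) η with ha
  have hsub : ∀ z, ¬ IsRowGeneric s (fun k j => M k j + Function.update Z i z k j)
      (Function.update Z i z) i → s * ‖a‖ < |∑ j, a j * z j| := by
    intro z hz
    by_contra hle
    refine hz ⟨η, ⟨hη.1, hη.2.1, fun v hv => ?_⟩, ?_⟩
    · rw [hsame z v hv, hsame z η hη.1]; exact hη.2.2 v hv
    · rw [hsame z η hη.1, inner_euclidean, ← ha]
      refine le_of_eq_of_le ?_ (not_lt.1 hle)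
      congr 1
      refine Finset.sum_congr rfl fun j _ => ?_
      rw [rowComb_apply, mul_comm (a j)]
      simp
  rcases eq_or_ne a 0 with h0 | h0
  · refine (measure_mono (t := ∅) fun z hz => ?_).trans (by simp)
    have := hsub z hz
    simp [h0] at this
  · have hpos : 0 < ‖a‖ := norm_pos_iff.2 h0
    refine (measure_mono (t := {z | s * ‖a‖ ≤ |∑ j, a j * z j|}) ?_).trans
      ((gaussPi_abs_linear_tail (fun j => a j) (V := ‖a‖ ^ 2) (by positivity)
        (by positivity) (by rw [EuclideanSpace.norm_sq_eq]; simp)).trans_eq ?_)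
    · intro z hz
      exact (hsub z hz).le
    · congr 4
      field_simp

/-- Near-isometry on a `1/8`-net extends to the whole space. -/
lemma near_isometry_of_net {E F : Type*} [NormedAddCommGroup E] [InnerProductSpace ℝ E]
    [NormedAddCommGroup F] [InnerProductSpace ℝ F] [FiniteDimensional ℝ E] (T : E →ₗ[ℝ] F)
    {p t : ℝ} (S : Set E) (hS : ∀ u : E, ‖u‖ = 1 → ∃ v ∈ S, ‖u - v‖ ≤ 1 / 8)
    (h : ∀ v ∈ S, |‖T v‖ ^ 2 - p * ‖v‖ ^ 2| ≤ t * ‖v‖ ^ 2) (ht : 0 ≤ t) (v : E) :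
    |‖T v‖ ^ 2 - p * ‖v‖ ^ 2| ≤ 2 * t * ‖v‖ ^ 2 := by
  rcases eq_or_ne v 0 with rfl | hv0
  · simp
  have hv0' : 0 < ‖v‖ := norm_pos_iff.2 hv0
  have : ProperSpace E := FiniteDimensional.proper ℝ E
  have hT : Continuous T := T.continuous_of_finiteDimensional
  obtain ⟨u, hu, hmax⟩ := (isCompact_sphere (0 : E) 1).exists_isMaxOn
    (f := fun v => |‖T v‖ ^ 2 - p * ‖v‖ ^ 2|) ⟨‖v‖⁻¹ • v, by simp [norm_smul, hv0'.ne']⟩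
    (by fun_prop)
  have hu1 : ‖u‖ = 1 := by simpa using hu
  obtain ⟨M, hM⟩ : ∃ M, M = |‖T u‖ ^ 2 - p * ‖u‖ ^ 2| := ⟨_, rfl⟩
  have hM0 : 0 ≤ M := hM ▸ abs_nonneg _
  have hall : ∀ w, |‖T w‖ ^ 2 - p * ‖w‖ ^ 2| ≤ M * ‖w‖ ^ 2 := by
    intro w
    rcases eq_or_ne w 0 with rfl | hw0
    · simp
    have hw0' : 0 < ‖w‖ := norm_pos_iff.2 hw0
    have h1 := hmax (a := ‖w‖⁻¹ • w) (by simp [norm_smul, hw0'.ne'])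
    simp only [Set.mem_ofPred_eq, map_smul, norm_smul, norm_inv, norm_norm, ← hM] at h1
    have h2 : ‖T w‖ ^ 2 - p * ‖w‖ ^ 2 =
        ‖w‖ ^ 2 * ((‖w‖⁻¹ * ‖T w‖) ^ 2 - p * (‖w‖⁻¹ * ‖w‖) ^ 2) := by
      field_simp
    rw [h2, abs_mul, abs_of_nonneg (by positivity), mul_comm]
    gcongr
  obtain ⟨w, hwS, hw⟩ := hS u hu1
  have hpol : ∀ a b : E, ‖a‖ ≤ 1 / 8 → ‖b‖ ≤ 17 / 8 →
      |inner ℝ (T a) (T b) - p * inner ℝ a b| ≤ 17 / 64 * M := by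
    intro a b ha hb
    have h1 := abs_le.1 (hall ((17 : ℝ) • a + b))
    have h2 := abs_le.1 (hall ((-17 : ℝ) • a + b))
    rw [add_comm, map_add, map_smul, norm_add_smul_sq, norm_add_smul_sq] at h1 h2
    have h3 := mul_le_mul_of_nonneg_left (pow_le_pow_left₀ (norm_nonneg _) ha 2) hM0
    have h4 := mul_le_mul_of_nonneg_left (pow_le_pow_left₀ (norm_nonneg _) hb 2) hM0
    rw [real_inner_comm (T b) (T a), real_inner_comm b a]
    exact abs_le.2 ⟨by nlinarith, by nlinarith⟩
  have hwn : ‖w‖ ≤ 9 / 8 := by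
    have := norm_sub_norm_le w u
    rw [norm_sub_rev] at this
    linarith
  have h1 := abs_le.1 (hpol (u - w) (u + w) hw ((norm_add_le _ _).trans (by linarith)))
  have h2 : inner ℝ (T (u - w)) (T (u + w)) - p * inner ℝ (u - w) (u + w) =
      (‖T u‖ ^ 2 - p * ‖u‖ ^ 2) - (‖T w‖ ^ 2 - p * ‖w‖ ^ 2) := by
    simp only [map_sub, map_add, inner_add_right, inner_sub_left, real_inner_self_eq_norm_sq]
    rw [real_inner_comm u w, real_inner_comm (T u) (T w)]
    ring
  rw [h2] at h1
  have h3 := abs_le.1 (h w hwS)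
  have h4 : t * ‖w‖ ^ 2 ≤ t * (9 / 8) ^ 2 := by gcongr
  have h5 : M ≤ t * (9 / 8) ^ 2 + 17 / 64 * M := by
    rw [hM]
    rw [hM] at h1
    exact abs_le.2 ⟨by linarith, by linarith⟩
  exact (hall v).trans (by gcongr; linarith)

/-- Lattice net of the unit sphere. -/
noncomputable def netPoint {n : ℕ} (c : Fin n → ℤ) : EuclideanSpace ℝ (Fin n) :=
  WithLp.toLp 2 fun i => c i / (4 * n)

lemma exists_netPoint {n : ℕ} (hn : 1 ≤ n) (u : EuclideanSpace ℝ (Fin n)) (hu : ‖u‖ = 1) :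
    ∃ c ∈ Fintype.piFinset fun _ : Fin n => Finset.Icc (-(4 * n : ℤ)) (4 * n),
      ‖u - netPoint c‖ ≤ 1 / 8 := by
  have hn' : (1 : ℝ) ≤ n := by exact_mod_cast hn
  have hui : ∀ i, |u i| ≤ 1 := fun i => by
    rw [← hu]; exact PiLp.norm_apply_le u i
  refine ⟨fun i => round (4 * n * u i), ?_, ?_⟩
  · rw [Fintype.mem_piFinset]
    intro i
    have h := abs_le.1 (hui i)
    have h1 := abs_le.1 (abs_sub_round (4 * n * u i))
    have h2 : 4 * n * u i ≤ 4 * n := by nlinarith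
    have h3 : -(4 * n) ≤ 4 * n * u i := by nlinarith
    rw [Finset.mem_Icc]
    constructor
    · have : (-(4 * n : ℤ) : ℝ) - 1 < round (4 * n * u i) := by push_cast; linarith
      have h4 : (-(4 * n : ℤ)) - 1 < round (4 * n * u i) := by exact_mod_cast this
      omega
    · have : (round (4 * n * u i) : ℝ) < (4 * n : ℤ) + 1 := by push_cast; linarith
      have h4 : round (4 * n * u i) < (4 * n : ℤ) + 1 := by exact_mod_cast this
      omega
  · refine (abs_le_of_sq_le_sq' ?_ (by norm_num)).2
    rw [EuclideanSpace.norm_sq_eq]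
    have h : ∀ i ∈ Finset.univ, ‖(u - netPoint fun i => round (4 * n * u i)) i‖ ^ 2 ≤
        (1 / (8 * n : ℝ)) ^ 2 := by
      intro i _
      have h1 : (u - netPoint fun i => round (4 * n * u i)) i =
          (4 * n * u i - round (4 * n * u i)) / (4 * n) := by
        simp only [netPoint, PiLp.sub_apply]
        field_simp
      rw [h1, Real.norm_eq_abs, abs_div, abs_of_pos (by positivity : (0 : ℝ) < 4 * n)]
      refine pow_le_pow_left₀ (by positivity) ?_ 2
      rw [div_le_div_iff₀ (by positivity) (by positivity)]
      have := abs_sub_round (4 * n * u i)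
      nlinarith
    refine (Finset.sum_le_sum h).trans ?_
    rw [Finset.sum_const, Finset.card_univ, Fintype.card_fin, nsmul_eq_mul, div_pow, div_pow,
      one_pow, mul_one_div, div_le_div_iff₀ (by positivity) (by positivity)]
    nlinarith

lemma noiseLaw_map_rowComb {n p : ℕ} (v : Fin n → ℝ) (hv : ∑ i, v i ^ 2 = 1) :
    (noiseLaw n p).map (fun Z j => ∑ i, v i * Z i j) = gaussPi p := by
  have h : (fun (Z : Fin n → Fin p → ℝ) (j : Fin p) => ∑ i, v i * Z i j) =
      (fun (W : Fin p → Fin n → ℝ) (j : Fin p) => ∑ i, v i * W j i) ∘ fun Z j i => Z i j := rfl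
  rw [h, ← Measure.map_map (by fun_prop) (by fun_prop), noiseLaw_map_transpose, noiseLaw]
  have hm : Measurable fun w : Fin n → ℝ => ∑ i, v i * w i := by fun_prop
  have := Measure.pi_map_pi (μ := fun _ : Fin p => gaussPi n)
    (f := fun _ (w : Fin n → ℝ) => ∑ i, v i * w i) (fun _ => hm.aemeasurable)
  rw [this]
  simp_rw [gaussPi_map_linear, hv, Real.toNNReal_one]
  rfl

lemma noiseLaw_norm_rowComb_le {n p : ℕ} (v : EuclideanSpace ℝ (Fin n)) {t : ℝ} (h0 : 0 ≤ t)
    (h1 : t ≤ p) :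
    noiseLaw n p {Z | ¬ |‖rowComb Z v‖ ^ 2 - p * ‖v‖ ^ 2| ≤ t * ‖v‖ ^ 2} ≤
      ENNReal.ofReal (2 * Real.exp (-(t ^ 2 / (8 * p)))) := by
  rcases eq_or_ne v 0 with rfl | hv0
  · simp
  have hv0' : 0 < ‖v‖ := norm_pos_iff.2 hv0
  have hu : ∑ i, (‖v‖⁻¹ * v i) ^ 2 = 1 := by
    simp_rw [mul_pow]
    rw [← Finset.mul_sum, inv_pow]
    have : ‖v‖ ^ 2 = ∑ i, v i ^ 2 := by rw [EuclideanSpace.norm_sq_eq]; simp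
    rw [← this]
    field_simp
  have hm : Measurable fun (Z : Fin n → Fin p → ℝ) (j : Fin p) => ∑ i, ‖v‖⁻¹ * v i * Z i j := by
    fun_prop
  rw [two_mul, ENNReal.ofReal_add (Real.exp_pos _).le (Real.exp_pos _).le]
  refine le_trans ?_ (add_le_add (gaussPi_sq_tail (σ := 1) (.inl rfl) h0 h1)
    (gaussPi_sq_tail (σ := -1) (.inr rfl) h0 h1))
  refine le_trans ?_ (measure_union_le _ _)
  rw [← noiseLaw_map_rowComb (p := p) (fun i => ‖v‖⁻¹ * v i) hu]
  refine le_trans (measure_mono ?_) (Measure.le_map_apply hm.aemeasurable _)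
  intro Z hZ
  have hZ' : t * ‖v‖ ^ 2 < |‖rowComb Z v‖ ^ 2 - p * ‖v‖ ^ 2| := not_le.1 hZ
  have hT : ‖rowComb Z v‖ ^ 2 - p * ‖v‖ ^ 2 =
      ‖v‖ ^ 2 * ∑ j, ((∑ i, ‖v‖⁻¹ * v i * Z i j) ^ 2 - 1) := by
    rw [EuclideanSpace.norm_sq_eq, Finset.sum_sub_distrib]
    simp_rw [mul_assoc, ← Finset.mul_sum, mul_pow]
    rw [← Finset.mul_sum]
    simp only [rowComb_apply, Real.norm_eq_abs, sq_abs, Finset.sum_const, Finset.card_univ,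
      Fintype.card_fin, nsmul_eq_mul, mul_one]
    field_simp
  rw [hT, abs_mul, abs_of_nonneg (by positivity), mul_comm t] at hZ'
  have h2 := lt_of_mul_lt_mul_left hZ' (by positivity)
  rcases lt_abs.1 h2 with h | h
  · left
    simpa using h.le
  · right
    simpa [← Finset.mul_sum] using h.le

lemma noiseLaw_not_near_isometry_le {n p : ℕ} (hn : 1 ≤ n) {t : ℝ} (h0 : 0 ≤ t) (h1 : t ≤ p) :
    noiseLaw n p {Z | ¬ ∀ v, |‖rowComb Z v‖ ^ 2 - p * ‖v‖ ^ 2| ≤ 2 * t * ‖v‖ ^ 2} ≤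
      ENNReal.ofReal (2 * Real.exp (n * Real.log (8 * n + 1) - t ^ 2 / (8 * p))) := by
  set N := Fintype.piFinset fun _ : Fin n => Finset.Icc (-(4 * n : ℤ)) (4 * n) with hN
  have hcard : (N.card : ℝ) = Real.exp (n * Real.log (8 * n + 1)) := by
    rw [← Real.log_pow, Real.exp_log (by positivity), hN, Fintype.card_piFinset]
    simp only [Int.card_Icc, Finset.prod_const, Finset.card_univ, Fintype.card_fin]
    have : (4 * (n : ℤ) + 1 - -(4 * n)).toNat = 8 * n + 1 := by omega
    rw [this]
    push_cast
    ring
  refine (measure_mono (t := ⋃ c ∈ N, {Z | ¬ |‖rowComb Z (netPoint c)‖ ^ 2 -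
    p * ‖netPoint c‖ ^ 2| ≤ t * ‖netPoint c‖ ^ 2}) ?_).trans ?_
  · intro Z hZ
    by_contra hcon
    refine hZ (near_isometry_of_net (rowComb Z) (netPoint '' N) (fun u hu => ?_) ?_ h0)
    · obtain ⟨c, hc, hc'⟩ := exists_netPoint hn u hu
      exact ⟨netPoint c, ⟨c, hc, rfl⟩, hc'⟩
    · rintro _ ⟨c, hc, rfl⟩
      by_contra hbad
      exact hcon (Set.mem_biUnion hc hbad)
  · refine (measure_biUnion_finset_le _ _).trans ((Finset.sum_le_sum fun c _ =>
      noiseLaw_norm_rowComb_le (netPoint c) h0 h1).trans_eq ?_)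
    rw [Finset.sum_const, nsmul_eq_mul, ← ENNReal.ofReal_natCast,
      ← ENNReal.ofReal_mul (by positivity),
      hcard, sub_eq_add_neg, Real.exp_add]
    congr 1
    ring

lemma abs_inner_rowComb_le {n p : ℕ} {Z : Fin n → Fin p → ℝ} {μ : Fin p → ℝ} {c : ℝ} (hc : 0 ≤ c)
    (h : ∀ i, |∑ j, μ j * Z i j| ≤ c) (v : EuclideanSpace ℝ (Fin n)) :
    |inner ℝ (WithLp.toLp 2 μ) (rowComb Z v)| ≤ c * Real.sqrt n * ‖v‖ := by
  have h1 : inner ℝ (WithLp.toLp 2 μ) (rowComb Z v) = ∑ i, v i * ∑ j, μ j * Z i j := by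
    rw [inner_euclidean]
    simp only [rowComb_apply, Finset.mul_sum]
    rw [Finset.sum_comm]
    exact Finset.sum_congr rfl fun i _ => Finset.sum_congr rfl fun j _ => by ring
  rw [h1]
  refine abs_le_of_sq_le_sq ?_ (by positivity)
  have h2 : ∑ i, (∑ j, μ j * Z i j) ^ 2 ≤ n * c ^ 2 := by
    refine (Finset.sum_le_sum fun i _ => sq_le_sq' (abs_le.1 (h i)).1
      (abs_le.1 (h i)).2).trans_eq ?_
    simp
  have h3 : ‖v‖ ^ 2 = ∑ i, v i ^ 2 := by rw [EuclideanSpace.norm_sq_eq]; simp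
  refine (Finset.sum_mul_sq_le_sq_mul_sq _ _ _).trans ?_
  rw [mul_pow, mul_pow, Real.sq_sqrt (Nat.cast_nonneg n), ← h3]
  nlinarith [mul_le_mul_of_nonneg_left h2 (sq_nonneg ‖v‖)]

lemma noiseLaw_not_sign_leading_le {n p : ℕ} {ℓ : Fin n → ℝ} {μ : Fin p → ℝ} {m s t : ℝ}
    (hℓ : IsLabel ℓ) (hμ : ∑ j, μ j ^ 2 = m) (hm : 0 < m) (hn : 25 ≤ Real.sqrt n) (hs0 : 0 ≤ s)
    (ht0 : 0 ≤ t) (htp : t ≤ p) (ht : 2 * t ≤ m * n / 25) (hsm : 625 * s ^ 2 ≤ m)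
    (hsp : 625 * (s ^ 2 * p) ≤ 2 * (m ^ 2 * n))
    (ξsel : (Fin n → Fin p → ℝ) → Fin n → ℝ) (hξ : ∀ X, IsTopEigenvector (gram X) (ξsel X)) :
    noiseLaw n p {Z | ¬ ∃ σ : ℝ, (σ = 1 ∨ σ = -1) ∧
        ∀ i, Real.sign (ξsel (fun i j => ℓ i * μ j + Z i j) i) = σ * ℓ i} ≤
      ENNReal.ofReal (2 * Real.exp (n * Real.log (8 * n + 1) - t ^ 2 / (8 * p)) +
        n * (4 * Real.exp (-(s ^ 2 / 2)))) := by
  have hN2 : Real.sqrt n ^ 2 = n := Real.sq_sqrt (Nat.cast_nonneg n)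
  have hnr : (2 : ℝ) ≤ n := by nlinarith
  have hn2 : 2 ≤ n := by exact_mod_cast hnr
  have hM2 : Real.sqrt m ^ 2 = m := Real.sq_sqrt hm.le
  have hM0 : 0 < Real.sqrt m := Real.sqrt_pos.2 hm
  set A : Set (Fin n → Fin p → ℝ) :=
    {Z | ¬ ∀ v, |‖rowComb Z v‖ ^ 2 - p * ‖v‖ ^ 2| ≤ 2 * t * ‖v‖ ^ 2}
  set B : Fin n → Set (Fin n → Fin p → ℝ) :=
    fun i => {Z | Z i ∈ {z | s * Real.sqrt m ≤ |∑ j, μ j * z j|}}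
  set C : Fin n → Set (Fin n → Fin p → ℝ) :=
    fun i => {Z | ¬ IsRowGeneric s (fun i j => ℓ i * μ j + Z i j) Z i}
  have hB : ∀ i, noiseLaw n p (B i) ≤ ENNReal.ofReal (2 * Real.exp (-(s ^ 2 / 2))) := by
    intro i
    refine (noiseLaw_row_le i _).trans ((gaussPi_abs_linear_tail μ hm (by positivity)
      hμ.le).trans_eq ?_)
    rw [mul_pow, hM2]
    congr 4
    field_simp
  have hC : ∀ i, noiseLaw n p (C i) ≤ ENNReal.ofReal (2 * Real.exp (-(s ^ 2 / 2))) := fun i =>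
    noiseLaw_not_isRowGeneric_le hn2 hs0 (fun i j => ℓ i * μ j) i
  refine (measure_mono (t := A ∪ ⋃ i, (B i ∪ C i)) ?_).trans ?_
  · intro Z hZ
    by_contra hcon
    rw [Set.mem_union, Set.mem_iUnion, not_or, not_exists] at hcon
    obtain ⟨hA, hBC⟩ := hcon
    refine hZ (sign_leading_eigenvector (t := 2 * t) (r := s * Real.sqrt m * Real.sqrt n) (s := s)
      hℓ rfl (not_not.1 hA) (abs_inner_rowComb_le (by positivity) fun i => ?_) hμ hm hn ht ?_ ?_
      (fun i => ?_) (hξ _))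
    · exact (not_le.1 fun h => hBC i (.inl h)).le
    · have h1 : 25 * s ≤ Real.sqrt m := by
        refine (abs_le_of_sq_le_sq' ?_ hM0.le).2
        rw [hM2, mul_pow]; linarith
      have h2 : 25 * s * (Real.sqrt m * Real.sqrt n) ≤
          Real.sqrt m * (Real.sqrt m * Real.sqrt n) := by gcongr
      have h3 : Real.sqrt m * (Real.sqrt m * Real.sqrt n) = m * Real.sqrt n := by
        rw [← mul_assoc, ← pow_two, hM2]
      linarith
    · rw [div_pow, mul_pow, mul_pow, hN2]
      have h1 : 625 * s ^ 2 * (m * n) ≤ m * (m * n) := by gcongr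
      nlinarith
    · exact not_not.1 fun h => hBC i (.inr h)
  · refine (measure_union_le _ _).trans ?_
    rw [ENNReal.ofReal_add (by positivity) (by positivity)]
    refine add_le_add (noiseLaw_not_near_isometry_le (by omega) ht0 htp) ?_
    refine (measure_iUnion_fintype_le _ _).trans ((Finset.sum_le_sum fun i _ =>
      (measure_union_le _ _).trans (add_le_add (hB i) (hC i))).trans_eq ?_)
    rw [Finset.sum_const, Finset.card_univ, Fintype.card_fin, nsmul_eq_mul,
      ← ENNReal.ofReal_add (by positivity) (by positivity), ← ENNReal.ofReal_natCast,
      ← ENNReal.ofReal_mul (by positivity)]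
    congr 1
    ring

lemma IsSignal.sum_sq {p : ℕ} {τ : ℝ} {μ : Fin p → ℝ} (h : IsSignal τ μ) :
    ∑ j, μ j ^ 2 = τ * ∑ j, μ j := by
  rw [Finset.mul_sum]
  refine Finset.sum_congr rfl fun j _ => ?_
  rcases h j with h | h <;> rw [h] <;> ring

/-- Nonasymptotic Hamming bound for thresholding after classical PCA. -/
lemma hammingSig_ShatIF_le {n p : ℕ} {ε τ T m s t c₀ : ℝ} (hp : 1 ≤ p) (h0 : 0 < ε)
    (h1 : ε ≤ 1) (hτ : 0 < τ) (hT : T = Real.sqrt (2 * Real.log p)) (hn : 25 ≤ Real.sqrt n)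
    (hs0 : 0 ≤ s) (ht0 : 0 ≤ t) (htp : t ≤ p) (hm : m = τ * (τ * (p * ε / 2)))
    (ht : 2 * t ≤ m * n / 25) (hsm : 625 * s ^ 2 ≤ m)
    (hsp : 625 * (s ^ 2 * p) ≤ 2 * (m ^ 2 * n)) (hTn : 2 * T ≤ Real.sqrt n * τ)
    (hc₀ : c₀ = 2 * Real.exp (n * Real.log (8 * n + 1) - t ^ 2 / (8 * p)) +
        n * (4 * Real.exp (-(s ^ 2 / 2))) + 2 * Real.exp (-(T ^ 2 / 2)))
    (ξsel : (Fin n → Fin p → ℝ) → Fin n → ℝ)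
    (hξ : ∀ X, IsTopEigenvector (gram X) (ξsel X)) :
    hammingSig n p ε τ dataMap (fun X => ShatIF (ξsel X) X) ≤
      c₀ / ε + c₀ + 2 * (Real.exp (-(p * ε / 10)) / ε) := by
  have hsn : 0 < Real.sqrt n := by linarith
  have hsq : Real.sqrt n * Real.sqrt n = n := Real.mul_self_sqrt (Nat.cast_nonneg n)
  have hn' : (0 : ℝ) < n := by rw [← hsq]; positivity
  have hT0 : 0 ≤ T := by rw [hT]; positivity
  have hpr : (0 : ℝ) < p := by exact_mod_cast hp
  have hm0 : 0 < m := by rw [hm]; positivity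
  have hmem : ∀ (ξ : Fin n → ℝ) (X : Fin n → Fin p → ℝ) j, j ∈ ShatIF ξ X ↔
      T * Real.sqrt n ≤ |∑ i, X i j * Real.sign (ξ i)| := by
    intro ξ X j
    simp only [ShatIF, Finset.mem_filter, Finset.mem_univ, true_and]
    simp only [yIF]
    rw [abs_mul, abs_of_nonneg (inv_nonneg.2 hsn.le), le_inv_mul_iff₀ hsn, hT, mul_comm]
  have hbad : ∀ ℓ : Fin n → ℝ, IsLabel ℓ → ∀ μ : Fin p → ℝ, IsSignal τ μ →
      τ * (p * ε / 2) ≤ ∑ j, μ j → ∀ j, ∀ A : Set (Fin n → Fin p → ℝ),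
      (∀ Z ∈ A, (∃ σ : ℝ, (σ = 1 ∨ σ = -1) ∧
        ∀ i, Real.sign (ξsel (fun i j => ℓ i * μ j + Z i j) i) = σ * ℓ i) →
        T * Real.sqrt n ≤ |∑ i, ℓ i * Z i j|) → noiseLaw n p A ≤ ENNReal.ofReal c₀ := by
    intro ℓ hℓ μ hμ hsum j A hA
    have hle : m ≤ ∑ j, μ j ^ 2 := by
      rw [hμ.sum_sq, hm]; gcongr
    have hB := noiseLaw_not_sign_leading_le hℓ rfl (hm0.trans_le hle) hn hs0 ht0 htp
      (ht.trans (by gcongr)) (hsm.trans hle) (hsp.trans (by gcongr)) ξsel hξ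
    have hC := (noiseLaw_col_le (n := n) j _).trans
      (gaussPi_abs_linear_tail ℓ (t := T * Real.sqrt n) hn' (by positivity) hℓ.sum_sq.le)
    rw [mul_pow, pow_two (Real.sqrt n), hsq, mul_div_mul_right _ _ hn'.ne'] at hC
    rw [hc₀, ENNReal.ofReal_add (by positivity) (by positivity)]
    refine (measure_mono fun Z hZ => ?_).trans ((measure_union_le _ _).trans (add_le_add hB hC))
    exact or_iff_not_imp_left.2 fun h => hA Z hZ (not_not.1 h)
  have hsum : ∀ {ℓ ζ : Fin n → ℝ} {σ : ℝ}, (σ = 1 ∨ σ = -1) → (∀ i, ζ i = σ * ℓ i) →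
      ∀ x : Fin n → ℝ, |∑ i, x i * ζ i| = |∑ i, ℓ i * x i| := by
    intro ℓ ζ σ hσ h x
    have : ∑ i, x i * ζ i = σ * ∑ i, ℓ i * x i := by
      rw [Finset.mul_sum]
      exact Finset.sum_congr rfl fun i _ => by rw [h]; ring
    rw [this, abs_mul]
    rcases hσ with rfl | rfl <;> simp
  have hc : 0 ≤ c₀ := by rw [hc₀]; positivity
  refine hammingSig_le hp h0 h1 hτ hc hc _ ?_ ?_
  · intro ℓ hℓ μ hμ hμs j hj
    refine hbad ℓ hℓ μ hμ hμs j _ ?_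
    rintro Z hZ ⟨σ, hσ, h⟩
    simp only [Set.mem_ofPred_eq, hmem] at hZ
    rw [hsum hσ h] at hZ
    simpa only [hj, mul_zero, zero_add] using hZ
  · intro ℓ hℓ μ hμ hμs j hj
    refine hbad ℓ hℓ μ hμ hμs j _ ?_
    rintro Z hZ ⟨σ, hσ, h⟩
    simp only [Set.mem_ofPred_eq, hmem, not_le] at hZ
    rw [hsum hσ h] at hZ
    have e : ∑ i, ℓ i * (ℓ i * μ j + Z i j) = n * τ + ∑ i, ℓ i * Z i j := by
      rw [← hℓ.sum_sq, hj, Finset.sum_mul, ← Finset.sum_add_distrib]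
      exact Finset.sum_congr rfl fun i _ => by ring
    rw [e] at hZ
    have h2 := (abs_lt.1 hZ).2
    have h3 : 2 * T * Real.sqrt n ≤ n * τ := by
      calc _ ≤ Real.sqrt n * τ * Real.sqrt n := by gcongr
        _ = Real.sqrt n * Real.sqrt n * τ := by ring
        _ = _ := by rw [hsq]
    exact le_abs.2 (.inr (by linarith))

/-- The failure probability of classical PCA with the deviations used for consistency. -/
lemma pca_failure_le {N p : ℝ} (hN : 1 ≤ N) (hNp : N ≤ p) (hp : 18 ≤ p) :
    2 * Real.exp (N * Real.log (8 * N + 1) -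
        Real.sqrt (32 * p * N * Real.log p) ^ 2 / (8 * p)) +
      N * (4 * Real.exp (-(Real.sqrt (8 * Real.log p) ^ 2 / 2))) +
      2 * Real.exp (-(Real.sqrt (2 * Real.log p) ^ 2 / 2)) ≤ 5 * Real.exp (-Real.log p) := by
  have hp0 : 0 < p := by linarith
  have hL : 0 ≤ Real.log p := Real.log_nonneg (by linarith)
  rw [Real.sq_sqrt (by positivity), Real.sq_sqrt (by positivity), Real.sq_sqrt (by positivity)]
  have e1 : Real.exp (N * Real.log (8 * N + 1) - 32 * p * N * Real.log p / (8 * p)) ≤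
      Real.exp (-Real.log p) := by
    have h6 : Real.log (8 * N + 1) ≤ 2 * Real.log p := by
      rw [← Real.log_rpow hp0]
      refine Real.log_le_log (by positivity) ?_
      rw [Real.rpow_two]
      nlinarith
    have h7 : 32 * p * N * Real.log p / (8 * p) = 4 * (N * Real.log p) := by
      field_simp; ring
    have h8 : N * Real.log (8 * N + 1) ≤ N * (2 * Real.log p) := by gcongr
    have h9 : Real.log p ≤ N * Real.log p := le_mul_of_one_le_left hL hN
    rw [Real.exp_le_exp, h7]
    linarith
  have e2 : N * (4 * Real.exp (-(8 * Real.log p / 2))) ≤ Real.exp (-Real.log p) := by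
    have h6 : p ^ 3 * Real.exp (-(8 * Real.log p / 2)) = Real.exp (-Real.log p) := by
      nth_rewrite 1 [← Real.exp_log hp0]
      rw [← Real.exp_nat_mul, ← Real.exp_add]
      congr 1; push_cast; ring
    have h7 : N * 4 ≤ p ^ 3 := by nlinarith [mul_pos hp0 hp0]
    rw [← h6, ← mul_assoc]
    gcongr
  have e3 : Real.exp (-(2 * Real.log p / 2)) = Real.exp (-Real.log p) := by
    congr 1; ring
  linarith

/-- Success of thresholding after classical PCA. -/
lemma tendsto_hammingSig_ShatIF {α β θ : ℝ} (hα0 : 0 < α) (hβ0 : 0 < β) (hβ1 : β < 1)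
    (hθ0 : 0 < θ) (hθ1 : θ < 1) (hβ : (1 - θ) / 2 < β) (hα : α < (1 + θ - 2 * β) / 4)
    (ξsel : (p : ℕ) → (Fin (nDim p θ) → Fin p → ℝ) → Fin (nDim p θ) → ℝ)
    (hξ : ∀ p : ℕ, 1 ≤ p → ∀ X, IsTopEigenvector (gram X) (ξsel p X)) :
    Tendsto (fun p : ℕ => hammingSig (nDim p θ) p ((p : ℝ) ^ (-β)) ((p : ℝ) ^ (-α)) dataMap
      (fun X => ShatIF (ξsel p X) X)) atTop (nhds 0) := by
  set f : ℕ → ℝ := fun p => Real.log p with hf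
  have hfle : ∀ᶠ p : ℕ in atTop, 1 * Real.log p ≤ f p := .of_forall fun p => (one_mul _).le
  have hlim := (((tendsto_exp_neg_div_rpow (f := f) (β := β) hβ1 hfle).const_mul 5).add
    ((tendsto_exp_neg (f := f) one_pos hfle).const_mul 5)).add (tendsto_sparse_term hβ1)
  simp only [mul_zero, add_zero] at hlim
  refine squeeze_zero' (.of_forall fun p => hammingSig_nonneg _ _ _ (by positivity) _ _) ?_ hlim
  filter_upwards [eventually_log_le_rpow 8 1 (b := θ - 2 * α) (by linarith),
    eventually_log_mul_rpow_le 64 1 hθ1, eventually_log_le_rpow 625 0 hθ0,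
    eventually_log_le_rpow 10000 1 (b := 1 - β - 2 * α) (by linarith),
    eventually_log_le_rpow 320000 1 (b := 2 * (1 - β - 2 * α) + θ - 1) (by linarith),
    eventually_one_le_log, eventually_ge_atTop 18]
    with p h1 h2 h3 h4 h5 hl hp
  have hp1 : 1 ≤ p := by omega
  have hp18 : (18 : ℝ) ≤ p := by exact_mod_cast hp
  have hp0 : (0 : ℝ) < p := by linarith
  have hn : (p : ℝ) ^ θ ≤ nDim p θ := rpow_le_nDim p θ
  have hn2 := nDim_le hp1 hθ0.le
  have hn1 : (1 : ℝ) ≤ nDim p θ := by exact_mod_cast one_le_nDim hp1 θ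
  rw [pow_one] at h1 h2 h4 h5
  rw [Real.rpow_one] at h2
  rw [pow_zero, mul_one] at h3
  set N : ℝ := (nDim p θ : ℝ) with hN
  set L : ℝ := Real.log p with hL
  have hnp : N ≤ p := by
    have : (p : ℝ) ^ θ ≤ L * (p : ℝ) ^ θ := le_mul_of_one_le_left (by positivity) hl
    nlinarith
  have hs2 : Real.sqrt (8 * L) ^ 2 = 8 * L := Real.sq_sqrt (by positivity)
  have ht2 : Real.sqrt (32 * p * N * L) ^ 2 = 32 * p * N * L := Real.sq_sqrt (by positivity)
  have hτ2 : ((p : ℝ) ^ (-α)) * (p : ℝ) ^ (-α) = (p : ℝ) ^ (-(2 * α)) := by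
    rw [← Real.rpow_add hp0]; congr 1; ring
  have hm : (p : ℝ) ^ (-α) * ((p : ℝ) ^ (-α) * (p * (p : ℝ) ^ (-β) / 2)) =
      (p : ℝ) ^ (1 - β - 2 * α) / 2 := by
    rw [show 1 - β - 2 * α = -(2 * α) + (1 + -β) by ring, Real.rpow_add hp0, Real.rpow_add hp0,
      Real.rpow_one, ← hτ2]
    ring
  have hm2 : 320000 * L * p ≤ ((p : ℝ) ^ (1 - β - 2 * α)) ^ 2 * N := by
    have e : (p : ℝ) ^ (2 * (1 - β - 2 * α) + θ - 1) * p =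
        ((p : ℝ) ^ (1 - β - 2 * α)) ^ 2 * (p : ℝ) ^ θ := by
      rw [← Real.rpow_natCast, ← Real.rpow_mul hp0.le, ← Real.rpow_add hp0]
      nth_rewrite 2 [← Real.rpow_one (p : ℝ)]
      rw [← Real.rpow_add hp0]
      congr 1; push_cast; ring
    calc _ ≤ (p : ℝ) ^ (2 * (1 - β - 2 * α) + θ - 1) * p := by gcongr
      _ ≤ _ := by rw [e]; gcongr
  refine (hammingSig_ShatIF_le (s := Real.sqrt (8 * L)) (t := Real.sqrt (32 * p * N * L))
    hp1 (by positivity) (rpow_neg_le_one hp1 hβ0.le) (by positivity) rfl ?_ (Real.sqrt_nonneg _)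
    (Real.sqrt_nonneg _) ?_ rfl ?_ ?_ ?_ ?_ rfl (ξsel p) (hξ p hp1)).trans ?_
  · exact Real.le_sqrt_of_sq_le (by rw [show (25 : ℝ) ^ 2 = 625 by norm_num]; exact h3.trans hn)
  · refine (Real.sqrt_le_left hp0.le).2 ?_
    have : 32 * N * L ≤ p := by nlinarith
    nlinarith
  · rw [hm]
    refine (abs_le_of_sq_le_sq' ?_ (by positivity)).2
    rw [mul_pow, ht2, ← hN]
    have := mul_le_mul_of_nonneg_right hm2 (zero_le_one.trans hn1)
    calc _ = 128 * L * p * N := by ring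
      _ ≤ (320000 * L * p * N) / 2500 := by ring_nf; rfl
      _ ≤ (((p : ℝ) ^ (1 - β - 2 * α)) ^ 2 * N * N) / 2500 := by gcongr
      _ = _ := by ring
  · rw [hm, hs2]; linarith
  · rw [hm, hs2, ← hN, div_pow]; nlinarith
  · refine (abs_le_of_sq_le_sq' ?_ (by positivity)).2
    rw [mul_pow, mul_pow, Real.sq_sqrt (by positivity), Real.sq_sqrt (by positivity), pow_two _,
      pow_two ((p : ℝ) ^ (-α)), hτ2, ← hN]
    rw [sub_eq_add_neg, Real.rpow_add hp0] at h1
    have h6 : (p : ℝ) ^ θ * (p : ℝ) ^ (-(2 * α)) ≤ N * (p : ℝ) ^ (-(2 * α)) := by gcongr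
    linarith
  · have hc := pca_failure_le hn1 hnp hp18
    rw [← hL] at hc
    refine add_le_add (add_le_add ?_ hc) le_rfl
    exact (div_le_div_of_nonneg_right hc (by positivity)).trans_eq (mul_div_assoc _ _ _)

end ARWPaper

open ARWPaper Filter in
/-- CTUB for signal recovery. If `α < η̃^sig_θ(β)` then
(i) thresholding after Simple Aggregation succeeds for `0 < β < (1-θ)/2`,
(ii) thresholding after classical PCA succeeds for `(1-θ)/2 < β < 1/2`, and
(iii) χ²-screening with `q ≥ 3` succeeds for `1/2 < β < 1`. -/
theorem signal_recovery_ctub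
    (α β θ : ℝ) (hα0 : 0 < α) (hα1 : α < 1) (hβ0 : 0 < β) (hβ1 : β < 1)
    (hθ0 : 0 < θ) (hθ1 : θ < 1) (hmain : α < etaSigT θ β) :
    (β < (1 - θ) / 2 →
      Tendsto
        (fun p : ℕ =>
          hammingSig (nDim p θ) p ((p : ℝ) ^ (-β)) ((p : ℝ) ^ (-α)) dataMap ShatSA)
        atTop (nhds 0)) ∧
    ((1 - θ) / 2 < β → β < 1 / 2 →
      ∀ ξsel : (p : ℕ) → (Fin (nDim p θ) → Fin p → ℝ) → Fin (nDim p θ) → ℝ,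
        (∀ p : ℕ, 1 ≤ p → ∀ X, IsTopEigenvector (gram X) (ξsel p X)) →
        Tendsto
          (fun p : ℕ =>
            hammingSig (nDim p θ) p ((p : ℝ) ^ (-β)) ((p : ℝ) ^ (-α)) dataMap
              (fun X => ShatIF (ξsel p X) X))
          atTop (nhds 0)) ∧
    (1 / 2 < β →
      ∀ q : ℝ, 3 ≤ q →
        Tendsto
          (fun p : ℕ =>
            hammingSig (nDim p θ) p ((p : ℝ) ^ (-β)) ((p : ℝ) ^ (-α)) dataMap
              (fun X => chiSel q X))
          atTop (nhds 0)) := by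
  refine ⟨fun hβ => ?_, fun hβ hβ' ξsel hξ => ?_, fun hβ q hq => ?_⟩
  · rw [etaSigT, if_pos hβ] at hmain
    exact tendsto_hammingSig_ShatSA hα0 hβ0 hβ1 hθ0 hθ1 hβ hmain
  · rw [etaSigT, if_neg hβ.not_gt, if_pos hβ'] at hmain
    exact tendsto_hammingSig_ShatIF hα0 hβ0 hβ1 hθ0 hθ1 hβ hmain ξsel hξ
  · rw [etaSigT, if_neg (by linarith), if_neg hβ.not_gt] at hmain
    exact tendsto_hammingSig_chiSel hα0 hβ0 hβ1 hθ0 hq hmain
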